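/- arXiv:1507.01072 — 4 statements merged into one kernel-verified Lean document; each statement's English description precedes it below -/
import Mathlib

section
/- Let M be a unital C*-algebra with a faithful tracial state τ, let n ≥ 2, let (x₁, …, xₙ) be an L-free family in M with ‖xᵢ‖ ≤ 1 for all i, and let α₁, …, αₙ ∈ ℂ with Σ_{i=1}^n |αᵢ|² ≤ 1. Then ‖Σ_{i=1}^n αᵢ xᵢ‖ ≤ 2√(1 − 1/n). -/
open scoped BigOperators ComplexOrder

section Defs

variable {A : Type*} [Ring A] [StarRing A] [Algebra ℂ A]

/-- `τ` is a (ℂ-linear) tracial state on the unital star ℂ-algebra `A`. -/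
def IsTracialState (τ : A → ℂ) : Prop :=
  (∀ (c : ℂ) (x y : A), τ (c • x + y) = c * τ x + τ y) ∧
  τ 1 = 1 ∧ (∀ x : A, 0 ≤ τ (star x * x)) ∧ (∀ x y : A, τ (x * y) = τ (y * x))

/-- `τ` is faithful. -/
def IsFaithful (τ : A → ℂ) : Prop := ∀ x : A, τ (star x * x) = 0 → x = 0

def IsProjection (p : A) : Prop := star p = p ∧ p * p = p

def IsUnitary (u : A) : Prop := star u * u = 1 ∧ u * star u = 1

/-- The alternating word `x_{i 0} (x_{i 1})* x_{i 2} (x_{i 3})* ⋯`. -/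
def LWord {n m : ℕ} (x : Fin n → A) (i : Fin m → Fin n) : A :=
  (List.ofFn fun s : Fin m => if (s : ℕ) % 2 = 0 then x (i s) else star (x (i s))).prod

/-- The alternating word `(x_{i 0})* x_{i 1} (x_{i 2})* x_{i 3} ⋯`. -/
def LWordStar {n m : ℕ} (x : Fin n → A) (i : Fin m → Fin n) : A :=
  (List.ofFn fun s : Fin m => if (s : ℕ) % 2 = 0 then star (x (i s)) else x (i s)).prod

/-- L-freeness of a finite family with respect to `τ`. -/
def IsLFree {n : ℕ} (τ : A → ℂ) (x : Fin n → A) : Prop :=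
  ∀ (k : ℕ), 1 ≤ k → ∀ i : Fin (2 * k) → Fin n,
    (∀ s t : Fin (2 * k), (t : ℕ) = (s : ℕ) + 1 → i s ≠ i t) →
    τ (LWord x i) = 0 ∧ τ (LWordStar x i) = 0

/-- Integer powers of a unitary: negative powers are powers of the adjoint. -/
def zpowU (u : A) (k : ℤ) : A := if 0 ≤ k then u ^ k.toNat else star u ^ (-k).toNat

/-- `v₁, …, v_m` are freely independent Haar unitaries with respect to `τ`. -/
def AreHaarFree {m : ℕ} (τ : A → ℂ) (v : Fin m → A) : Prop :=
  ∀ (r : ℕ), 1 ≤ r → ∀ (i : Fin r → Fin m) (e : Fin r → ℤ),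
    (∀ s, e s ≠ 0) → (∀ s t : Fin r, (t : ℕ) = (s : ℕ) + 1 → i s ≠ i t) →
    τ ((List.ofFn fun s : Fin r => zpowU (v (i s)) (e s)).prod) = 0

/-- `X` and `Y` are freely independent sets with respect to `τ`: every alternating
word with letters from `X` and `Y` has zero trace. -/
def FreeSets (τ : A → ℂ) (X Y : Set A) : Prop :=
  ∀ (m : ℕ), 1 ≤ m → ∀ z : Fin m → A,
    ((∀ s : Fin m, if (s : ℕ) % 2 = 0 then z s ∈ X else z s ∈ Y) ∨
     (∀ s : Fin m, if (s : ℕ) % 2 = 0 then z s ∈ Y else z s ∈ X)) →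
    τ ((List.ofFn z).prod) = 0

end Defs


namespace LFreeProof

section Growth

theorem form_growth {V : Type*} [AddCommGroup V] [Module ℝ V]
    (B : V →ₗ[ℝ] V →ₗ[ℝ] ℝ) (hsymm : ∀ u v, B u v = B v u) (hpos : ∀ v, 0 ≤ B v v)
    (y : V →ₗ[ℝ] V) (hy : ∀ u v, B (y u) v = B u (y v))
    (N : V → ℝ) (D c : ℝ) (hD : 0 ≤ D) (hc : 0 < c) (hBN : ∀ v, B v v ≤ D * N v)
    (hN : ∀ v, N (y v) ≤ c * N v) (v : V) : B (y v) (y v) ≤ c * B v v := by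
  have hcs : ∀ u w, (B u w) ^ 2 ≤ B u u * B w w := by
    intro u w
    have h : ∀ t : ℝ, 0 ≤ B w w * (t * t) + (2 * B u w) * t + B u u := by
      intro t
      have := hpos (u + t • w)
      simp only [map_add, map_smul, LinearMap.add_apply, LinearMap.smul_apply, smul_eq_mul] at this
      rw [hsymm w u] at this
      linarith
    have := discrim_le_zero h
    rw [discrim] at this
    nlinarith
  set f : ℕ → ℝ := fun k => B ((y ^ k) v) ((y ^ k) v) with hf
  have hys : ∀ k, (y ^ (k+1)) v = y ((y ^ k) v) := fun k => by rw [pow_succ']; rfl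
  have hf0 : ∀ k, 0 ≤ f k := fun k => hpos _
  have hlog : ∀ k, f (k+1) ^ 2 ≤ f k * f (k+2) := by
    intro k
    have h := hcs ((y ^ k) v) ((y ^ (k+2)) v)
    have e : B ((y ^ k) v) ((y ^ (k+2)) v) = f (k+1) := by
      simp only [hf]
      rw [hys (k+1), ← hy, ← hys k]
    rw [e] at h
    exact h
  have hNk : ∀ k, N ((y ^ k) v) ≤ c ^ k * N v := by
    intro k
    induction k with
    | zero => simp
    | succ k ih =>
      rw [hys]
      calc _ ≤ c * N ((y ^ k) v) := hN _
        _ ≤ c * (c ^ k * N v) := by gcongr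
        _ = _ := by ring
  have hfk : ∀ k, f k ≤ D * (c ^ k * N v) := fun k =>
    (hBN _).trans (mul_le_mul_of_nonneg_left (hNk k) hD)
  have e0 : B v v = f 0 := by simp [hf]
  have e1 : B (y v) (y v) = f 1 := by simp [hf]
  rw [e0, e1]
  by_contra! hlt
  have hf00 : 0 < f 0 := by
    rcases (hf0 0).lt_or_eq with h | h
    · exact h
    · have := hlog 0
      rw [← h] at this hlt
      simp at this hlt
      have h1 : f 1 = 0 := by nlinarith
      linarith
  set r := f 1 / f 0 with hr
  have hrc : c < r := by rw [hr, lt_div_iff₀ hf00]; exact hlt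
  have hr0 : 0 < r := hc.trans hrc
  have step : ∀ k, 0 < f k ∧ r * f k ≤ f (k+1) := by
    intro k
    induction k with
    | zero => exact ⟨hf00, by rw [hr]; field_simp; simp⟩
    | succ k ih =>
      have h1 : 0 < f (k+1) := lt_of_lt_of_le (mul_pos hr0 ih.1) ih.2
      refine ⟨h1, ?_⟩
      have h2 := hlog k
      have h3 : (r * f (k+1)) * f k ≤ f (k+2) * f k := by nlinarith [ih.2]
      exact le_of_mul_le_mul_right h3 ih.1
  have geo : ∀ k, r ^ k * f 0 ≤ f k := by
    intro k
    induction k with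
    | zero => simp
    | succ k ih =>
      calc r ^ (k+1) * f 0 = r * (r ^ k * f 0) := by ring
        _ ≤ r * f k := by gcongr
        _ ≤ _ := (step k).2
  obtain ⟨k, hk⟩ := pow_unbounded_of_one_lt (D * N v / f 0) ((one_lt_div hc).2 hrc)
  rw [div_lt_iff₀ hf00, div_pow, div_mul_eq_mul_div, lt_div_iff₀ (pow_pos hc k)] at hk
  have := geo k
  have := hfk k
  nlinarith

end Growth

section Kernel

variable {A : Type*} [CStarAlgebra A] {n : ℕ}

/-- letter followed by `m` letters -/
def letter (x : Fin n → A) (i : Fin n) (m : ℕ) : A := if m % 2 = 0 then x i else star (x i)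

def wd (x : Fin n → A) : List (Fin n) → A
  | [] => 1
  | i :: g => letter x i g.length * wd x g

def ker (x : Fin n → A) : List (Fin n) → List (Fin n) → A
  | [], h => wd x h
  | i :: g, [] => star (wd x (i :: g))
  | i :: g, j :: h => if i = j then ker x g h else star (wd x (i :: g)) * wd x (j :: h)

def lker (x : Fin n → A) (g h : List (Fin n)) : A := ker x g h - star (wd x g) * wd x h

theorem lker_of_ne (x : Fin n → A) (g h : List (Fin n)) (hne : g.head? ≠ h.head?) :
    lker x g h = 0 := by
  cases g with
  | nil => simp [lker, ker, wd]
  | cons i g =>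
    cases h with
    | nil => simp [lker, ker, wd]
    | cons j h =>
      have : i ≠ j := by simpa using hne
      simp [lker, ker, this]

theorem ker_of_ne (x : Fin n → A) (g h : List (Fin n)) (hne : g.head? ≠ h.head?) :
    ker x g h = star (wd x g) * wd x h := by
  have := lker_of_ne x g h hne
  rwa [lker, sub_eq_zero] at this

theorem lker_cons (x : Fin n → A) (i : Fin n) (g h : List (Fin n)) :
    lker x (i :: g) (i :: h) = lker x g h +
      star (wd x g) * (1 - star (letter x i g.length) * letter x i h.length) * wd x h := by
  simp only [lker, ker, wd, if_true, star_mul]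
  noncomm_ring

theorem ker_self (x : Fin n → A) (g : List (Fin n)) : ker x g g = 1 := by
  induction g with
  | nil => simp [ker, wd]
  | cons i g ih => simp [ker, ih]

theorem star_letter (x : Fin n → A) (i : Fin n) {a b : ℕ} (h : a % 2 ≠ b % 2) :
    star (letter x i a) = letter x i b := by
  unfold letter
  rcases Nat.mod_two_eq_zero_or_one a with h1 | h1 <;>
  rcases Nat.mod_two_eq_zero_or_one b with h2 | h2 <;> simp_all

theorem star_ker (x : Fin n → A) : ∀ g h : List (Fin n), star (ker x g h) = ker x h g
  | [], [] => by simp [ker, wd]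
  | [], j :: h => by simp [ker]
  | i :: g, [] => by simp [ker]
  | i :: g, j :: h => by
    by_cases e : i = j
    · subst e; simp [ker, star_ker x g h]
    · simp [ker, e, Ne.symm e]

theorem split_sum {ι κ E : Type*} [AddCommMonoid E] [Fintype κ] [DecidableEq κ] (s : Finset ι)
    (c : ι → κ) (F : ι → ι → E) :
    ∑ p ∈ s, ∑ q ∈ s, (if c p = c q then F p q else 0) =
      ∑ e : κ, ∑ p ∈ s.filter (fun p => c p = e), ∑ q ∈ s.filter (fun q => c q = e), F p q := by
  rw [← Finset.sum_fiberwise s c]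
  refine Finset.sum_congr rfl fun e _ => Finset.sum_congr rfl fun p hp => ?_
  rw [Finset.mem_filter] at hp
  rw [Finset.sum_filter, hp.2]
  refine Finset.sum_congr rfl fun q _ => ?_
  simp [eq_comm]

theorem sandwich {ι : Type*} (s : Finset ι) (z : ι → ℝ) (u : ι → A) (w : A) :
    ∑ p ∈ s, ∑ q ∈ s, (z p * z q) • (star (u p) * w * u q) =
      star (∑ p ∈ s, z p • u p) * w * (∑ p ∈ s, z p • u p) := by
  simp only [star_sum, Finset.sum_mul, Finset.mul_sum, star_smul, star_trivial]
  rw [Finset.sum_comm]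
  refine Finset.sum_congr rfl fun p _ => Finset.sum_congr rfl fun q _ => ?_
  simp only [smul_mul_assoc, mul_smul_comm, smul_smul]
  rw [mul_comm]

variable [PartialOrder A] [StarOrderedRing A]

theorem one_sub_letter (x : Fin n → A) (hx : ∀ i, ‖x i‖ ≤ 1) (i : Fin n) (m : ℕ) :
    0 ≤ 1 - star (letter x i m) * letter x i m := by
  have h : ‖letter x i m‖ ≤ 1 := by
    unfold letter; split_ifs
    · exact hx i
    · rw [norm_star]; exact hx i
  rw [sub_nonneg]
  rw [← CStarAlgebra.norm_le_one_iff_of_nonneg _ (star_mul_self_nonneg _)]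
  rw [CStarRing.norm_star_mul_self]
  nlinarith [norm_nonneg (letter x i m)]

theorem lker_psd (x : Fin n → A) (hx : ∀ i, ‖x i‖ ≤ 1) {ι : Type*} (z : ι → ℝ) (m : ℕ) :
    ∀ (s : Finset ι) (g : ι → List (Fin n)) (e : ℕ), (∀ p ∈ s, (g p).length ≤ m) →
      (∀ p ∈ s, (g p).length % 2 = e % 2) →
      0 ≤ ∑ p ∈ s, ∑ q ∈ s, (z p * z q) • lker x (g p) (g q) := by
  induction m with
  | zero =>
    intro s g e hl _
    refine (Finset.sum_eq_zero fun p hp => Finset.sum_eq_zero fun q hq => ?_).ge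
    have h1 : g p = [] := List.length_eq_zero_iff.1 (Nat.le_zero.1 (hl p hp))
    have h2 : g q = [] := List.length_eq_zero_iff.1 (Nat.le_zero.1 (hl q hq))
    simp [h1, h2, lker, ker, wd]
  | succ m ih =>
    intro s g e hl he
    have h1 : ∑ p ∈ s, ∑ q ∈ s, (z p * z q) • lker x (g p) (g q) =
        ∑ p ∈ s, ∑ q ∈ s, (if (g p).head? = (g q).head? then
          (z p * z q) • lker x (g p) (g q) else 0) := by
      refine Finset.sum_congr rfl fun p _ => Finset.sum_congr rfl fun q _ => ?_
      split_ifs with h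
      · rfl
      · rw [lker_of_ne x _ _ h, smul_zero]
    rw [h1, split_sum s (fun p => (g p).head?)]
    refine Finset.sum_nonneg fun o _ => ?_
    cases o with
    | none =>
      refine (Finset.sum_eq_zero fun p hp => Finset.sum_eq_zero fun q hq => ?_).ge
      have h1 : g p = [] := by simpa using (Finset.mem_filter.1 hp).2
      have h2 : g q = [] := by simpa using (Finset.mem_filter.1 hq).2
      simp [h1, h2, lker, ker, wd]
    | some i =>
      set t := s.filter (fun p => (g p).head? = some i) with ht
      have hg : ∀ p ∈ t, g p = i :: (g p).tail := by
        intro p hp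
        have := (Finset.mem_filter.1 hp).2
        cases hgp : g p with
        | nil => simp [hgp] at this
        | cons j l => simp [hgp] at this; simp [this]
      have hlen : ∀ p ∈ t, (g p).length = (g p).tail.length + 1 := by
        intro p hp
        conv_lhs => rw [hg p hp]
        simp
      have hpar : ∀ p ∈ t, (g p).tail.length % 2 = (e + 1) % 2 := by
        intro p hp
        have := hlen p hp
        have := he p (Finset.mem_filter.1 hp).1
        omega
      have h2 : ∑ p ∈ t, ∑ q ∈ t, (z p * z q) • lker x (g p) (g q) =
          ∑ p ∈ t, ∑ q ∈ t, (z p * z q) • lker x (g p).tail (g q).tail +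
          ∑ p ∈ t, ∑ q ∈ t, (z p * z q) • (star (wd x (g p).tail) *
            (1 - star (letter x i (e+1)) * letter x i (e+1)) * wd x (g q).tail) := by
        rw [← Finset.sum_add_distrib]
        refine Finset.sum_congr rfl fun p hp => ?_
        rw [← Finset.sum_add_distrib]
        refine Finset.sum_congr rfl fun q hq => ?_
        rw [← smul_add]
        congr 1
        conv_lhs => rw [hg p hp, hg q hq]
        rw [lker_cons]
        have e1 : letter x i (g p).tail.length = letter x i (e+1) := by
          unfold letter; rw [hpar p hp]
        have e2 : letter x i (g q).tail.length = letter x i (e+1) := by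
          unfold letter; rw [hpar q hq]
        rw [e1, e2]
      rw [h2, sandwich]
      refine add_nonneg (ih t _ (e+1) ?_ hpar) ?_
      · intro p hp
        have := hlen p hp
        have := hl p (Finset.mem_filter.1 hp).1
        omega
      · exact star_left_conjugate_nonneg (one_sub_letter x hx i (e+1)) _

theorem le_ker_sum (x : Fin n → A) (hx : ∀ i, ‖x i‖ ≤ 1) {ι : Type*} (z : ι → ℝ)
    (s : Finset ι) (g : ι → List (Fin n)) (e : ℕ)
    (he : ∀ p ∈ s, (g p).length % 2 = e % 2) :
    star (∑ p ∈ s, z p • wd x (g p)) * (∑ p ∈ s, z p • wd x (g p)) ≤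
      ∑ p ∈ s, ∑ q ∈ s, (z p * z q) • ker x (g p) (g q) := by
  have h := lker_psd x hx z (s.sup fun p => (g p).length) s g e
    (fun p hp => Finset.le_sup (f := fun p => (g p).length) hp) he
  have h2 := sandwich s z (fun p => wd x (g p)) 1
  simp only [mul_one] at h2
  rw [← h2, ← sub_nonneg]
  simpa only [lker, smul_sub, Finset.sum_sub_distrib] using h

theorem ker_sum_nonneg (x : Fin n → A) (hx : ∀ i, ‖x i‖ ≤ 1) {ι : Type*} (z : ι → ℝ)
    (s : Finset ι) (g : ι → List (Fin n)) :
    0 ≤ ∑ p ∈ s, ∑ q ∈ s, (if ((g p).length : ZMod 2) = (g q).length then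
      (z p * z q) • ker x (g p) (g q) else 0) := by
  rw [split_sum s (fun p => ((g p).length : ZMod 2))]
  refine Finset.sum_nonneg fun e _ => ?_
  refine (star_mul_self_nonneg _).trans (le_ker_sum x hx z _ g e.val ?_)
  intro p hp
  have := (Finset.mem_filter.1 hp).2
  rw [← this, ZMod.val_natCast]
  simp

end Kernel

section Ell2

variable {W : Type*}

noncomputable def NN : (W →₀ ℝ) →ₗ[ℝ] (W →₀ ℝ) →ₗ[ℝ] ℝ :=
  Finsupp.linearCombination ℝ (fun g => Finsupp.lapply g)

theorem NN_apply (z w : W →₀ ℝ) : NN z w = ∑ g ∈ z.support, z g * w g := by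
  simp [NN, Finsupp.linearCombination_apply, Finsupp.sum, LinearMap.sum_apply]

theorem NN_zero_of_disj (z w : W →₀ ℝ) (h : ∀ g, z g = 0 ∨ w g = 0) : NN z w = 0 := by
  rw [NN_apply]
  exact Finset.sum_eq_zero fun g _ => by rcases h g with h | h <;> simp [h]

theorem NN_symm (z w : W →₀ ℝ) : NN z w = NN w z := by
  have : (NN : (W →₀ ℝ) →ₗ[ℝ] (W →₀ ℝ) →ₗ[ℝ] ℝ) = NN.flip := by
    ext g h
    classical
    simp [NN, Finsupp.single_apply, eq_comm]
  conv_lhs => rw [this]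
  rfl

theorem NN_self_nonneg (z : W →₀ ℝ) : 0 ≤ NN z z := by
  rw [NN_apply]; exact Finset.sum_nonneg fun g _ => mul_self_nonneg _

/-- action of a permutation -/
noncomputable def op (e : Equiv.Perm W) : (W →₀ ℝ) →ₗ[ℝ] (W →₀ ℝ) := (Finsupp.domLCongr e).toLinearMap

theorem op_single (e : Equiv.Perm W) (g : W) (c : ℝ) :
    op e (Finsupp.single g c) = Finsupp.single (e g) c := by simp [op]

theorem op_apply (e : Equiv.Perm W) (z : W →₀ ℝ) (g : W) : op e z g = z (e.symm g) := by
  simp [op]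

theorem NN_op (e : Equiv.Perm W) (z w : W →₀ ℝ) : NN (op e z) (op e w) = NN z w := by
  have : (NN.compl₁₂ (op e) (op e) : (W →₀ ℝ) →ₗ[ℝ] (W →₀ ℝ) →ₗ[ℝ] ℝ) = NN := by
    ext g h
    classical
    simp [NN, op_single, Finsupp.single_apply]
  conv_rhs => rw [← this]
  rfl

theorem cs_form {V : Type*} [AddCommGroup V] [Module ℝ V]
    (B : V →ₗ[ℝ] V →ₗ[ℝ] ℝ) (hsymm : ∀ u v, B u v = B v u) (hpos : ∀ v, 0 ≤ B v v) (u w : V) :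
    (B u w) ^ 2 ≤ B u u * B w w := by
  have h : ∀ t : ℝ, 0 ≤ B w w * (t * t) + (2 * B u w) * t + B u u := by
    intro t
    have := hpos (u + t • w)
    simp only [map_add, map_smul, LinearMap.add_apply, LinearMap.smul_apply, smul_eq_mul] at this
    rw [hsymm w u] at this
    linarith
  have := discrim_le_zero h
  rw [discrim] at this
  nlinarith

variable {n : ℕ}

noncomputable def yop (S : Fin n → Equiv.Perm W) (α : Fin n → ℝ) : (W →₀ ℝ) →ₗ[ℝ] (W →₀ ℝ) :=
  ∑ i, α i • op (S i)

theorem form_yop (B : (W →₀ ℝ) →ₗ[ℝ] (W →₀ ℝ) →ₗ[ℝ] ℝ) (S : Fin n → Equiv.Perm W)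
    (hS : ∀ i g, S i (S i g) = g)
    (α : Fin n → ℝ) (hB : ∀ i z w, B (op (S i) z) (op (S i) w) = B z w) (z w : W →₀ ℝ) :
    B (yop S α z) w = B z (yop S α w) := by
  have h : ∀ i z w, B (op (S i) z) w = B z (op (S i) w) := by
    intro i z w
    rw [← hB i z]
    congr 1
    have : ∀ w, op (S i) (op (S i) w) = w := by
      intro w; ext g; simp only [op_apply]; congr 1
      rw [Equiv.symm_apply_eq, Equiv.symm_apply_eq, hS]
    rw [this]
  simp [yop, LinearMap.sum_apply, map_sum, h]

theorem real_ineq (hn : 2 ≤ n) (α p q : Fin n → ℝ) (N : ℝ)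
    (hα : ∑ i, α i ^ 2 ≤ 1) (hp : ∀ i, 0 ≤ p i) (hpN : ∑ i, p i ≤ N)
    (hq : ∀ i, q i ^ 2 ≤ 4 * (p i * (N - p i))) :
    |∑ i, α i * q i| ≤ 2 * Real.sqrt (1 - 1 / (n : ℝ)) * N := by
  have hn' : (2 : ℝ) ≤ n := by exact_mod_cast hn
  have hN : 0 ≤ N := (Finset.sum_nonneg fun i _ => hp i).trans hpN
  have h1n : 0 ≤ 1 - 1 / (n : ℝ) := by
    rw [sub_nonneg, div_le_one (by linarith)]; linarith
  apply abs_le_of_sq_le_sq _ (by positivity)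
  rw [mul_pow, mul_pow, Real.sq_sqrt h1n]
  have c1 := Finset.sum_mul_sq_le_sq_mul_sq Finset.univ α q
  have c2 := sq_sum_le_card_mul_sum_sq (s := Finset.univ) (f := p)
  simp only [Finset.card_univ, Fintype.card_fin] at c2
  set s := ∑ i, p i with hs
  have hs0 : 0 ≤ s := Finset.sum_nonneg fun i _ => hp i
  have c3 : ∑ i, q i ^ 2 ≤ 4 * (s * N - ∑ i, p i ^ 2) := by
    calc ∑ i, q i ^ 2 ≤ ∑ i, 4 * (p i * (N - p i)) := Finset.sum_le_sum fun i _ => hq i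
      _ = _ := by
        rw [hs, Finset.sum_mul, ← Finset.sum_sub_distrib, Finset.mul_sum]
        exact Finset.sum_congr rfl fun i _ => by ring
  have c4 : s ^ 2 / n ≤ ∑ i, p i ^ 2 := by
    rw [div_le_iff₀ (by linarith)]; linarith
  have c5 : s * N - s ^ 2 / n ≤ (1 - 1 / n) * N ^ 2 := by
    have : 0 ≤ (N - s) * (N - (N + s) / n) := by
      apply mul_nonneg (by linarith)
      rw [sub_nonneg, div_le_iff₀ (by linarith)]
      nlinarith
    have e : (1 - 1 / (n:ℝ)) * N ^ 2 - (s * N - s ^ 2 / n) = (N - s) * (N - (N + s) / n) := by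
      field_simp; ring
    linarith
  have c6 : (∑ i, α i ^ 2) * ∑ i, q i ^ 2 ≤ 1 * ∑ i, q i ^ 2 :=
    mul_le_mul_of_nonneg_right hα (Finset.sum_nonneg fun i _ => sq_nonneg _)
  linarith

theorem yop_quad (hn : 2 ≤ n) (S : Fin n → Equiv.Perm W) (hS : ∀ i g, S i (S i g) = g)
    (c : W → Option (Fin n)) (hc : ∀ i g, c (S i g) = some i ↔ c g ≠ some i)
    (α : Fin n → ℝ) (hα : ∑ i, α i ^ 2 ≤ 1) (z : W →₀ ℝ) :
    |NN (yop S α z) z| ≤ 2 * Real.sqrt (1 - 1 / (n : ℝ)) * NN z z := by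
  classical
  have e : NN (yop S α z) z = ∑ i, α i * NN (op (S i) z) z := by
    simp [yop, LinearMap.sum_apply, map_sum]
  rw [e]
  have hsym : ∀ i g, (S i).symm g = S i g := fun i g => by rw [Equiv.symm_apply_eq, hS]
  let a : Fin n → W →₀ ℝ := fun i => z.filter (fun g => c g = some i)
  let b : Fin n → W →₀ ℝ := fun i => z.filter (fun g => ¬ c g = some i)
  have hab : ∀ i, a i + b i = z := fun i => Finsupp.filter_add_filter_not z _
  have ha : ∀ i g, a i g = if c g = some i then z g else 0 := fun i g => Finsupp.filter_apply _ _ _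
  have hb : ∀ i g, b i g = if ¬ c g = some i then z g else 0 :=
    fun i g => Finsupp.filter_apply _ _ _
  have z1 : ∀ i, NN (a i) (b i) = 0 := by
    intro i; apply NN_zero_of_disj; intro g; rw [ha, hb]
    by_cases h : c g = some i <;> simp [h]
  have z2 : ∀ i, NN (op (S i) (a i)) (a i) = 0 := by
    intro i; apply NN_zero_of_disj; intro g; rw [op_apply, hsym, ha, ha]
    by_cases h : c g = some i
    · left; rw [if_neg]; rw [hc]; simpa using h
    · right; simp [h]
  have z3 : ∀ i, NN (op (S i) (b i)) (b i) = 0 := by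
    intro i; apply NN_zero_of_disj; intro g; rw [op_apply, hsym, hb, hb]
    by_cases h : c g = some i
    · right; simp [h]
    · left; rw [if_neg]; rw [hc]; simpa using h
  have z4 : ∀ i, NN (op (S i) (b i)) (a i) = NN (op (S i) (a i)) (b i) := by
    intro i
    rw [← NN_op (S i) (op (S i) (b i)) (a i)]
    have : op (S i) (op (S i) (b i)) = b i := by
      ext g; simp only [op_apply, hsym, hS]
    rw [this, NN_symm]
  have hz : ∀ i, NN z z = NN (a i) (a i) + NN (b i) (b i) := by
    intro i
    conv_lhs => rw [← hab i]
    simp only [map_add, LinearMap.add_apply]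
    rw [NN_symm (b i) (a i), z1]; ring
  have hq : ∀ i, NN (op (S i) z) z = 2 * NN (op (S i) (a i)) (b i) := by
    intro i
    conv_lhs => rw [← hab i]
    simp only [map_add, LinearMap.add_apply]
    rw [z2, z3, z4]; ring
  apply real_ineq hn α (fun i => NN (a i) (a i)) _ _ hα (fun i => NN_self_nonneg _)
  · have : ∀ i, NN (a i) (a i) = ∑ g ∈ z.support, if c g = some i then z g * z g else 0 := by
      intro i
      have h1 : NN (a i) (a i) = NN z (a i) := by
        conv_rhs => rw [← hab i]
        simp only [map_add, LinearMap.add_apply]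
        rw [NN_symm (b i) (a i), z1]; ring
      rw [h1, NN_apply]
      refine Finset.sum_congr rfl fun g _ => ?_
      rw [ha]; split_ifs <;> simp
    simp only [this]
    rw [Finset.sum_comm, NN_apply]
    refine Finset.sum_le_sum fun g _ => ?_
    cases hcg : c g with
    | none => simpa using mul_self_nonneg (z g)
    | some j => simp
  · intro i
    rw [hq, mul_pow]
    have h := cs_form NN NN_symm NN_self_nonneg (op (S i) (a i)) (b i)
    rw [NN_op] at h
    have : NN z z - NN (a i) (a i) = NN (b i) (b i) := by rw [hz i]; ring
    rw [this]
    linarith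

theorem yop_norm (hn : 2 ≤ n) (S : Fin n → Equiv.Perm W) (hS : ∀ i g, S i (S i g) = g)
    (c : W → Option (Fin n)) (hc : ∀ i g, c (S i g) = some i ↔ c g ≠ some i)
    (α : Fin n → ℝ) (hα : ∑ i, α i ^ 2 ≤ 1) (C : ℝ) (hC0 : 0 < C)
    (hC : C = 2 * Real.sqrt (1 - 1 / (n : ℝ))) (z : W →₀ ℝ) :
    NN (yop S α z) (yop S α z) ≤ C ^ 2 * NN z z := by
  set y := yop S α with hy
  have hq : ∀ z, |NN (y z) z| ≤ C * NN z z := fun z => by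
    rw [hC]; exact yop_quad hn S hS c hc α hα z
  have hs : ∀ z w, NN (y z) w = NN z (y w) := form_yop NN S hS α (fun i => NN_op (S i))
  have h1 := (abs_le.1 (hq (C • z + y z))).2
  have h2 := (abs_le.1 (hq (C • z - y z))).1
  simp only [map_add, map_sub, map_smul, LinearMap.add_apply, LinearMap.sub_apply,
    LinearMap.smul_apply, smul_eq_mul] at h1 h2
  have e1 := hs (y z) z
  have e2 := NN_symm z (y z)
  have e3 := hs z (y z)
  rw [e1] at h1 h2
  have : 2 * C * NN (y z) (y z) ≤ 2 * C * (C ^ 2 * NN z z) := by nlinarith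
  exact le_of_mul_le_mul_left this (by positivity)

end Ell2


section Words

variable {n : ℕ}

abbrev RW (n : ℕ) : Type := {l : List (Fin n) // l.IsChain (· ≠ ·)}

def tog (i : Fin n) (l : List (Fin n)) : List (Fin n) :=
  if l.head? = some i then l.tail else i :: l

theorem tog_chain (i : Fin n) (l : List (Fin n)) (h : l.IsChain (· ≠ ·)) :
    (tog i l).IsChain (· ≠ ·) := by
  unfold tog
  split_ifs with h1
  · exact h.tail
  · cases l with
    | nil => simp
    | cons j l =>
      rw [List.isChain_cons_cons]
      refine ⟨fun e => h1 (by simp [e]), h⟩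

theorem tog_head (i : Fin n) (l : List (Fin n)) (h : l.IsChain (· ≠ ·)) :
    (tog i l).head? = some i ↔ l.head? ≠ some i := by
  unfold tog
  split_ifs with h1
  · simp only [h1, ne_eq, not_true_eq_false, iff_false]
    cases l with
    | nil => simp
    | cons j l =>
      cases l with
      | nil => simp
      | cons k l =>
        rw [List.isChain_cons_cons] at h
        simp at h1 ⊢
        subst h1
        exact fun e => h.1 e.symm
  · simp [h1]

theorem tog_tog (i : Fin n) (l : List (Fin n)) (h : l.IsChain (· ≠ ·)) :
    tog i (tog i l) = l := by
  have hh := tog_head i l h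
  by_cases h1 : l.head? = some i
  · have h2 : ¬ (tog i l).head? = some i := by rw [hh]; simpa using h1
    conv_lhs => rw [tog, if_neg h2, tog, if_pos h1]
    cases l with
    | nil => simp at h1
    | cons j l => simp at h1; simp [h1]
  · have h2 : (tog i l).head? = some i := by rw [hh]; exact h1
    conv_lhs => rw [tog, if_pos h2, tog, if_neg h1]
    simp

def SP (i : Fin n) : Equiv.Perm (RW n) where
  toFun g := ⟨tog i g.1, tog_chain i g.1 g.2⟩
  invFun g := ⟨tog i g.1, tog_chain i g.1 g.2⟩
  left_inv g := Subtype.ext (tog_tog i g.1 g.2)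
  right_inv g := Subtype.ext (tog_tog i g.1 g.2)

theorem tog_length (i : Fin n) (l : List (Fin n)) :
    ((tog i l).length : ZMod 2) = l.length + 1 := by
  unfold tog
  split_ifs with h
  · cases l with
    | nil => simp at h
    | cons j l =>
      simp only [List.tail_cons, List.length_cons, Nat.cast_add, Nat.cast_one]
      rw [add_assoc, show (1 : ZMod 2) + 1 = 0 from rfl, add_zero]
  · simp

variable {A : Type*} [CStarAlgebra A]

theorem ker_tog_aux (x : Fin n → A) (i : Fin n) (g h : List (Fin n))
    (hg : g.head? ≠ some i) (hh : h.head? ≠ some i)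
    (hp : g.length % 2 ≠ h.length % 2) : ker x g (i :: h) = ker x (i :: g) h := by
  rw [ker_of_ne x g (i :: h) (by simpa using hg),
    ker_of_ne x (i :: g) h (by simpa using Ne.symm hh)]
  simp only [wd, star_mul]
  rw [star_letter x i hp, mul_assoc]

theorem zmod_par (a b : ℕ) : ((a : ZMod 2) = b) ↔ a % 2 = b % 2 := ZMod.natCast_eq_natCast_iff' a b 2

theorem ker_tog (x : Fin n → A) (i : Fin n) (g h : List (Fin n))
    (hg : g.IsChain (· ≠ ·)) (hh : h.IsChain (· ≠ ·))
    (hp : (g.length : ZMod 2) = h.length) : ker x (tog i g) (tog i h) = ker x g h := by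
  rw [zmod_par] at hp
  have key : ∀ l : List (Fin n), l.IsChain (· ≠ ·) → l.head? = some i →
      ∃ l', l = i :: l' ∧ l'.head? ≠ some i ∧ tog i l = l' := by
    intro l hl h1
    have h2 := (tog_head i l hl).not.2 (by simpa using h1)
    cases l with
    | nil => simp at h1
    | cons j l =>
      simp at h1
      subst h1
      have : tog j (j :: l) = l := by simp [tog]
      exact ⟨l, rfl, by rwa [this] at h2, this⟩
  by_cases h1 : g.head? = some i <;> by_cases h2 : h.head? = some i
  · obtain ⟨g', rfl, -, e1⟩ := key g hg h1
    obtain ⟨h', rfl, -, e2⟩ := key h hh h2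
    rw [e1, e2]; simp [ker]
  · obtain ⟨g', rfl, h3, e1⟩ := key g hg h1
    rw [e1, tog, if_neg h2]
    apply ker_tog_aux x i g' h h3 h2
    simp at hp; omega
  · obtain ⟨h', rfl, h3, e2⟩ := key h hh h2
    rw [e2, tog, if_neg h1]
    refine (ker_tog_aux x i g h' h1 h3 ?_).symm
    simp at hp; omega
  · rw [tog, if_neg h1, tog, if_neg h2]; simp [ker]

theorem wd_append (x : Fin n → A) : ∀ g h : List (Fin n), g.length % 2 = h.length % 2 →
    wd x (g.reverse ++ h) = star (wd x g) * wd x h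
  | [], h, _ => by simp [wd]
  | i :: g, h, hp => by
    simp only [List.length_cons] at hp
    have := wd_append x g (i :: h) (by simp only [List.length_cons]; omega)
    simp only [List.reverse_cons, List.append_assoc, List.cons_append, List.nil_append]
    rw [this]
    simp only [wd, star_mul]
    rw [star_letter x i (b := h.length) (by omega), mul_assoc]

/-- For distinct reduced words of equal parity the kernel is a nonempty reduced word. -/
theorem ker_eq_wd (x : Fin n → A) : ∀ g h : List (Fin n), g.IsChain (· ≠ ·) → h.IsChain (· ≠ ·) →
    g.length % 2 = h.length % 2 → g ≠ h →
    ∃ l : List (Fin n), l.IsChain (· ≠ ·) ∧ l ≠ [] ∧ l.length % 2 = 0 ∧ ker x g h = wd x l := by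
  have key : ∀ g h : List (Fin n), g.IsChain (· ≠ ·) → h.IsChain (· ≠ ·) →
      g.length % 2 = h.length % 2 → g.head? ≠ h.head? →
      ∃ l : List (Fin n), l.IsChain (· ≠ ·) ∧ l ≠ [] ∧ l.length % 2 = 0 ∧
        ker x g h = wd x l := by
    intro g h hg hh hp hne
    refine ⟨g.reverse ++ h, ?_, ?_, ?_, ?_⟩
    · rw [List.isChain_append]
      refine ⟨?_, hh, ?_⟩
      · rw [List.isChain_reverse]
        exact hg.imp fun a b h => h.symm
      · intro a ha b hb e
        subst e
        rw [List.getLast?_reverse] at ha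
        exact hne (ha.trans hb.symm)
    · intro e
      simp at e
      exact hne (by simp [e.1, e.2])
    · simp; omega
    · rw [ker_of_ne x g h hne, wd_append x g h hp]
  intro g
  induction g with
  | nil =>
    intro h hg hh hp hne
    apply key [] h hg hh hp
    cases h with
    | nil => exact absurd rfl hne
    | cons => simp
  | cons i g ih =>
    intro h hg hh hp hne
    cases h with
    | nil => exact key _ _ hg hh hp (by simp)
    | cons j h =>
      by_cases e : i = j
      · subst e
        obtain ⟨l, h1, h2, h3, h4⟩ := ih h hg.tail hh.tail (by simp at hp; omega)
          (by simpa using hne)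
        exact ⟨l, h1, h2, h3, by simpa [ker] using h4⟩
      · exact key _ _ hg hh hp (by simpa using e)

end Words

section Main

variable {A : Type*} [CStarAlgebra A] [PartialOrder A] [StarOrderedRing A] {n : ℕ}

noncomputable def kk (x : Fin n → A) (ρ : A →ₗ[ℝ] ℝ) (b : A) (g h : RW n) : ℝ :=
  if (g.1.length : ZMod 2) = h.1.length then ρ (star b * ker x g.1 h.1 * b) else 0

noncomputable def BB (x : Fin n → A) (ρ : A →ₗ[ℝ] ℝ) (b : A) :
    (RW n →₀ ℝ) →ₗ[ℝ] (RW n →₀ ℝ) →ₗ[ℝ] ℝ :=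
  Finsupp.linearCombination ℝ (fun g => Finsupp.linearCombination ℝ (fun h => kk x ρ b g h))

theorem BB_single (x : Fin n → A) (ρ : A →ₗ[ℝ] ℝ) (b : A) (g h : RW n) :
    BB x ρ b (Finsupp.single g 1) (Finsupp.single h 1) = kk x ρ b g h := by
  simp [BB]

theorem BB_self (x : Fin n → A) (ρ : A →ₗ[ℝ] ℝ) (b : A) (z : RW n →₀ ℝ) :
    BB x ρ b z z = ρ (star b * (∑ p ∈ z.support, ∑ q ∈ z.support,
      (if ((p.1).length : ZMod 2) = (q.1).length then
      (z p * z q) • ker x p.1 q.1 else 0)) * b) := by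
  simp only [BB, Finsupp.linearCombination_apply, Finsupp.sum, LinearMap.sum_apply,
    LinearMap.smul_apply, Finset.mul_sum, Finset.sum_mul, map_sum, Finset.smul_sum]
  refine Finset.sum_congr rfl fun p _ => Finset.sum_congr rfl fun q _ => ?_
  unfold kk
  split_ifs
  · simp [mul_assoc]
  · simp

structure Good (x : Fin n → A) (ρ : A →ₗ[ℝ] ℝ) : Prop where
  norm_le : ∀ i, ‖x i‖ ≤ 1
  star' : ∀ y, ρ (star y) = ρ y
  pos : ∀ y, 0 ≤ ρ (star y * y)
  tr : ∀ y w, ρ (y * w) = ρ (w * y)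
  one : ρ 1 = 1
  faithful : ∀ y, ρ (star y * y) = 0 → y = 0
  free : ∀ l : List (Fin n), l.IsChain (· ≠ ·) → l ≠ [] → l.length % 2 = 0 → ρ (wd x l) = 0

variable {x : Fin n → A} {ρ : A →ₗ[ℝ] ℝ}

theorem Good.conj_nonneg (H : Good x ρ) (b P : A) (hP : 0 ≤ P) : 0 ≤ ρ (star b * P * b) := by
  obtain ⟨r, rfl⟩ := CStarAlgebra.nonneg_iff_eq_star_mul_self.1 hP
  have := H.pos (r * b)
  simpa [star_mul, mul_assoc] using this

theorem Good.conj_le (H : Good x ρ) (b P : A) (hP : 0 ≤ P) :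
    ρ (star b * P * b) ≤ ‖b‖ ^ 2 * ρ P := by
  obtain ⟨r, rfl⟩ := CStarAlgebra.nonneg_iff_eq_star_mul_self.1 hP
  have e1 : ρ (star b * (star r * r) * b) = ρ (r * (b * star b) * star r) := by
    rw [mul_assoc (star b), mul_assoc (star r), ← mul_assoc, H.tr, ← star_mul, star_mul]
    simp only [mul_assoc]
  rw [e1, H.tr (star r) r]
  have h2 : 0 ≤ (‖b‖ ^ 2) • (1 : A) - b * star b := by
    have := CStarAlgebra.mul_star_le_algebraMap_norm_sq (A := A) (a := b)
    rw [Algebra.algebraMap_eq_smul_one] at this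
    exact sub_nonneg.2 this
  have h3 := H.conj_nonneg (star r) _ h2
  rw [star_star, mul_sub, sub_mul, map_sub] at h3
  simp only [mul_smul_comm, smul_mul_assoc, map_smul, smul_eq_mul, mul_one] at h3
  linarith

theorem BB_one (H : Good x ρ) (z : RW n →₀ ℝ) : BB x ρ 1 z z = NN z z := by
  have : BB x ρ 1 = NN := by
    ext g h
    simp only [LinearMap.comp_apply, Finsupp.lsingle_apply, BB_single]
    have e : (NN (Finsupp.single g 1) (Finsupp.single h 1) : ℝ) = if g = h then 1 else 0 := by
      simp [NN, Finsupp.single_apply, eq_comm]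
    rw [e]
    unfold kk
    by_cases hgh : g = h
    · subst hgh; simp [ker_self, H.one]
    · rw [if_neg hgh]
      split_ifs with hp
      · obtain ⟨l, h1, h2, h3, h4⟩ := ker_eq_wd x g.1 h.1 g.2 h.2 ((zmod_par _ _).1 hp)
          (fun e => hgh (Subtype.ext e))
        simp [h4, H.free l h1 h2 h3]
      · rfl
  rw [this]

theorem Good.main (H : Good x ρ) (hn : 2 ≤ n) (α : Fin n → ℝ) (hα : ∑ i, α i ^ 2 ≤ 1)
    (b : A) (C : ℝ) (hC0 : 0 < C) (hC : C = 2 * Real.sqrt (1 - 1 / (n : ℝ))) :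
    ρ (star b * (star (∑ i, α i • x i) * (∑ i, α i • x i)) * b) ≤ C ^ 2 * ρ (star b * b) := by
  have hS : ∀ (i : Fin n) (g : RW n), SP i (SP i g) = g := fun i g =>
    Subtype.ext (tog_tog i g.1 g.2)
  have hPpos := fun z : RW n →₀ ℝ => ker_sum_nonneg x H.norm_le (fun p => z p) z.support
    (fun p : RW n => p.1)
  have hsymm : ∀ u v, BB x ρ b u v = BB x ρ b v u := by
    have : BB x ρ b = (BB x ρ b).flip := by
      ext g h
      simp only [LinearMap.comp_apply, Finsupp.lsingle_apply, LinearMap.flip_apply]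
      simp only [LinearMap.flip_apply, LinearMap.comp_apply, Finsupp.lsingle_apply, BB_single]
      unfold kk
      by_cases hp : (g.1.length : ZMod 2) = h.1.length
      · rw [if_pos hp, if_pos hp.symm, ← H.star']
        simp [star_mul, star_ker, mul_assoc]
      · rw [if_neg hp, if_neg (Ne.symm hp)]
    intro u v
    conv_lhs => rw [this]
    rfl
  have hinv : ∀ i z w, BB x ρ b (op (SP i) z) (op (SP i) w) = BB x ρ b z w := by
    intro i z w
    have : (BB x ρ b).compl₁₂ (op (SP i)) (op (SP i)) = BB x ρ b := by
      ext g h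
      simp only [LinearMap.comp_apply, Finsupp.lsingle_apply, LinearMap.compl₁₂_apply, op_single,
        BB_single]
      unfold kk
      have e : ∀ g : RW n, (SP i g).1 = tog i g.1 := fun _ => rfl
      simp only [e, tog_length, add_left_inj]
      split_ifs with hp
      · rw [ker_tog x i _ _ g.2 h.2 hp]
      · rfl
    conv_rhs => rw [← this]
    rfl
  have hpos : ∀ v, 0 ≤ BB x ρ b v v := by
    intro z
    rw [BB_self]
    exact H.conj_nonneg _ _ (hPpos z)
  have hdom : ∀ v, BB x ρ b v v ≤ ‖b‖ ^ 2 * NN v v := by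
    intro z
    rw [← BB_one H, BB_self, BB_self]
    simpa using H.conj_le b _ (hPpos z)
  have hy := form_yop (BB x ρ b) SP hS α hinv
  have hg := form_growth (BB x ρ b) hsymm hpos (yop SP α) hy (fun v => NN v v) (‖b‖ ^ 2) (C ^ 2)
    (by positivity) (by positivity) hdom
    (yop_norm hn SP hS (fun g => g.1.head?) (fun i g => tog_head i g.1 g.2) α hα C hC0 hC)
    (Finsupp.single ⟨[], by simp⟩ 1)
  have e0 : BB x ρ b (Finsupp.single ⟨[], by simp⟩ 1) (Finsupp.single ⟨[], by simp⟩ 1) =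
      ρ (star b * b) := by
    rw [BB_single]; simp [kk, ker, wd]
  rw [e0] at hg
  refine le_trans ?_ hg
  have e1 : yop SP α (Finsupp.single ⟨[], by simp⟩ 1) =
      ∑ i, α i • Finsupp.single (⟨[i], by simp⟩ : RW n) 1 := by
    simp only [yop, LinearMap.sum_apply, LinearMap.smul_apply, op_single]
    rfl
  rw [e1]
  have e2 : BB x ρ b (∑ i, α i • Finsupp.single (⟨[i], by simp⟩ : RW n) 1)
      (∑ i, α i • Finsupp.single (⟨[i], by simp⟩ : RW n) 1) =
      ρ (star b * (∑ i, ∑ j, (α i * α j) • ker x [i] [j]) * b) := by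
    simp only [map_sum, map_smul, LinearMap.sum_apply, LinearMap.smul_apply, BB_single,
      Finset.mul_sum, Finset.sum_mul, Finset.smul_sum]
    rw [Finset.sum_comm]
    refine Finset.sum_congr rfl fun i _ => Finset.sum_congr rfl fun j _ => ?_
    simp [kk, mul_assoc]
    try ring
  rw [e2]
  have hle := le_ker_sum x H.norm_le α Finset.univ (fun i => [i]) 1 (by simp)
  have e3 : ∀ i, wd x [i] = x i := fun i => by simp [wd, letter]
  simp only [e3] at hle
  have := H.conj_nonneg b _ (sub_nonneg.2 hle)
  rw [mul_sub, sub_mul, map_sub] at this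
  linarith

theorem Good.norm_bound (H : Good x ρ) (hn : 2 ≤ n) (α : Fin n → ℝ) (hα : ∑ i, α i ^ 2 ≤ 1) :
    ‖∑ i, α i • x i‖ ≤ 2 * Real.sqrt (1 - 1 / (n : ℝ)) := by
  obtain ⟨C, hC⟩ : ∃ C, C = 2 * Real.sqrt (1 - 1 / (n : ℝ)) := ⟨_, rfl⟩
  have hn' : (2 : ℝ) ≤ n := by exact_mod_cast hn
  have hC0 : 0 < C := by
    rw [hC]
    have : 0 < 1 - 1 / (n : ℝ) := by
      rw [sub_pos, div_lt_one (by linarith)]; linarith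
    positivity
  have hm := fun b => H.main hn α hα b C hC0 hC
  rw [← hC]
  set a := ∑ i, α i • x i with ha
  set h : A := star a * a - (C ^ 2) • (1 : A) with hh
  have hsa : IsSelfAdjoint h := by
    rw [hh]
    exact (IsSelfAdjoint.star_mul_self a).sub ((IsSelfAdjoint.all (C ^ 2)).smul (IsSelfAdjoint.one A))
  have hpp : 0 ≤ h⁺ := CFC.posPart_nonneg h
  obtain ⟨c, hc⟩ := CStarAlgebra.nonneg_iff_eq_star_mul_self.1 hpp
  have h1 := hm (star c)
  rw [star_star] at h1
  have h2 : ρ (h⁺ * h) ≤ 0 := by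
    have e : ρ (c * h * star c) = ρ (h⁺ * h) := by
      rw [H.tr, ← mul_assoc, ← hc]
    rw [← e, hh, mul_sub, sub_mul, map_sub]
    simp only [mul_smul_comm, smul_mul_assoc, map_smul, smul_eq_mul, mul_one]
    linarith
  have h3 : h⁺ * h = star h⁺ * h⁺ := by
    have e1 := CFC.posPart_sub_negPart h hsa
    conv_lhs => rw [← e1]
    rw [mul_sub]
    have e2 : (h⁺ - h⁻)⁺ = h⁺ := by rw [e1]
    rw [e2, CFC.posPart_mul_negPart, sub_zero, (IsSelfAdjoint.of_nonneg hpp).star_eq]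
  have h4 : h⁺ = 0 := H.faithful _ (le_antisymm (h3 ▸ h2) (H.pos _))
  have h5 : h ≤ 0 := (CFC.posPart_eq_zero_iff h hsa).1 h4
  have h6 : star a * a ≤ algebraMap ℝ A (C ^ 2) := by
    rw [Algebra.algebraMap_eq_smul_one]; exact sub_nonpos.1 h5
  rw [← CStarAlgebra.norm_le_iff_le_algebraMap _ (by positivity) (star_mul_self_nonneg a),
    CStarRing.norm_star_mul_self] at h6
  nlinarith [norm_nonneg a]

end Main

section Final

variable {A : Type*} [CStarAlgebra A] {n : ℕ}

theorem wd_ofFn (x : Fin n → A) : ∀ (m : ℕ) (i : Fin m → Fin n), wd x (List.ofFn i) =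
    (List.ofFn fun s : Fin m => letter x (i s) (m - s - 1)).prod
  | 0, i => by simp [wd]
  | m + 1, i => by
    simp only [List.ofFn_succ, List.prod_cons, wd, List.length_ofFn]
    rw [wd_ofFn x m]
    simp [Nat.sub_sub, add_comm, Nat.add_sub_add_left, Nat.add_sub_add_right]

theorem free_wd (τ : A → ℂ) (x : Fin n → A) (hL : IsLFree τ x) (l : List (Fin n))
    (hl : l.IsChain (· ≠ ·)) (hne : l ≠ []) (hev : l.length % 2 = 0) : τ (wd x l) = 0 := by
  obtain ⟨k, hk⟩ : ∃ k, l.length = 2 * k := ⟨l.length / 2, by omega⟩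
  have hk1 : 1 ≤ k := by
    have := List.length_pos_iff.2 hne
    omega
  let i : Fin (2 * k) → Fin n := fun s => l.get (s.cast hk.symm)
  have hi : List.ofFn i = l := by
    apply List.ext_getElem
    · simp [hk]
    · intro m h1 h2; simp [i]
  have h := (hL k hk1 i ?_).2
  · rw [← hi, wd_ofFn]
    unfold LWordStar at h
    convert h using 3
    congr 1
    funext s
    have := s.2
    unfold letter
    by_cases hs : (s : ℕ) % 2 = 0
    · rw [if_pos hs, if_neg (by omega)]
    · rw [if_neg hs, if_pos (by omega)]
  · intro s t hst
    rw [List.isChain_iff_getElem] at hl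
    have ht := t.2
    have := hl s (by omega)
    simpa [i, hst] using this

theorem wd_smul (x : Fin n → A) (u : Fin n → ℂ) (l : List (Fin n)) :
    ∃ c : ℂ, wd (fun i => u i • x i) l = c • wd x l := by
  induction l with
  | nil => exact ⟨1, by simp [wd]⟩
  | cons i l ih =>
    obtain ⟨c, hc⟩ := ih
    by_cases h : l.length % 2 = 0
    · exact ⟨u i * c, by simp [wd, letter, h, hc, smul_smul, mul_comm]⟩
    · exact ⟨star (u i) * c, by simp [wd, letter, h, hc, smul_smul, mul_comm, star_smul]⟩

theorem final (τ : A → ℂ) (hτ : IsTracialState τ) (hτf : IsFaithful τ)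
    (hn : 2 ≤ n)
    (x : Fin n → A) (hx : ∀ i, ‖x i‖ ≤ 1) (hL : IsLFree τ x)
    (α : Fin n → ℂ) (hα : ∑ i, ‖α i‖ ^ 2 ≤ 1) :
    ‖∑ i, α i • x i‖ ≤ 2 * Real.sqrt (1 - 1 / (n : ℝ)) := by
  letI : PartialOrder A := CStarAlgebra.spectralOrder A
  haveI : StarOrderedRing A := CStarAlgebra.spectralOrderedRing A
  obtain ⟨hlin, hone, hpos, htr⟩ := hτ
  have hzero : τ 0 = 0 := by
    have := hlin 1 0 0
    simpa using this
  have hadd : ∀ a b, τ (a + b) = τ a + τ b := fun a b => by simpa using hlin 1 a b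
  have hsmul : ∀ (c : ℂ) a, τ (c • a) = c * τ a := fun c a => by simpa [hzero] using hlin c a 0
  let ρ : A →ₗ[ℝ] ℝ :=
    { toFun := fun a => (τ a).re
      map_add' := fun a b => by simp [hadd]
      map_smul' := fun r a => by
        have : r • a = (r : ℂ) • a := (Complex.coe_smul r a).symm
        rw [this, hsmul]; simp }
  have hρ : ∀ a, ρ a = (τ a).re := fun _ => rfl
  have him : ∀ y, (τ (star y * y)).im = 0 := fun y => (Complex.nonneg_iff.1 (hpos y)).2.symm
  choose u hu1 hu2 using fun i => (show ∃ u : ℂ, ‖u‖ = 1 ∧ α i = (‖α i‖ : ℂ) * u by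
    by_cases h : α i = 0
    · exact ⟨1, by simp, by simp [h]⟩
    · exact ⟨α i / ‖α i‖, by simp [h], by field_simp⟩)
  have G : Good (fun i => u i • x i) ρ :=
    { norm_le := fun i => by rw [norm_smul, hu1, one_mul]; exact hx i
      star' := fun y => by
        have h := him (1 + Complex.I • y)
        have e : star (1 + Complex.I • y) * (1 + Complex.I • y) =
            1 + (Complex.I • y + ((-Complex.I) • star y + star y * y)) := by
          simp only [star_add, star_one, star_smul, add_mul, mul_add, one_mul, mul_one,
            smul_mul_assoc, mul_smul_comm, smul_add, smul_smul, Complex.star_def, Complex.conj_I]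
          have e1 : -Complex.I * Complex.I = 1 := by simp
          have e2 : Complex.I * -Complex.I = 1 := by simp
          simp only [e1, e2, one_smul]
          abel
        rw [e, hadd, hadd, hadd, hsmul, hsmul, hone] at h
        simp [him] at h
        rw [hρ, hρ]; linarith
      pos := fun y => (Complex.nonneg_iff.1 (hpos y)).1
      tr := fun y w => by rw [hρ, hρ, htr]
      one := by rw [hρ, hone]; simp
      faithful := fun y h => hτf y (Complex.ext h (him y))
      free := fun l h1 h2 h3 => by
        obtain ⟨c, hc⟩ := wd_smul x u l
        rw [hρ, hc, hsmul, free_wd τ x hL l h1 h2 h3]; simp }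
  have := G.norm_bound hn (fun i => ‖α i‖) hα
  convert this using 3 with i
  rw [← Complex.coe_smul, smul_smul, ← hu2]

end Final

end LFreeProof
/-- An L-free family of `n ≥ 2` contractions satisfies
`‖Σ αᵢ xᵢ‖ ≤ 2√(1 - 1/n)` whenever `Σ |αᵢ|² ≤ 1`. -/
theorem norm_comb_le_of_LFree_contractions
    {M : Type*} [NormedRing M] [StarRing M] [CStarRing M] [NormedAlgebra ℂ M]
    [StarModule ℂ M] [CompleteSpace M]
    (τ : M → ℂ) (hτ : IsTracialState τ) (hτf : IsFaithful τ)
    (n : ℕ) (hn : 2 ≤ n)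
    (x : Fin n → M) (hx : ∀ i, ‖x i‖ ≤ 1) (hL : IsLFree τ x)
    (α : Fin n → ℂ) (hα : ∑ i, ‖α i‖ ^ 2 ≤ 1) :
    ‖∑ i, α i • x i‖ ≤ 2 * Real.sqrt (1 - 1 / (n : ℝ)) := by
  letI : CStarAlgebra M := { }
  exact LFreeProof.final τ hτ hτf hn x hx hL α hα
end

section
/- Let M be a unital C*-algebra with a faithful tracial state τ, let n ≥ 1, and let (x₁, …, xₙ) be an L-free family in M with ‖xᵢ‖ ≤ 1 for all i. Then there exist a unital C*-algebra N with a faithful tracial state σ, a unital injective *-homomorphism ι : M → N with σ ∘ ι = τ, and unitaries U₁, …, Uₙ in the C*-algebra M_{n+1}(N) of (n+1)×(n+1) matrices (rows and columns indexed by 0, 1, …, n) with entries in N, such that: (i) the family (U₁, …, Uₙ) is L-free with respect to the faithful tracial state σ̃ on M_{n+1}(N) defined by σ̃(V) = (1/(n+1)) Σ_{j=0}^n σ(V_{jj}); and (ii) the (0,0) entry of Uᵢ equals ι(xᵢ) for every i = 1, …, n. -/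
open scoped BigOperators ComplexOrder

universe u

/-- A target for a trace-preserving unital ∗-embedding of `M`: a unital
C*-algebra `N` together with a functional `σ` on `N` and a unital
∗-homomorphism `ι : M → N`. -/
structure CStarDilation (M : Type u) [NormedRing M] [StarRing M] [CStarRing M]
    [NormedAlgebra ℂ M] [StarModule ℂ M] [CompleteSpace M] where
  N : Type u
  [instNormedRing : NormedRing N]
  [instStarRing : StarRing N]
  [instCStarRing : CStarRing N]
  [instNormedAlgebra : NormedAlgebra ℂ N]
  [instStarModule : StarModule ℂ N]
  [instCompleteSpace : CompleteSpace N]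
  σ : N → ℂ
  ι : M →⋆ₐ[ℂ] N

attribute [instance] CStarDilation.instNormedRing CStarDilation.instStarRing
  CStarDilation.instCStarRing CStarDilation.instNormedAlgebra
  CStarDilation.instStarModule CStarDilation.instCompleteSpace

set_option linter.unusedSectionVars false

namespace LF

/-- The formal inverse of a letter. -/
def inv {V : Type} (g : V × Bool) : V × Bool := (g.1, !g.2)

@[simp] theorem inv_inv {V : Type} (g : V × Bool) : inv (inv g) = g := by simp [inv]

section Words

variable {B : Type u} (V : Type) (b0 : B)

def Rel (p q : (V × Bool) × B) : Prop := q.1 = inv p.1 → p.2 ≠ b0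

/-- Tails of reduced words. -/
def T : Type u := {l : List ((V × Bool) × B) // l.IsChain (Rel V b0)}

variable {V}

variable (V) in
/-- The empty tail. -/
def nilT : T V b0 := ⟨[], by simp⟩

open Classical in
noncomputable def act (g : V × Bool) : B × T V b0 → B × T V b0
  | (b, ⟨[], _⟩) => (b0, ⟨[(g, b)], by simp⟩)
  | (b, ⟨p :: l, h⟩) =>
      if hp : p.1 = inv g ∧ b = b0 then (p.2, ⟨l, (List.isChain_cons.1 h).2⟩)
      else (b0, ⟨(g, b) :: p :: l, by
        refine List.isChain_cons_cons.2 ⟨?_, h⟩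
        intro h1 h2
        exact hp ⟨h1, h2⟩⟩)

theorem act_of_not (g : V × Bool) (b : B) (t : T V b0)
    (h : ¬ (b = b0 ∧ t.1.head?.map Prod.fst = some (inv g))) :
    ∃ h', act b0 g (b, t) = (b0, ⟨(g, b) :: t.1, h'⟩) := by
  obtain ⟨l, hl⟩ := t
  cases l with
  | nil => exact ⟨by simp, rfl⟩
  | cons p l =>
    have : ¬ (p.1 = inv g ∧ b = b0) := by
      rintro ⟨h1, h2⟩
      exact h ⟨h2, by simp [h1]⟩
    refine ⟨List.isChain_cons_cons.2 ⟨fun h1 h2 => this ⟨h1, h2⟩, hl⟩, ?_⟩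
    simp only [act, this, dite_false]

theorem act_inv_act (g : V × Bool) (w : B × T V b0) : act b0 (inv g) (act b0 g w) = w := by
  obtain ⟨b, l, hl⟩ := w
  cases l with
  | nil => simp [act]
  | cons p l =>
    by_cases h : p.1 = inv g ∧ b = b0
    · have e1 : act b0 g (b, ⟨p :: l, hl⟩) = (p.2, ⟨l, (List.isChain_cons.1 hl).2⟩) := by
        simp [act, h]
      rw [e1]
      obtain ⟨h', e2⟩ := act_of_not b0 (inv g) p.2 ⟨l, (List.isChain_cons.1 hl).2⟩ (by
        rintro ⟨h1, h2⟩
        have := (List.isChain_cons.1 hl).1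
        cases l with
        | nil => simp at h2
        | cons q l =>
          simp at h2
          refine this q (by simp) ?_ h1
          rw [h.1, h2, inv_inv])
      rw [e2]
      obtain ⟨p1, p2⟩ := p
      obtain ⟨h1, h2⟩ := h
      simp at h1
      subst h1; subst h2; rfl
    · have e1 : ∃ h', act b0 g (b, ⟨p :: l, hl⟩) = (b0, ⟨(g, b) :: p :: l, h'⟩) := by
        refine ⟨List.isChain_cons_cons.2 ⟨fun h1 h2 => h ⟨h1, h2⟩, hl⟩, ?_⟩
        simp only [act, h, dite_false]
      obtain ⟨h', e1⟩ := e1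
      rw [e1]
      simp [act]

noncomputable def perm (g : V × Bool) : Equiv.Perm (B × T V b0) where
  toFun := act b0 g
  invFun := act b0 (inv g)
  left_inv := act_inv_act b0 g
  right_inv w := by
    have := act_inv_act b0 (inv g) w
    rwa [inv_inv] at this

end Words

section Hilbert

open scoped InnerProductSpace

variable {B K : Type u} {V : Type} [NormedAddCommGroup K] [InnerProductSpace ℂ K]
  [CompleteSpace K] (hb : HilbertBasis B ℂ K) (b0 : B)

variable (V K) in
/-- The free product Hilbert space. -/
abbrev HS : Type u := lp (fun _ : T V b0 => K) 2

open Classical in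
noncomputable def ev (w : B × T V b0) : HS K V b0 := lp.single 2 w.2 (hb w.1)

theorem inner_ev (w : B × T V b0) (f : HS K V b0) : ⟪ev hb b0 w, f⟫_ℂ = ⟪hb w.1, f w.2⟫_ℂ := by
  classical
  rw [ev, lp.inner_single_left]

theorem hb_ext {a b : K} (h : ∀ i, ⟪hb i, a⟫_ℂ = ⟪hb i, b⟫_ℂ) : a = b := by
  apply hb.repr.injective
  ext i
  rw [hb.repr_apply_apply, hb.repr_apply_apply, h]

theorem ev_ext {f f' : HS K V b0} (h : ∀ w, ⟪ev hb b0 w, f⟫_ℂ = ⟪ev hb b0 w, f'⟫_ℂ) : f = f' := by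
  ext t
  apply hb_ext hb
  intro i
  have := h (i, t)
  rwa [inner_ev, inner_ev] at this

theorem ev_orthonormal : Orthonormal ℂ (ev (V := V) hb b0) := by
  classical
  rw [orthonormal_iff_ite]
  rintro ⟨b, t⟩ ⟨b', t'⟩
  rw [inner_ev, ev]
  by_cases ht : t = t'
  · subst ht
    have := orthonormal_iff_ite.1 hb.orthonormal b b'
    simp only [lp.single_apply_self, this, Prod.mk.injEq, and_true]
  · have h2 : ¬ ((b, t) = (b', t')) := fun h => ht (Prod.mk.inj h).2
    simp only [h2, if_false]
    rw [lp.single_apply_ne _ _ _ ht, inner_zero_right]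

theorem ev_span_perp : (Submodule.span ℂ (Set.range (ev (V := V) hb b0)))ᗮ = ⊥ := by
  rw [Submodule.eq_bot_iff]
  intro f hf
  apply ev_ext hb b0
  intro w
  rw [inner_zero_right]
  exact (Submodule.mem_orthogonal _ _).1 hf _ (Submodule.subset_span ⟨w, rfl⟩)

variable (V) in
noncomputable def eb : HilbertBasis (B × T V b0) ℂ (HS K V b0) :=
  HilbertBasis.mkOfOrthogonalEqBot (ev_orthonormal hb b0) (ev_span_perp hb b0)

theorem eb_coe : ⇑(eb V hb b0) = ev hb b0 := HilbertBasis.coe_mkOfOrthogonalEqBot _ _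

noncomputable def eb' (g : V × Bool) : HilbertBasis (B × T V b0) ℂ (HS K V b0) :=
  HilbertBasis.mkOfOrthogonalEqBot (v := ev hb b0 ∘ perm b0 g)
    ((ev_orthonormal hb b0).comp _ (perm b0 g).injective) (by
      rw [(perm b0 g).surjective.range_comp]
      exact ev_span_perp hb b0)

theorem eb'_coe (g : V × Bool) : ⇑(eb' hb b0 g) = ev hb b0 ∘ perm b0 g :=
  HilbertBasis.coe_mkOfOrthogonalEqBot _ _

noncomputable def vi (g : V × Bool) : HS K V b0 ≃ₗᵢ[ℂ] HS K V b0 :=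
  (eb V hb b0).repr.trans (eb' hb b0 g).repr.symm

theorem vi_ev (g : V × Bool) (w : B × T V b0) : vi hb b0 g (ev hb b0 w) = ev hb b0 (act b0 g w) := by
  classical
  have h1 : ev hb b0 w = eb V hb b0 w := by rw [eb_coe]
  have h2 : ev hb b0 (act b0 g w) = eb' hb b0 g w := by rw [eb'_coe]; rfl
  rw [h1, h2, vi, LinearIsometryEquiv.trans_apply, HilbertBasis.repr_self,
    HilbertBasis.repr_symm_single]

noncomputable def vop (g : V × Bool) : HS K V b0 →L[ℂ] HS K V b0 :=
  (vi hb b0 g).toContinuousLinearEquiv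

theorem vop_ev (g : V × Bool) (w : B × T V b0) :
    vop hb b0 g (ev hb b0 w) = ev hb b0 (act b0 g w) := vi_ev hb b0 g w

theorem inner_vop (g : V × Bool) (w : B × T V b0) (f : HS K V b0) :
    ⟪ev hb b0 w, vop hb b0 g f⟫_ℂ = ⟪ev hb b0 (act b0 (inv g) w), f⟫_ℂ := by
  have h : ev hb b0 w = vi hb b0 g (ev hb b0 (act b0 (inv g) w)) := by
    rw [vi_ev]
    congr 1
    exact ((perm b0 g).right_inv w).symm
  rw [h]
  exact (vi hb b0 g).inner_map_map _ _

theorem vop_mul (g : V × Bool) : vop hb b0 g * vop hb b0 (inv g) = 1 := by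
  ext1 f
  apply ev_ext hb b0
  intro w
  change ⟪ev hb b0 w, vop hb b0 g (vop hb b0 (inv g) f)⟫_ℂ = _
  rw [inner_vop, inner_vop, act_inv_act]
  rfl

theorem vop_star (g : V × Bool) : star (vop hb b0 g) = vop hb b0 (inv g) := by
  ext1 f
  apply ev_ext hb b0
  intro w
  rw [ContinuousLinearMap.star_eq_adjoint, ContinuousLinearMap.adjoint_inner_right, inner_vop,
    vop_ev, inv_inv]

variable (V) in
noncomputable def dg (a : K →L[ℂ] K) : HS K V b0 →L[ℂ] HS K V b0 :=
  lp.mapCLM 2 (fun _ => a) (norm_nonneg a) (fun _ => le_rfl)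

theorem dg_apply (a : K →L[ℂ] K) (f : HS K V b0) (t : T V b0) : dg V b0 a f t = a (f t) := rfl

variable (V K) in
noncomputable def dgHom : (K →L[ℂ] K) →⋆ₐ[ℂ] (HS K V b0 →L[ℂ] HS K V b0) where
  toFun := dg V b0
  map_one' := by ext f t; rfl
  map_mul' a b := by ext f t; rfl
  map_zero' := by ext f t; rfl
  map_add' a b := by ext f t; rfl
  commutes' r := by ext f t; rfl
  map_star' a := by
    rw [ContinuousLinearMap.star_eq_adjoint, ContinuousLinearMap.star_eq_adjoint]
    rw [ContinuousLinearMap.eq_adjoint_iff]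
    intro f f'
    rw [lp.inner_eq_tsum, lp.inner_eq_tsum]
    congr 1
    ext t
    rw [dg_apply, dg_apply, ContinuousLinearMap.adjoint_inner_left]

theorem dgHom_apply (a : K →L[ℂ] K) (f : HS K V b0) (t : T V b0) : dgHom K V b0 a f t = a (f t) := rfl

variable (V) in
noncomputable def Om : HS K V b0 := ev hb b0 (b0, nilT V b0)

theorem Om_apply_nil : Om V hb b0 (nilT V b0) = hb b0 := by
  classical
  rw [Om, ev, lp.single_apply_self]

theorem Om_apply_ne (t : T V b0) (ht : t.1 ≠ []) : Om V hb b0 t = 0 := by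
  classical
  rw [Om, ev, lp.single_apply_ne]
  rintro rfl
  exact ht rfl

theorem inner_Om (f : HS K V b0) : ⟪Om V hb b0, f⟫_ℂ = ⟪hb b0, f (nilT V b0)⟫_ℂ := by
  rw [Om, inner_ev]

/-- Vectors supported on words beginning with the basepoint and then the letter `g`. -/
def Eg (g : V × Bool) : Submodule ℂ (HS K V b0) where
  carrier := {f | ∀ w : B × T V b0, ¬ (w.1 = b0 ∧ w.2.1.head?.map Prod.fst = some g) →
    ⟪ev hb b0 w, f⟫_ℂ = 0}
  add_mem' := by
    intro f f' h h' w hw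
    rw [inner_add_right, h w hw, h' w hw, add_zero]
  zero_mem' := by
    intro w _
    rw [inner_zero_right]
  smul_mem' := by
    intro c f h w hw
    rw [inner_smul_right, h w hw, mul_zero]

theorem Eg_apply_ne {g : V × Bool} {f : HS K V b0} (hf : f ∈ Eg hb b0 g) (t : T V b0)
    (ht : t.1.head?.map Prod.fst ≠ some g) : f t = 0 := by
  apply hb_ext hb
  intro i
  have := hf (i, t) (fun h => ht h.2)
  rwa [inner_ev, ← inner_zero_right (hb i)] at this

theorem Eg_apply {g : V × Bool} {f : HS K V b0} (hf : f ∈ Eg hb b0 g) (t : T V b0) :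
    f t = ⟪hb b0, f t⟫_ℂ • hb b0 := by
  classical
  apply hb_ext hb
  intro i
  have hi := orthonormal_iff_ite.1 hb.orthonormal i b0
  rw [inner_smul_right, hi]
  by_cases h : i = b0
  · simp [h]
  · have := hf (i, t) (fun h' => h h'.1)
    rw [inner_ev] at this
    simpa [h] using this

theorem mem_Eg (g : V × Bool) (a : K →L[ℂ] K) (f : HS K V b0)
    (hf : ∀ t : T V b0, t.1.head?.map Prod.fst = some (inv g) → ⟪hb b0, a (f t)⟫_ℂ = 0) :
    vop hb b0 g (dgHom K V b0 a f) ∈ Eg hb b0 g := by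
  rintro ⟨b, t⟩ hw
  rw [inner_vop]
  obtain ⟨h', e⟩ := act_of_not b0 (inv g) b t (by rwa [inv_inv])
  rw [e, inner_ev, dgHom_apply]
  exact hf ⟨(inv g, b) :: t.1, h'⟩ (by simp)

theorem F1 {g h : V × Bool} {f : HS K V b0} (hf : f ∈ Eg hb b0 h) (a : K →L[ℂ] K)
    (hg : g ≠ inv h ∨ ⟪hb b0, a (hb b0)⟫_ℂ = 0) :
    vop hb b0 g (dgHom K V b0 a f) ∈ Eg hb b0 g := by
  apply mem_Eg
  intro t ht
  by_cases hgh : g = inv h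
  · rw [Eg_apply hb b0 hf t, map_smul, inner_smul_right]
    rcases hg with hg | hg
    · exact absurd hgh hg
    · rw [hg, mul_zero]
  · rw [Eg_apply_ne hb b0 hf t, map_zero, inner_zero_right]
    rw [ht]
    intro h'
    apply hgh
    rw [← Option.some_injective _ h', inv_inv]

theorem F2 (g : V × Bool) (a : K →L[ℂ] K) :
    vop hb b0 g (dgHom K V b0 a (Om V hb b0)) ∈ Eg hb b0 g := by
  apply mem_Eg
  intro t ht
  rw [Om_apply_ne, map_zero, inner_zero_right]
  intro h
  simp [h] at ht

theorem F3 {g : V × Bool} {f : HS K V b0} (hf : f ∈ Eg hb b0 g) (a : K →L[ℂ] K) :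
    ⟪Om V hb b0, dgHom K V b0 a f⟫_ℂ = 0 := by
  rw [inner_Om, dgHom_apply, Eg_apply_ne hb b0 hf, map_zero, inner_zero_right]
  simp [nilT]

theorem F4 (a : K →L[ℂ] K) :
    ⟪Om V hb b0, dgHom K V b0 a (Om V hb b0)⟫_ℂ = ⟪hb b0, a (hb b0)⟫_ℂ := by
  rw [inner_Om, dgHom_apply, Om_apply_nil]

theorem cyclic (S : Set (K →L[ℂ] K)) (hS : Dense {k : K | ∃ a ∈ S, k = a (hb b0)})
    (C : Submodule ℂ (HS K V b0)) (hC : IsClosed (C : Set (HS K V b0)))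
    (hO : Om V hb b0 ∈ C) (hv : ∀ g, ∀ f ∈ C, vop hb b0 g f ∈ C)
    (ha : ∀ a ∈ S, ∀ f ∈ C, dgHom K V b0 a f ∈ C) : C = ⊤ := by
  classical
  have step : ∀ t : T V b0, ev hb b0 (b0, t) ∈ C → ∀ k : K, (lp.single 2 t k : HS K V b0) ∈ C := by
    intro t ht k
    have hcl : IsClosed {k : K | (lp.single 2 t k : HS K V b0) ∈ C} :=
      hC.preimage (lp.isometry_single (E := fun _ : T V b0 => K) (p := 2) t).continuous
    have hsub : {k : K | ∃ a ∈ S, k = a (hb b0)} ⊆ {k : K | (lp.single 2 t k : HS K V b0) ∈ C} := by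
      rintro _ ⟨a, haS, rfl⟩
      have h1 := ha a haS _ ht
      have h2 : dgHom K V b0 a (ev hb b0 (b0, t)) = (lp.single 2 t (a (hb b0)) : HS K V b0) := by
        ext t'
        rw [dgHom_apply, ev]
        by_cases htt : t' = t
        · subst htt; rw [lp.single_apply_self, lp.single_apply_self]
        · rw [lp.single_apply_ne _ _ _ htt, lp.single_apply_ne _ _ _ htt, map_zero]
      rw [h2] at h1
      exact h1
    have := hcl.closure_subset_iff.2 hsub
    rw [hS.closure_eq] at this
    exact this (Set.mem_univ k)
  have all : ∀ l : List ((V × Bool) × B), ∀ h, ev hb b0 (b0, (⟨l, h⟩ : T V b0)) ∈ C := by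
    intro l
    induction l with
    | nil => intro h; exact hO
    | cons p l ih =>
      intro h
      have h1 := (List.isChain_cons.1 h)
      have h2 := step _ (ih h1.2) (hb p.2)
      have h3 := hv p.1 _ h2
      have h4 := vop_ev hb b0 p.1 (p.2, (⟨l, h1.2⟩ : T V b0))
      obtain ⟨h', e⟩ := act_of_not b0 p.1 p.2 (⟨l, h1.2⟩ : T V b0) (by
        rintro ⟨h5, h6⟩
        cases l with
        | nil => simp at h6
        | cons q l =>
          simp at h6
          exact h1.1 q (by simp) h6 h5)
      rw [e] at h4
      change vop hb b0 p.1 (ev hb b0 (p.2, (⟨l, h1.2⟩ : T V b0))) ∈ C at h3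
      rw [h4] at h3
      exact h3
  have : Submodule.span ℂ (Set.range (eb V hb b0)) ≤ C := by
    rw [Submodule.span_le]
    rintro _ ⟨⟨b, t⟩, rfl⟩
    rw [eb_coe]
    exact step t (all t.1 t.2) (hb b)
  have h2 := Submodule.topologicalClosure_minimal _ this hC
  rw [(eb V hb b0).dense_span] at h2
  exact top_le_iff.1 h2

end Hilbert

end LF
namespace LF

section Abstract

open scoped InnerProductSpace

variable {M : Type u} [NormedRing M] [StarRing M] [CStarRing M] [NormedAlgebra ℂ M]
    [StarModule ℂ M] [CompleteSpace M] {V : Type}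

/-- The data of a free family of unitaries on a Hilbert space carrying `M`. -/
structure Sys (τ : M → ℂ) (V : Type) (H : Type u) [NormedAddCommGroup H]
    [InnerProductSpace ℂ H] [CompleteSpace H] where
  hτ : IsTracialState τ
  π : M →⋆ₐ[ℂ] (H →L[ℂ] H)
  v : V × Bool → (H →L[ℂ] H)
  Ω : H
  E : V × Bool → Submodule ℂ H
  v_star : ∀ g, star (v g) = v (inv g)
  v_mul : ∀ g, v g * v (inv g) = 1
  f1 : ∀ (g h : V × Bool) (ξ : H) (m : M), ξ ∈ E h → (g ≠ inv h ∨ τ m = 0) →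
    v g (π m ξ) ∈ E g
  f2 : ∀ (g : V × Bool) (m : M), v g (π m Ω) ∈ E g
  f3 : ∀ (g : V × Bool) (m : M) (ξ : H), ξ ∈ E g → ⟪Ω, π m ξ⟫_ℂ = 0
  f4 : ∀ m, ⟪Ω, π m Ω⟫_ℂ = τ m
  cyc : ∀ C : Submodule ℂ H, IsClosed (C : Set H) → Ω ∈ C → (∀ g, ∀ ξ ∈ C, v g ξ ∈ C) →
    (∀ m, ∀ ξ ∈ C, π m ξ ∈ C) → C = ⊤

variable {τ : M → ℂ} {H : Type u} [NormedAddCommGroup H]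
    [InnerProductSpace ℂ H] [CompleteSpace H] (S : Sys τ V H)

theorem tr_sub (hτ : IsTracialState τ) (m : M) : τ (m - τ m • 1) = 0 := by
  have h := hτ.1 (-(τ m)) 1 m
  rw [hτ.2.1] at h
  have e : m - τ m • (1 : M) = -(τ m) • (1 : M) + m := by rw [neg_smul]; abel
  rw [e, h]; ring

namespace Sys

open Classical in
theorem split (g h : V × Bool) (m : M) (ζ : H) (hζ : S.v g ζ ∈ S.E g) :
    ∃ e ∈ S.E h, S.v h (S.π m (S.v g ζ)) = e + (if h = inv g then τ m else 0) • ζ := by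
  by_cases hg : h = inv g
  · refine ⟨S.v h (S.π (m - τ m • 1) (S.v g ζ)), S.f1 h g _ _ hζ (Or.inr (tr_sub S.hτ m)), ?_⟩
    have h1 : S.v h (S.v g ζ) = ζ := by
      have := S.v_mul h
      rw [hg, inv_inv] at this
      rw [hg]
      exact DFunLike.congr_fun this ζ
    rw [map_sub, map_smul, map_one, ContinuousLinearMap.sub_apply, map_sub,
      ContinuousLinearMap.smul_apply, map_smul, ContinuousLinearMap.one_apply, h1, if_pos hg]
    abel
  · refine ⟨_, S.f1 h g _ m hζ (Or.inl hg), ?_⟩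
    rw [if_neg hg, zero_smul, add_zero]

/-- Reduced tails. -/
def Ch (τ : M → ℂ) (l : List ((V × Bool) × M)) : Prop :=
  l.IsChain (fun p q => q.1 = inv p.1 → τ p.2 = 0)

noncomputable def word (l : List ((V × Bool) × M)) : H →L[ℂ] H := (l.map fun p => S.v p.1 * S.π p.2).prod

theorem word_cons (p : (V × Bool) × M) (l : List ((V × Bool) × M)) :
    S.word (p :: l) = S.v p.1 * S.π p.2 * S.word l := by simp [word]

theorem chain_ne {τ : M → ℂ} {p q : (V × Bool) × M} {l : List ((V × Bool) × M)}
    (h : Ch τ (p :: q :: l)) : p.1 ≠ inv q.1 ∨ τ p.2 = 0 := by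
  have := (List.isChain_cons_cons.1 h).1
  by_cases hh : q.1 = inv p.1
  · exact Or.inr (this hh)
  · left
    intro h'
    apply hh
    rw [h', inv_inv]

theorem word_mem (m : M) : ∀ (l : List ((V × Bool) × M)) (p : (V × Bool) × M), Ch τ (p :: l) →
    S.word (p :: l) (S.π m S.Ω) ∈ S.E p.1 := by
  intro l
  induction l with
  | nil =>
    intro p _
    have h := S.f2 p.1 (p.2 * m)
    rw [map_mul] at h
    simpa [word] using h
  | cons q l ih =>
    intro p hp
    rw [word_cons]
    exact S.f1 p.1 q.1 _ p.2 (ih q (List.isChain_cons_cons.1 hp).2) (chain_ne hp)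

theorem v_Om (h : V × Bool) : S.v h S.Ω ∈ S.E h := by
  have := S.f2 h 1
  simpa using this

theorem word_v_mem (h : V × Bool) : ∀ (l : List ((V × Bool) × M)) (p q : (V × Bool) × M),
    Ch τ (p :: q :: l) → S.word (p :: q :: l) (S.v h S.Ω) ∈ S.E p.1 := by
  intro l
  induction l with
  | nil =>
    intro p q hp
    obtain ⟨e, he, h1⟩ := S.split h q.1 q.2 S.Ω (S.v_Om h)
    rw [word_cons]
    change S.v p.1 (S.π p.2 (S.word [q] (S.v h S.Ω))) ∈ _
    have h2 : S.word [q] (S.v h S.Ω) = S.v q.1 (S.π q.2 (S.v h S.Ω)) := by simp [word]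
    rw [h2, h1, map_add, map_add]
    refine add_mem (S.f1 _ _ _ _ he (chain_ne hp)) ?_
    rw [map_smul, map_smul]
    exact Submodule.smul_mem _ _ (S.f2 _ _)
  | cons r l ih =>
    intro p q hp
    rw [word_cons]
    exact S.f1 p.1 q.1 _ p.2 (ih q r (List.isChain_cons_cons.1 hp).2) (chain_ne hp)

/-- The vector functional. -/
noncomputable def φ (a : H →L[ℂ] H) : ℂ := ⟪S.Ω, a S.Ω⟫_ℂ

theorem φ_add (a b : H →L[ℂ] H) : S.φ (a + b) = S.φ a + S.φ b := by
  simp [φ, inner_add_right]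

theorem φ_smul (c : ℂ) (a : H →L[ℂ] H) : S.φ (c • a) = c * S.φ a := by
  simp [φ, inner_smul_right]

theorem φ_star (a : H →L[ℂ] H) : S.φ (star a) = starRingEnd ℂ (S.φ a) := by
  rw [φ, φ, ContinuousLinearMap.star_eq_adjoint, ContinuousLinearMap.adjoint_inner_right,
    inner_conj_symm]

theorem φ_sq (a : H →L[ℂ] H) : S.φ (star a * a) = ((‖a S.Ω‖ ^ 2 : ℝ) : ℂ) := by
  rw [φ, ContinuousLinearMap.mul_apply, ContinuousLinearMap.star_eq_adjoint,
    ContinuousLinearMap.adjoint_inner_right, inner_self_eq_norm_sq_to_K]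
  simp

theorem φ_cont : Continuous S.φ := by
  unfold φ
  fun_prop

/-- Span of reduced words. -/
def R : Submodule ℂ (H →L[ℂ] H) :=
  Submodule.span ℂ {y | ∃ (m : M) (l : List ((V × Bool) × M)), Ch τ l ∧ y = S.π m * S.word l}

def gens : Set (H →L[ℂ] H) := Set.range S.π ∪ Set.range S.v

noncomputable def A : StarSubalgebra ℂ (H →L[ℂ] H) := StarAlgebra.adjoin ℂ S.gens

theorem π_mem (m : M) : S.π m ∈ S.A := StarAlgebra.subset_adjoin ℂ _ (Or.inl ⟨m, rfl⟩)

theorem v_mem (g : V × Bool) : S.v g ∈ S.A := StarAlgebra.subset_adjoin ℂ _ (Or.inr ⟨g, rfl⟩)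

theorem π_R (m : M) : ∀ y ∈ S.R, S.π m * y ∈ S.R := by
  intro y hy
  induction hy using Submodule.span_induction with
  | mem y h =>
    obtain ⟨m', l, hl, rfl⟩ := h
    refine Submodule.subset_span ⟨m * m', l, hl, ?_⟩
    rw [map_mul, mul_assoc]
  | zero => simp
  | add y z _ _ h1 h2 => rw [mul_add]; exact add_mem h1 h2
  | smul c y _ h => rw [mul_smul_comm]; exact Submodule.smul_mem _ _ h

theorem v_R (g : V × Bool) : ∀ y ∈ S.R, S.v g * y ∈ S.R := by
  intro y hy
  induction hy using Submodule.span_induction with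
  | mem y h =>
    obtain ⟨m, l, hl, rfl⟩ := h
    have base : ∀ m : M, Ch τ ((g, m) :: l) → S.v g * (S.π m * S.word l) ∈ S.R := by
      intro m hm
      refine Submodule.subset_span ⟨1, (g, m) :: l, hm, ?_⟩
      rw [word_cons, map_one, one_mul, mul_assoc]
    cases l with
    | nil => exact base m (by simp [Ch])
    | cons q l =>
      by_cases hq : q.1 = inv g
      · have e : S.v g * (S.π m * S.word (q :: l)) =
            S.v g * (S.π (m - τ m • 1) * S.word (q :: l)) + τ m • (S.π q.2 * S.word l) := by
          rw [map_sub, map_smul, map_one, sub_mul, mul_sub, smul_mul_assoc, one_mul,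
            mul_smul_comm]
          have : S.v g * S.word (q :: l) = S.π q.2 * S.word l := by
            rw [word_cons, hq, ← mul_assoc, ← mul_assoc, S.v_mul, one_mul]
          rw [this]; abel
        rw [e]
        refine add_mem (base _ ?_) (Submodule.smul_mem _ _ (Submodule.subset_span
          ⟨q.2, l, (List.isChain_cons.1 hl).2, rfl⟩))
        exact List.isChain_cons_cons.2 ⟨fun _ => tr_sub S.hτ m, hl⟩
      · exact base m (List.isChain_cons_cons.2 ⟨fun h => absurd h hq, hl⟩)
  | zero => simp
  | add y z _ _ h1 h2 => rw [mul_add]; exact add_mem h1 h2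
  | smul c y _ h => rw [mul_smul_comm]; exact Submodule.smul_mem _ _ h

theorem A_R (a : H →L[ℂ] H) (ha : a ∈ S.A) :
    (∀ y ∈ S.R, a * y ∈ S.R) ∧ (∀ y ∈ S.R, star a * y ∈ S.R) := by
  unfold A at ha
  induction ha using StarAlgebra.adjoin_induction with
  | mem x hx =>
    rcases hx with ⟨m, rfl⟩ | ⟨g, rfl⟩
    · rw [← map_star]
      exact ⟨S.π_R _, S.π_R _⟩
    · rw [S.v_star]
      exact ⟨S.v_R _, S.v_R _⟩
  | algebraMap r =>
    have : ∀ r : ℂ, ∀ y ∈ S.R, algebraMap ℂ (H →L[ℂ] H) r * y ∈ S.R := by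
      intro r y hy
      rw [Algebra.algebraMap_eq_smul_one, smul_mul_assoc, one_mul]
      exact Submodule.smul_mem _ _ hy
    rw [← algebraMap_star_comm]
    exact ⟨this _, this _⟩
  | add x y _ _ h1 h2 =>
    refine ⟨fun z hz => ?_, fun z hz => ?_⟩
    · rw [add_mul]; exact add_mem (h1.1 z hz) (h2.1 z hz)
    · rw [star_add, add_mul]; exact add_mem (h1.2 z hz) (h2.2 z hz)
  | mul x y _ _ h1 h2 =>
    refine ⟨fun z hz => ?_, fun z hz => ?_⟩
    · rw [mul_assoc]; exact h1.1 _ (h2.1 z hz)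
    · rw [star_mul, mul_assoc]; exact h2.2 _ (h1.2 z hz)
  | star x _ h => rw [star_star]; exact ⟨h.2, h.1⟩

theorem A_sub_R (a : H →L[ℂ] H) (ha : a ∈ S.A) : a ∈ S.R := by
  have := (S.A_R a ha).1 1 (Submodule.subset_span ⟨1, [], by simp [Ch], by simp [word]⟩)
  rwa [mul_one] at this

theorem φ_π (m : M) : S.φ (S.π m) = τ m := S.f4 m

theorem φ_word (m m' : M) (p : (V × Bool) × M) (l : List ((V × Bool) × M)) (h : Ch τ (p :: l)) :
    S.φ (S.π m * S.word (p :: l) * S.π m') = 0 :=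
  S.f3 p.1 m _ (S.word_mem m' l p h)

theorem tr_π (m : M) (y : H →L[ℂ] H) (hy : y ∈ S.R) : S.φ (S.π m * y) = S.φ (y * S.π m) := by
  induction hy using Submodule.span_induction with
  | mem y h =>
    obtain ⟨m', l, hl, rfl⟩ := h
    cases l with
    | nil => simp [word, ← map_mul, φ_π, S.hτ.2.2.2 m m']
    | cons p l =>
      rw [S.φ_word m' m p l hl, ← mul_assoc, ← map_mul]
      have := S.φ_word (m * m') 1 p l hl
      rwa [map_one, mul_one] at this
  | zero => simp
  | add y z _ _ h1 h2 => rw [mul_add, add_mul, φ_add, φ_add, h1, h2]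
  | smul c y _ h => rw [mul_smul_comm, smul_mul_assoc, φ_smul, φ_smul, h]

theorem φ_E (h : V × Bool) (e : H) (he : e ∈ S.E h) : ⟪S.Ω, e⟫_ℂ = 0 := by
  have := S.f3 h 1 e he
  rwa [map_one] at this

theorem tr_v (h : V × Bool) (y : H →L[ℂ] H) (hy : y ∈ S.R) : S.φ (S.v h * y) = S.φ (y * S.v h) := by
  classical
  induction hy using Submodule.span_induction with
  | mem y hh =>
    obtain ⟨m, l, hl, rfl⟩ := hh
    match l, hl with
    | [], _ =>
      simp only [word, List.map_nil, List.prod_nil, mul_one]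
      have h1 : S.φ (S.v h * S.π m) = 0 := S.φ_E h _ (S.f2 h m)
      have h2 : S.φ (S.π m * S.v h) = 0 := S.f3 h m _ (S.v_Om h)
      rw [h1, h2]
    | [p], _ =>
      have hw : S.word [p] = S.v p.1 * S.π p.2 := by simp [word]
      rw [hw]
      obtain ⟨e, he, h1⟩ := S.split p.1 h m (S.π p.2 S.Ω) (S.f2 p.1 p.2)
      obtain ⟨e', he', h2⟩ := S.split h p.1 p.2 S.Ω (S.v_Om h)
      have h3 : S.φ (S.v h * (S.π m * (S.v p.1 * S.π p.2))) =
          ⟪S.Ω, S.v h (S.π m (S.v p.1 (S.π p.2 S.Ω)))⟫_ℂ := rfl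
      have h4 : S.φ (S.π m * (S.v p.1 * S.π p.2) * S.v h) =
          ⟪S.Ω, S.π m (S.v p.1 (S.π p.2 (S.v h S.Ω)))⟫_ℂ := rfl
      rw [h3, h4, h1, h2, map_add, inner_add_right, inner_add_right, map_smul, inner_smul_right,
        inner_smul_right, S.φ_E h e he, S.f3 _ _ _ he', S.f4, S.f4]
      by_cases hp : h = inv p.1
      · have hp' : p.1 = inv h := by rw [hp, inv_inv]
        rw [if_pos hp, if_pos hp']; ring
      · have hp' : ¬ p.1 = inv h := fun h' => hp (by rw [h', inv_inv])
        rw [if_neg hp, if_neg hp']; ring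
    | p :: q :: l, hl =>
      have h4 : S.φ (S.π m * S.word (p :: q :: l) * S.v h) = 0 :=
        S.f3 p.1 m _ (S.word_v_mem h l p q hl)
      have hq : S.word (q :: l) S.Ω ∈ S.E q.1 := by
        have := S.word_mem 1 l q (List.isChain_cons_cons.1 hl).2
        rwa [map_one] at this
      obtain ⟨e, he, h1⟩ := S.split p.1 h m (S.π p.2 (S.word (q :: l) S.Ω))
        (S.f1 _ _ _ _ hq (chain_ne hl))
      have h3 : S.φ (S.v h * (S.π m * S.word (p :: q :: l))) =
          ⟪S.Ω, S.v h (S.π m (S.v p.1 (S.π p.2 (S.word (q :: l) S.Ω))))⟫_ℂ := by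
        rw [word_cons]; rfl
      rw [h4, h3, h1, inner_add_right, inner_smul_right, S.φ_E h e he, S.f3 _ _ _ hq]
      ring
  | zero => simp
  | add y z _ _ h1 h2 => rw [mul_add, add_mul, φ_add, φ_add, h1, h2]
  | smul c y _ h => rw [mul_smul_comm, smul_mul_assoc, φ_smul, φ_smul, h]

theorem tr_A (a : H →L[ℂ] H) (ha : a ∈ S.A) : ∀ b ∈ S.A, S.φ (a * b) = S.φ (b * a) := by
  unfold A at ha
  induction ha using StarAlgebra.adjoin_induction with
  | mem x hx =>
    intro b hb
    rcases hx with ⟨m, rfl⟩ | ⟨g, rfl⟩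
    · exact S.tr_π m b (S.A_sub_R b hb)
    · exact S.tr_v g b (S.A_sub_R b hb)
  | algebraMap r =>
    intro b _
    rw [Algebra.commutes]
  | add x y _ _ h1 h2 =>
    intro b hb
    rw [add_mul, mul_add, φ_add, φ_add, h1 b hb, h2 b hb]
  | mul x y hx hy h1 h2 =>
    intro b hb
    rw [mul_assoc, h1 _ (mul_mem hy hb), mul_assoc, h2 _ (mul_mem hb hx), mul_assoc]
  | star x hx h =>
    intro b hb
    have := h (star b) (star_mem hb)
    have e1 : star x * b = star (star b * x) := by simp
    have e2 : b * star x = star (x * star b) := by simp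
    rw [e1, e2, φ_star, φ_star, this]

noncomputable def N : StarSubalgebra ℂ (H →L[ℂ] H) := S.A.topologicalClosure

theorem A_le_N {a : H →L[ℂ] H} (ha : a ∈ S.A) : a ∈ S.N := S.A.le_topologicalClosure ha

theorem tr_N (a b : H →L[ℂ] H) (ha : a ∈ S.N) (hb : b ∈ S.N) : S.φ (a * b) = S.φ (b * a) := by
  have ha' : a ∈ closure (S.A : Set (H →L[ℂ] H)) := by
    rw [← StarSubalgebra.topologicalClosure_coe]; exact ha
  have hb' : b ∈ closure (S.A : Set (H →L[ℂ] H)) := by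
    rw [← StarSubalgebra.topologicalClosure_coe]; exact hb
  have hc := S.φ_cont
  refine closure_induction₂' a b ha' hb'
where
  closure_induction₂' (a b) (ha : a ∈ closure (S.A : Set (H →L[ℂ] H)))
      (hb : b ∈ closure (S.A : Set (H →L[ℂ] H))) : S.φ (a * b) = S.φ (b * a) := by
    have hc := S.φ_cont
    have step : ∀ a ∈ S.A, ∀ b ∈ closure (S.A : Set (H →L[ℂ] H)), S.φ (a * b) = S.φ (b * a) := by
      intro a ha b hb
      have hcl : IsClosed {b | S.φ (a * b) = S.φ (b * a)} :=
        isClosed_eq (hc.comp (continuous_const.mul continuous_id))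
          (hc.comp (continuous_id.mul continuous_const))
      exact (hcl.closure_subset_iff.2 (fun b hb => S.tr_A a ha b hb)) hb
    have hcl : IsClosed {a | S.φ (a * b) = S.φ (b * a)} :=
        isClosed_eq (hc.comp (continuous_id.mul continuous_const))
          (hc.comp (continuous_const.mul continuous_id))
    exact (hcl.closure_subset_iff.2 (fun a ha => step a ha b hb)) ha

theorem cyclicN : (Submodule.map (LinearMap.flip (ContinuousLinearMap.coeLM ℂ :
    (H →L[ℂ] H) →ₗ[ℂ] (H →ₗ[ℂ] H)) S.Ω)
    (Subalgebra.toSubmodule S.A.toSubalgebra)).topologicalClosure = ⊤ := by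
  set P := (Submodule.map (LinearMap.flip (ContinuousLinearMap.coeLM ℂ :
    (H →L[ℂ] H) →ₗ[ℂ] (H →ₗ[ℂ] H)) S.Ω) (Subalgebra.toSubmodule S.A.toSubalgebra)) with hP
  have inv : ∀ a ∈ S.A, ∀ ξ ∈ P.topologicalClosure, a ξ ∈ P.topologicalClosure := by
    intro a ha ξ hξ
    have hcl : IsClosed {ξ | a ξ ∈ P.topologicalClosure} :=
      P.isClosed_topologicalClosure.preimage a.continuous
    have hsub : (P : Set H) ⊆ {ξ | a ξ ∈ P.topologicalClosure} := by
      rintro _ ⟨b, hb, rfl⟩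
      exact P.le_topologicalClosure ⟨a * b, (show a * b ∈ S.A from mul_mem ha (show b ∈ S.A from hb)), rfl⟩
    exact (hcl.closure_subset_iff.2 hsub) hξ
  refine S.cyc _ P.isClosed_topologicalClosure ?_ (fun g => inv _ (S.v_mem g))
    (fun m => inv _ (S.π_mem m))
  exact P.le_topologicalClosure ⟨1, one_mem S.A, rfl⟩

theorem faithN (a : H →L[ℂ] H) (ha : a ∈ S.N) (h : S.φ (star a * a) = 0) : a = 0 := by
  have h1 : S.φ (star (star a) * star a) = 0 := by
    rw [star_star, S.tr_N _ _ ha (star_mem ha), h]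
  have h2 : star a S.Ω = 0 := by
    rw [φ_sq] at h1
    simpa using h1
  have h3 : ∀ b ∈ S.A, a (b S.Ω) = 0 := by
    intro b hb
    have hbN := S.A_le_N hb
    have e : S.φ (star (a * b) * (a * b)) = S.φ (star (star b * star a) * (star b * star a)) := by
      have e1 : star (a * b) * (a * b) = (star b * star a) * (a * b) := by simp
      have e2 : star (star b * star a) * (star b * star a) = (a * b) * (star b * star a) := by simp
      rw [e1, e2]
      exact S.tr_N _ _ (mul_mem (star_mem hbN) (star_mem ha)) (mul_mem ha hbN)
    rw [φ_sq, φ_sq] at e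
    have e3 : (star b * star a) S.Ω = 0 := by
      rw [ContinuousLinearMap.mul_apply, h2, map_zero]
    rw [e3] at e
    simpa using e
  have hcl : IsClosed {ξ | a ξ = 0} := isClosed_eq a.continuous continuous_const
  have hc := S.cyclicN
  set P := (Submodule.map (LinearMap.flip (ContinuousLinearMap.coeLM ℂ :
    (H →L[ℂ] H) →ₗ[ℂ] (H →ₗ[ℂ] H)) S.Ω) (Subalgebra.toSubmodule S.A.toSubalgebra)) with hP
  have hsub : (P : Set H) ⊆ {ξ | a ξ = 0} := by
    rintro _ ⟨b, hb, rfl⟩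
    exact h3 b hb
  ext1 ξ
  have hξ : ξ ∈ P.topologicalClosure := by rw [hc]; trivial
  exact (hcl.closure_subset_iff.2 hsub) hξ

noncomputable def D : CStarDilation M where
  N := S.N
  instCompleteSpace := (S.A.isClosed_topologicalClosure).completeSpace_coe
  σ := fun a => S.φ a
  ι := StarAlgHom.codRestrict S.π S.N (fun m => S.A_le_N (S.π_mem m))

theorem model (S : Sys τ V H) (hf : IsFaithful τ) : ∃ (D : CStarDilation M), IsTracialState D.σ ∧ IsFaithful D.σ ∧
    Function.Injective D.ι ∧ (∀ y, D.σ (D.ι y) = τ y) ∧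
    ∃ (v : V × Bool → D.N) (E : V × Bool → Submodule ℂ D.N),
      (∀ g, star (v g) = v (inv g)) ∧ (∀ g, v g * v (inv g) = 1) ∧
      (∀ (g h : V × Bool) (ξ : D.N) (m : M), ξ ∈ E h → (g ≠ inv h ∨ τ m = 0) →
        v g * (D.ι m * ξ) ∈ E g) ∧
      (∀ (g : V × Bool) (m : M), v g * D.ι m ∈ E g) ∧
      (∀ (g : V × Bool) (m : M) (ξ : D.N), ξ ∈ E g → D.σ (D.ι m * ξ) = 0) := by
  have hι : ∀ y, S.D.σ (S.D.ι y) = τ y := fun y => S.φ_π y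
  refine ⟨S.D, ⟨?_, ?_, ?_, ?_⟩, ?_, ?_, hι, fun g => ⟨S.v g, S.A_le_N (S.v_mem g)⟩,
    fun g => Submodule.comap ((LinearMap.flip (ContinuousLinearMap.coeLM ℂ :
    (H →L[ℂ] H) →ₗ[ℂ] (H →ₗ[ℂ] H)) S.Ω) ∘ₗ (S.N.subtype.toAlgHom.toLinearMap)) (S.E g), ?_, ?_, ?_, ?_, ?_⟩
  · intro c x y
    have := S.φ_add (c • x.1) y.1
    rw [φ_smul] at this
    exact this
  · have := hι 1
    rwa [map_one, S.hτ.2.1] at this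
  · intro x
    have := S.φ_sq x.1
    change 0 ≤ S.φ (star x.1 * x.1)
    rw [this]
    exact Complex.zero_le_real.2 (sq_nonneg _)
  · intro x y
    exact S.tr_N x.1 y.1 x.2 y.2
  · intro x hx
    exact Subtype.ext (S.faithN x.1 x.2 hx)
  · rw [injective_iff_map_eq_zero]
    intro y hy
    apply hf
    rw [← hι, map_mul, hy, mul_zero, ← map_zero S.D.ι, hι]
    have := S.hτ.1 1 0 0
    simpa using this
  · intro g
    exact Subtype.ext (S.v_star g)
  · intro g
    exact Subtype.ext (S.v_mul g)
  · intro g h ξ m hξ hh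
    exact S.f1 g h _ m hξ hh
  · intro g m
    exact S.f2 g m
  · intro g m ξ hξ
    exact S.f3 g m _ hξ

end Sys

end Abstract

end LF
namespace LF

section GNS

open scoped InnerProductSpace

/-- Everything we need from the free product of `M` with a free group. -/
theorem exists_model {M : Type u} [NormedRing M] [StarRing M] [CStarRing M] [NormedAlgebra ℂ M]
    [StarModule ℂ M] [CompleteSpace M] (τ : M → ℂ) (hτ : IsTracialState τ) (hτf : IsFaithful τ)
    (V : Type) :
    ∃ (D : CStarDilation M), IsTracialState D.σ ∧ IsFaithful D.σ ∧
    Function.Injective D.ι ∧ (∀ y, D.σ (D.ι y) = τ y) ∧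
    ∃ (v : V × Bool → D.N) (E : V × Bool → Submodule ℂ D.N),
      (∀ g, star (v g) = v (inv g)) ∧ (∀ g, v g * v (inv g) = 1) ∧
      (∀ (g h : V × Bool) (ξ : D.N) (m : M), ξ ∈ E h → (g ≠ inv h ∨ τ m = 0) →
        v g * (D.ι m * ξ) ∈ E g) ∧
      (∀ (g : V × Bool) (m : M), v g * D.ι m ∈ E g) ∧
      (∀ (g : V × Bool) (m : M) (ξ : D.N), ξ ∈ E g → D.σ (D.ι m * ξ) = 0) := by
  let : CStarAlgebra M := {}
  let : PartialOrder M := CStarAlgebra.spectralOrder M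
  let : StarOrderedRing M := CStarAlgebra.spectralOrderedRing M
  have hτ0 : τ 0 = 0 := by
    have := hτ.1 1 0 0
    simpa using this
  let t : M →ₗ[ℂ] ℂ :=
    { toFun := τ
      map_add' := fun x y => by have := hτ.1 1 x y; simpa using this
      map_smul' := fun c x => by have := hτ.1 c x 0; simpa [hτ0] using this }
  let f : M →ₚ[ℂ] ℂ := PositiveLinearMap.mk₀ t (by
    intro x hx
    obtain ⟨y, rfl⟩ := CStarAlgebra.nonneg_iff_eq_star_mul_self.1 hx
    exact hτ.2.2.1 y)
  have hf : ∀ m, f m = τ m := fun _ => rfl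
  let Ω : f.GNS := ((f.toPreGNS 1 : f.PreGNS) : UniformSpace.Completion f.PreGNS)
  have hact : ∀ m, f.gnsStarAlgHom m Ω =
      ((f.toPreGNS m : f.PreGNS) : UniformSpace.Completion f.PreGNS) := by
    intro m
    have := f.gnsNonUnitalStarAlgHom_apply_coe (a := m) (b := f.toPreGNS 1)
    refine this.trans ?_
    congr 1
    change f.toPreGNS (m * 1) = _
    rw [mul_one]
  have hin : ∀ m, ⟪Ω, f.gnsStarAlgHom m Ω⟫_ℂ = τ m := by
    intro m
    rw [hact]
    refine (UniformSpace.Completion.inner_coe _ _).trans ?_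
    rw [f.preGNS_inner_def]
    simp [hf]
  have hn : ‖Ω‖ = 1 := by
    have h := hin 1
    rw [map_one, hτ.2.1] at h
    have h2 : ⟪Ω, Ω⟫_ℂ = 1 := h
    rw [inner_self_eq_norm_sq_to_K] at h2
    have h3 : ‖Ω‖ ^ 2 = 1 := by
      apply Complex.ofReal_injective
      rw [Complex.ofReal_one, ← h2]
      simp
    have := norm_nonneg Ω
    nlinarith
  have ho : Orthonormal ℂ ((↑) : ({Ω} : Set f.GNS) → f.GNS) := by
    constructor
    · rintro ⟨a, rfl⟩
      exact hn
    · rintro ⟨a, rfl⟩ ⟨b, rfl⟩ h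
      exact absurd rfl h
  obtain ⟨w, b, hw, hb⟩ := ho.exists_hilbertBasis_extension
  let b0 : w := ⟨Ω, hw rfl⟩
  have hb0 : b b0 = Ω := by rw [hb]
  let S : Sys τ V (HS f.GNS V b0) :=
    { hτ := hτ
      π := (dgHom f.GNS V b0).comp f.gnsStarAlgHom
      v := vop b b0
      Ω := Om V b b0
      E := Eg b b0
      v_star := vop_star b b0
      v_mul := vop_mul b b0
      f1 := fun g h ξ m hξ hh => F1 b b0 hξ _ (by
        rw [hb0]
        exact hh.imp id (fun h => (hin m).trans h))
      f2 := fun g m => F2 b b0 g _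
      f3 := fun g m ξ hξ => F3 b b0 hξ _
      f4 := fun m => by
        refine (F4 b b0 _).trans ?_
        rw [hb0]
        exact hin m
      cyc := fun C hC hO hv hm => by
        refine cyclic b b0 (Set.range f.gnsStarAlgHom) ?_ C hC hO hv ?_
        · have hd : DenseRange ((↑) : f.PreGNS → UniformSpace.Completion f.PreGNS) :=
            UniformSpace.Completion.denseRange_coe
          refine Dense.mono ?_ hd
          rintro _ ⟨m, rfl⟩
          exact ⟨_, ⟨f.ofPreGNS m, rfl⟩, by rw [hb0, hact]; rfl⟩
        · rintro _ ⟨m, rfl⟩ ξ hξ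
          exact hm m ξ hξ }
  exact S.model hτf

end GNS

end LF
namespace LF

section Sqrt

/-- Halmos square roots. -/
theorem exists_sqrt {M : Type u} [NormedRing M] [StarRing M] [CStarRing M] [NormedAlgebra ℂ M]
    [StarModule ℂ M] [CompleteSpace M] (τ : M → ℂ) (hτ : IsTracialState τ) (hτf : IsFaithful τ)
    (x : M) (hx : ‖x‖ ≤ 1) : ∃ s s' : M, star s = s ∧ star s' = s' ∧ s * s = 1 - x * star x ∧
      s' * s' = 1 - star x * x ∧ x * s' = s * x := by
  let _ : CStarAlgebra M := {}
  let _ : PartialOrder M := CStarAlgebra.spectralOrder M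
  let _ : StarOrderedRing M := CStarAlgebra.spectralOrderedRing M
  have key : ∀ y : M, ‖y‖ ≤ 1 → ∃ s r : M, star s = s ∧ star r = r ∧ r * r = s ∧
      s * s = 1 - star y * y := by
    intro y hy
    have h0 : 0 ≤ 1 - star y * y := by
      rw [sub_nonneg]
      apply (CStarAlgebra.norm_le_one_iff_of_nonneg _ (star_mul_self_nonneg y)).1
      rw [CStarRing.norm_star_mul_self]
      nlinarith [norm_nonneg y]
    refine ⟨CFC.sqrt (1 - star y * y), CFC.sqrt (CFC.sqrt (1 - star y * y)), ?_, ?_, ?_, ?_⟩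
    · exact (CFC.sqrt_nonneg _).isSelfAdjoint
    · exact (CFC.sqrt_nonneg _).isSelfAdjoint
    · exact CFC.sqrt_mul_sqrt_self _ (CFC.sqrt_nonneg _)
    · exact CFC.sqrt_mul_sqrt_self _ h0
  obtain ⟨s', r', hs', hr', hrs', hss'⟩ := key x hx
  obtain ⟨s, r, hs, hr, hrs, hss⟩ := key (star x) (by rwa [norm_star])
  rw [star_star] at hss
  refine ⟨s, s', hs, hs', hss, hss', ?_⟩
  have hτ0 : τ 0 = 0 := by
    have := hτ.1 1 0 0
    simpa using this
  have hadd : ∀ a b, τ (a + b) = τ a + τ b := fun a b => by have := hτ.1 1 a b; simpa using this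
  have hcomm := hτ.2.2.2
  obtain ⟨d, hd⟩ : ∃ d, d = x * s' - s * x := ⟨_, rfl⟩
  have h1 : s * d + d * s' = 0 := by
    have : s * d + d * s' = x * (s' * s') - (s * s) * x := by rw [hd]; noncomm_ring
    rw [this, hss, hss']; noncomm_ring
  have h2 : star (r * d) * (r * d) + star d * (d * s') = 0 := by
    have : star (r * d) * (r * d) = star d * (s * d) := by
      rw [star_mul, hr, ← hrs]; noncomm_ring
    rw [this, ← mul_add, h1, mul_zero]
  have h3 : τ (star (r * d) * (r * d)) + τ (star (d * r') * (d * r')) = 0 := by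
    have : τ (star (d * r') * (d * r')) = τ (star d * (d * s')) := by
      rw [star_mul, hr', mul_assoc, hcomm, ← hrs']; congr 1; noncomm_ring
    rw [this, ← hadd, h2, hτ0]
  have p1 := hτ.2.2.1 (r * d)
  have p2 := hτ.2.2.1 (d * r')
  have h4 : r * d = 0 := by
    apply hτf
    exact ((add_eq_zero_iff_of_nonneg p1 p2).1 h3).1
  have h5 : d * r' = 0 := by
    apply hτf
    exact ((add_eq_zero_iff_of_nonneg p1 p2).1 h3).2
  have h6 : s * d = 0 := by rw [← hrs, mul_assoc, h4, mul_zero]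
  have h7 : d * s' = 0 := by rw [← hrs', ← mul_assoc, h5, zero_mul]
  have h8 : d = 0 := by
    apply hτf
    have e : star d * d = s' * (star x * d) := by
      have : star d * d = s' * (star x * d) - star x * (s * d) := by
        conv_lhs => rw [show star d = s' * star x - star x * s by
          rw [hd, star_sub, star_mul, star_mul, hs, hs']]
        noncomm_ring
      rw [this, h6, mul_zero, sub_zero]
    rw [e, hcomm, mul_assoc, h7, mul_zero, hτ0]
  rw [hd] at h8
  exact sub_eq_zero.1 h8

end Sqrt

section Mat

variable {n : ℕ} {A : Type*} [Ring A]

/-- The generalized Halmos matrices. -/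
def HM (x s : Fin n → Bool → A) (v : (Fin n × Fin (n + 1)) × Bool → A) (i : Fin n) (b : Bool) :
    Matrix (Fin (n + 1)) (Fin (n + 1)) A :=
  Matrix.of fun r c =>
    if r = 0 then (if c = 0 then x i b else if c = i.succ then s i b else 0)
    else if r = i.succ then (if c = 0 then s i (!b) else if c = i.succ then - x i (!b) else 0)
    else if c = r then v ((i, r), b) else 0

variable (x s : Fin n → Bool → A) (v : (Fin n × Fin (n + 1)) × Bool → A)

theorem HM_zero (i : Fin n) (b : Bool) (c : Fin (n + 1)) : HM x s v i b 0 c =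
    if c = 0 then x i b else if c = i.succ then s i b else 0 := by
  simp [HM]

theorem HM_succ (i : Fin n) (b : Bool) (c : Fin (n + 1)) : HM x s v i b i.succ c =
    if c = 0 then s i (!b) else if c = i.succ then - x i (!b) else 0 := by
  simp [HM]

theorem HM_else (i : Fin n) (b : Bool) (r c : Fin (n + 1)) (h0 : r ≠ 0) (hr : r ≠ i.succ) :
    HM x s v i b r c = if c = r then v ((i, r), b) else 0 := by
  simp [HM, h0, hr]

theorem HM_mul_zero (i : Fin n) (b : Bool) (W : Matrix (Fin (n + 1)) (Fin (n + 1)) A)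
    (c : Fin (n + 1)) : (HM x s v i b * W) 0 c = x i b * W 0 c + s i b * W i.succ c := by
  have : ∀ j, HM x s v i b 0 j * W j c =
      (if j = 0 then x i b * W 0 c else 0) + (if j = i.succ then s i b * W i.succ c else 0) := by
    intro j
    rw [HM_zero]
    by_cases h : j = 0
    · subst h; simp [(Fin.succ_ne_zero i).symm]
    · by_cases h' : j = i.succ
      · subst h'; simp
      · simp [h, h']
  rw [Matrix.mul_apply, Finset.sum_congr rfl (fun j _ => this j), Finset.sum_add_distrib]
  simp

theorem HM_mul_succ (i : Fin n) (b : Bool) (W : Matrix (Fin (n + 1)) (Fin (n + 1)) A)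
    (c : Fin (n + 1)) : (HM x s v i b * W) i.succ c =
      s i (!b) * W 0 c - x i (!b) * W i.succ c := by
  have : ∀ j, HM x s v i b i.succ j * W j c =
      (if j = 0 then s i (!b) * W 0 c else 0) +
      (if j = i.succ then - x i (!b) * W i.succ c else 0) := by
    intro j
    rw [HM_succ]
    by_cases h : j = 0
    · subst h; simp [(Fin.succ_ne_zero i).symm]
    · by_cases h' : j = i.succ
      · subst h'; simp
      · simp [h, h']
  rw [Matrix.mul_apply, Finset.sum_congr rfl (fun j _ => this j), Finset.sum_add_distrib]
  simp [sub_eq_add_neg]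

theorem HM_mul_else (i : Fin n) (b : Bool) (W : Matrix (Fin (n + 1)) (Fin (n + 1)) A)
    (r c : Fin (n + 1)) (h0 : r ≠ 0) (hr : r ≠ i.succ) :
    (HM x s v i b * W) r c = v ((i, r), b) * W r c := by
  rw [Matrix.mul_apply]
  simp [HM_else x s v i b r _ h0 hr]

theorem HM_star [StarRing A] (hx : ∀ i b, star (x i b) = x i (!b)) (hs : ∀ i b, star (s i b) = s i b)
    (hv : ∀ g, star (v g) = v (inv g)) (i : Fin n) (b : Bool) :
    star (HM x s v i b) = HM x s v i (!b) := by
  ext r c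
  rw [Matrix.star_apply]
  by_cases hr : r = 0
  · subst hr
    by_cases hc : c = 0
    · subst hc; simp [HM_zero, hx]
    · by_cases hc' : c = i.succ
      · subst hc'; simp [HM_zero, HM_succ, hs]
      · rw [HM_else _ _ _ _ _ _ _ hc hc', HM_zero]
        simp [hc, hc', Ne.symm hc]
  · by_cases hr' : r = i.succ
    · subst hr'
      by_cases hc : c = 0
      · subst hc; simp [HM_zero, HM_succ, hs]
      · by_cases hc' : c = i.succ
        · subst hc'; simp [HM_succ, hx]
        · rw [HM_else _ _ _ _ _ _ _ hc hc', HM_succ]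
          simp [hc, hc', Ne.symm hc']
    · rw [HM_else _ _ _ _ _ _ _ hr hr']
      by_cases hc : c = 0
      · subst hc; simp [HM_zero, hr, hr', Ne.symm hr]
      · by_cases hc' : c = i.succ
        · subst hc'; simp [HM_succ, hr, hr', Ne.symm hr']
        · rw [HM_else _ _ _ _ _ _ _ hc hc']
          by_cases h : c = r
          · subst h; simp [hv, inv]
          · simp [h, Ne.symm h]

theorem HM_mul_inv (h1 : ∀ i b, s i b * s i b = 1 - x i b * x i (!b))
    (h2 : ∀ i b, x i b * s i (!b) = s i b * x i b)
    (hv : ∀ g, v g * v (inv g) = 1) (i : Fin n) (b : Bool) :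
    HM x s v i b * HM x s v i (!b) = 1 := by
  ext r c
  by_cases hr : r = 0
  · subst hr
    rw [HM_mul_zero, HM_zero, HM_succ, Bool.not_not]
    by_cases hc : c = 0
    · subst hc; simp [h1]
    · by_cases hc' : c = i.succ
      · subst hc'; simp [h2, (Fin.succ_ne_zero i).symm]
      · simp [hc, hc', Ne.symm hc]
  · by_cases hr' : r = i.succ
    · subst hr'
      rw [HM_mul_succ, HM_zero, HM_succ, Bool.not_not]
      by_cases hc : c = 0
      · subst hc
        have := h2 i (!b)
        rw [Bool.not_not] at this
        simp [this]
      · by_cases hc' : c = i.succ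
        · subst hc'; simp [h1]
        · simp [hc, hc', Ne.symm hc']
    · rw [HM_mul_else _ _ _ _ _ _ _ _ hr hr', HM_else _ _ _ _ _ _ _ hr hr', Matrix.one_apply]
      by_cases h : c = r
      · subst h
        have := hv ((i, c), b)
        simpa [inv] using this
      · simp [h, Ne.symm h]

end Mat

end LF
namespace LF

section Comb

variable {n : ℕ}

/-- Alternating lists of letters. -/
def Good (L : List (Fin n × Bool)) : Prop := L.IsChain (fun p q => p.1 ≠ q.1 ∧ q.2 = !p.2)

def wd {A : Type*} [Monoid A] (x : Fin n → Bool → A) (L : List (Fin n × Bool)) : A :=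
  (L.map fun p => x p.1 p.2).prod

theorem wd_cons {A : Type*} [Monoid A] (x : Fin n → Bool → A) (p : Fin n × Bool)
    (L : List (Fin n × Bool)) : wd x (p :: L) = x p.1 p.2 * wd x L := by simp [wd]

theorem wd_concat {A : Type*} [Monoid A] (x : Fin n → Bool → A) (p : Fin n × Bool)
    (L : List (Fin n × Bool)) : wd x (L ++ [p]) = wd x L * x p.1 p.2 := by simp [wd]

theorem wd_nil {A : Type*} [Monoid A] (x : Fin n → Bool → A) : wd x [] = 1 := by simp [wd]

theorem good_sign (q : Fin n × Bool) : ∀ (L : List (Fin n × Bool)) (p : Fin n × Bool),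
    Good (p :: (L ++ [q])) → q.2 = xor p.2 (!(Nat.bodd L.length)) := by
  intro L
  induction L with
  | nil =>
    intro p h
    have := (List.isChain_cons_cons.1 h).1.2
    simp [this]
  | cons r L ih =>
    intro p h
    have h' := List.isChain_cons_cons.1 h
    rw [ih r h'.2, h'.1.2]
    simp

theorem good_ext {L : List (Fin n × Bool)} {p q : Fin n × Bool} (h : Good (L ++ [p]))
    (hp : p.1 ≠ q.1) (hq : q.2 = !p.2) : Good ((L ++ [p]) ++ [q]) := by
  have := (List.isChain_append_cons_cons (l₁ := L) (b := p) (c := q) (l₂ := [])).2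
    ⟨h, ⟨hp, hq⟩, by simp⟩
  unfold Good
  simpa using this

theorem even_bodd {k : ℕ} : Even k ↔ Nat.bodd k = false := by
  rw [Nat.even_iff, Nat.mod_two_of_bodd]
  cases Nat.bodd k <;> simp

end Comb

section Inv

variable {n : ℕ} {M N : Type u} [Ring M] [Ring N] [Algebra ℂ M] [Algebra ℂ N]

/-- The abstract setting for the computation. -/
structure Setting (τ : M → ℂ) (σ : N → ℂ) (ι : M →ₐ[ℂ] N) (x s : Fin n → Bool → M)
    (v : (Fin n × Fin (n + 1)) × Bool → N) (E : (Fin n × Fin (n + 1)) × Bool → Submodule ℂ N) :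
    Prop where
  τadd : ∀ a b, τ (a - b) = τ a - τ b
  τcomm : ∀ a b, τ (a * b) = τ (b * a)
  σadd : ∀ a b, σ (a + b) = σ a + σ b
  σsub : ∀ a b, σ (a - b) = σ a - σ b
  σι : ∀ a, σ (ι a) = τ a
  hW : ∀ L, Good L → L ≠ [] → Even L.length → τ (wd x L) = 0
  hs : ∀ i b, s i b * s i b = 1 - x i b * x i (!b)
  f1 : ∀ (g h : (Fin n × Fin (n + 1)) × Bool) (ξ : N) (m : M), ξ ∈ E h → (g ≠ inv h ∨ τ m = 0) →
        v g * (ι m * ξ) ∈ E g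
  f2 : ∀ (g : (Fin n × Fin (n + 1)) × Bool) (m : M), v g * ι m ∈ E g
  f3 : ∀ (g : (Fin n × Fin (n + 1)) × Bool) (m : M) (ξ : N), ξ ∈ E g → σ (ι m * ξ) = 0

variable {τ : M → ℂ} {σ : N → ℂ} {ι : M →ₐ[ℂ] N} {x s : Fin n → Bool → M}
    {v : (Fin n × Fin (n + 1)) × Bool → N} {E : (Fin n × Fin (n + 1)) × Bool → Submodule ℂ N}

theorem Setting.trace (S : Setting τ σ ι x s v E) (k : Fin n) (b : Bool)
    (L : List (Fin n × Bool)) (h : Good ((k, b) :: (L ++ [(k, !b)]))) :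
    τ (s k (!b) * wd x L * s k (!b)) = 0 := by
  have hev : Even L.length := by
    have := good_sign _ _ _ h
    rw [even_bodd]
    cases b <;> cases hb : Nat.bodd L.length <;> simp_all
  have hne : L ≠ [] := by
    rintro rfl
    exact (List.isChain_cons_cons.1 h).1.1 rfl
  have hL : Good L := List.IsChain.left_of_append (List.isChain_cons.1 h).2
  have e1 := S.hW L hL hne hev
  have e2 := S.hW _ h (by simp) (by simp [hev])
  rw [wd_cons, wd_concat, S.τcomm, mul_assoc, S.τcomm] at e2
  rw [S.τcomm, ← mul_assoc, S.hs, Bool.not_not, sub_mul, one_mul, S.τadd, e1]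
  exact (congrArg (fun z => 0 - z) e2).trans (sub_zero 0)

/-- The inductive invariant for a column of a product of Halmos matrices. -/
structure Inv (τ : M → ℂ) (σ : N → ℂ) (ι : M →ₐ[ℂ] N) (x s : Fin n → Bool → M)
    (v : (Fin n × Fin (n + 1)) × Bool → N) (E : (Fin n × Fin (n + 1)) × Bool → Submodule ℂ N)
    (a : Fin (n + 1)) (δ : Bool) (i : Fin n) (ε : Bool) (ψ : Fin (n + 1) → N) : Prop where
  i1 : ∀ j, j ≠ 0 → j ≠ i.succ → ψ j ∈ E ((i, j), ε)
  i2 : ∀ k δ' L, Good ((k, δ') :: (L ++ [(i, ε)])) → ∀ l, l ≠ k →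
    v ((l, k.succ), !δ') * (ι (s k (!δ') * wd x L) * ψ 0) ∈ E ((l, k.succ), !δ')
  i3 : ∀ l, l ≠ i → v ((l, i.succ), !ε) * ψ i.succ ∈ E ((l, i.succ), !ε)
  i4 : a = 0 → ∀ L, Good (L ++ [(i, ε)]) → xor ε (Nat.bodd L.length) = !δ →
    σ (ι (wd x L) * ψ 0) = 0
  i5 : ∀ k : Fin n, a = k.succ → ∀ L, Good ((k, !δ) :: (L ++ [(i, ε)])) →
    σ (ι (s k δ * wd x L) * ψ 0) = 0

theorem inv_base (S : Setting τ σ ι x s v E) (a : Fin (n + 1)) (i : Fin n) (ε : Bool) :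
    Inv τ σ ι x s v E a ε i ε
      (fun j => HM (fun i b => ι (x i b)) (fun i b => ι (s i b)) v i ε j a) := by
  have h0 : ∃ m, HM (fun i b => ι (x i b)) (fun i b => ι (s i b)) v i ε 0 a = ι m := by
    rw [HM_zero]
    by_cases h : a = 0
    · exact ⟨_, by rw [if_pos h]⟩
    · by_cases h' : a = i.succ
      · exact ⟨_, by rw [if_neg h, if_pos h']⟩
      · exact ⟨0, by rw [if_neg h, if_neg h', map_zero]⟩
  have h1 : ∃ m, HM (fun i b => ι (x i b)) (fun i b => ι (s i b)) v i ε i.succ a = ι m := by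
    rw [HM_succ]
    by_cases h : a = 0
    · exact ⟨_, by rw [if_pos h]⟩
    · by_cases h' : a = i.succ
      · exact ⟨- x i (!ε), by rw [if_neg h, if_pos h', map_neg]⟩
      · exact ⟨0, by rw [if_neg h, if_neg h', map_zero]⟩
  have σ0 : σ 0 = 0 := by
    have := S.σadd 0 0
    simpa using this
  refine ⟨?_, ?_, ?_, ?_, ?_⟩
  · intro j hj hj'
    rw [HM_else _ _ _ _ _ _ _ hj hj']
    by_cases h : a = j
    · rw [if_pos h]
      have := S.f2 ((i, j), ε) 1
      rwa [map_one, mul_one] at this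
    · rw [if_neg h]
      exact zero_mem _
  · intro k δ' L _ l _
    obtain ⟨m, hm⟩ := h0
    rw [hm, ← map_mul]
    exact S.f2 _ _
  · intro l _
    obtain ⟨m, hm⟩ := h1
    rw [hm]
    exact S.f2 _ _
  · rintro rfl L hL hb
    rw [HM_zero, if_pos rfl, ← map_mul, S.σι, ← wd_concat x (i, ε) L]
    refine S.hW _ hL (by simp) ?_
    rw [even_bodd]
    cases ε <;> cases hb : Nat.bodd L.length <;> simp_all
  · rintro k rfl L hL
    rw [HM_zero, if_neg (Fin.succ_ne_zero k)]
    by_cases h : k.succ = i.succ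
    · have h' := Fin.succ_injective _ h
      subst h'
      rw [if_pos rfl, ← map_mul, S.σι]
      have := S.trace k (!ε) L (by rwa [Bool.not_not])
      rwa [Bool.not_not] at this
    · rw [if_neg h, mul_zero, σ0]

theorem inv_step (S : Setting τ σ ι x s v E) (a : Fin (n + 1)) (δ : Bool) (i i' : Fin n)
    (hi : i' ≠ i) (ε : Bool) (W : Matrix (Fin (n + 1)) (Fin (n + 1)) N)
    (I : Inv τ σ ι x s v E a δ i ε (fun j => W j a)) :
    Inv τ σ ι x s v E a δ i' (!ε)
      (fun j => (HM (fun i b => ι (x i b)) (fun i b => ι (s i b)) v i' (!ε) * W) j a) := by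
  have hE : W i'.succ a ∈ E ((i, i'.succ), ε) :=
    I.i1 _ (Fin.succ_ne_zero _) (fun h => hi (Fin.succ_injective _ h))
  have hext : ∀ L, Good (L ++ [(i', !ε)]) → Good ((L ++ [(i', !ε)]) ++ [(i, ε)]) := by
    intro L hL
    exact good_ext hL hi (by simp)
  have hext' : ∀ p L, Good (p :: (L ++ [(i', !ε)])) → Good (p :: ((L ++ [(i', !ε)]) ++ [(i, ε)])) := by
    intro p L hL
    exact good_ext (L := p :: L) hL hi (by simp)
  have hexp : ∀ m : M, ι m * (ι (x i' (!ε)) * W 0 a + ι (s i' (!ε)) * W i'.succ a) =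
      ι (m * x i' (!ε)) * W 0 a + ι (m * s i' (!ε)) * W i'.succ a := by
    intro m
    rw [mul_add, map_mul, map_mul, mul_assoc, mul_assoc]
  refine ⟨?_, ?_, ?_, ?_, ?_⟩
  · intro j hj hj'
    rw [HM_mul_else _ _ _ _ _ _ _ _ hj hj']
    by_cases h : j = i.succ
    · subst h
      exact I.i3 i' hi
    · have := S.f1 ((i', j), !ε) ((i, j), ε) (W j a) 1 (I.i1 j hj h) (Or.inl (by
        intro h'
        apply hi
        exact congrArg (fun p => p.1.1) h'))
      rwa [map_one, one_mul] at this
  · intro k δ' L hL l hl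
    rw [HM_mul_zero, hexp, mul_add]
    refine add_mem ?_ ?_
    · have := I.i2 k δ' (L ++ [(i', !ε)]) (hext' _ _ hL) l hl
      rwa [wd_concat, ← mul_assoc (s k (!δ'))] at this
    · refine S.f1 _ _ _ _ hE ?_
      by_cases h : ((l, k.succ), !δ') = inv ((i, i'.succ), ε)
      · right
        have hk : k = i' := Fin.succ_injective _ (congrArg (fun p => p.1.2) h)
        have hδ : (!δ') = !ε := congrArg (fun p => p.2) h
        have hδ' : δ' = ε := by simpa using hδ
        subst hk hδ'
        exact S.trace k δ' L hL
      · exact Or.inl h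
  · intro l hl
    rw [HM_mul_succ, mul_sub]
    refine sub_mem ?_ ?_
    · have := I.i2 i' (!ε) [] (by
        refine List.isChain_cons_cons.2 ⟨⟨hi, by simp⟩, by simp⟩) l hl
      rwa [wd_nil, mul_one] at this
    · refine S.f1 _ _ _ _ hE (Or.inl ?_)
      intro h
      have hδ : (!!ε) = !ε := congrArg (fun p => p.2) h
      simp at hδ
  · intro ha L hL hb
    rw [HM_mul_zero, hexp, S.σadd, S.f3 _ _ _ hE, add_zero]
    have := I.i4 ha (L ++ [(i', !ε)]) (hext _ hL) (by
      rw [← hb]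
      simp)
    rwa [wd_concat] at this
  · intro k ha L hL
    rw [HM_mul_zero, hexp, S.σadd, S.f3 _ _ _ hE, add_zero]
    have := I.i5 k ha (L ++ [(i', !ε)]) (hext' _ _ hL)
    rwa [wd_concat, ← mul_assoc] at this

theorem inv_all (S : Setting τ σ ι x s v E) (a : Fin (n + 1)) :
    ∀ (L : List (Fin n × Bool)) (i : Fin n) (ε : Bool), Good ((i, ε) :: L) →
    Inv τ σ ι x s v E a (xor ε (Nat.bodd L.length)) i ε
      (fun j => wd (HM (fun i b => ι (x i b)) (fun i b => ι (s i b)) v) ((i, ε) :: L) j a) := by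
  intro L
  induction L with
  | nil =>
    intro i ε _
    have := inv_base S a i ε
    simpa [wd] using this
  | cons q L ih =>
    intro i' ε' h
    obtain ⟨i, ε⟩ := q
    have h' := List.isChain_cons_cons.1 h
    have he : ε' = !ε := by
      have := h'.1.2
      dsimp only at this
      rw [this, Bool.not_not]
    subst he
    have := inv_step S a _ i i' h'.1.1 ε _ (ih i ε h'.2)
    rw [wd_cons]
    have e : (xor (!ε) (Nat.bodd ((i, ε) :: L).length)) = xor ε (Nat.bodd L.length) := by simp
    rw [e]
    exact this

theorem diag_zero (S : Setting τ σ ι x s v E) (a : Fin (n + 1)) (L : List (Fin n × Bool))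
    (hL : Good L) (hne : L ≠ []) (hev : Even L.length) :
    σ (wd (HM (fun i b => ι (x i b)) (fun i b => ι (s i b)) v) L a a) = 0 := by
  match L, hL, hne, hev with
  | [p], _, _, hev => simp at hev
  | (i, ε) :: (i0, ε0) :: L, hL, _, hev =>
    have h' := List.isChain_cons_cons.1 hL
    have hb : Nat.bodd L.length = false := by
      rw [← even_bodd]
      simpa [Nat.even_add_one] using hev
    have he0 : ε0 = !ε := h'.1.2
    have I := inv_all S a _ i ε hL
    have I0 := inv_all S a _ i0 ε0 h'.2
    by_cases ha : a = 0
    · have := I.i4 ha [] (by simp [Good]) (by simp [hb])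
      rw [wd_nil, map_one, one_mul] at this
      rw [ha] at this ⊢
      exact this
    · by_cases ha' : a = i.succ
      · rw [wd_cons, ha', HM_mul_succ, S.σsub]
        have e1 := S.f3 _ (x i (!ε)) _ (I0.i1 i.succ (Fin.succ_ne_zero _)
          (fun h => h'.1.1 (Fin.succ_injective _ h)))
        have e2 := I0.i5 i ha' [] (by
          refine List.isChain_cons_cons.2 ⟨⟨h'.1.1, by simp [hb]⟩, by simp⟩)
        rw [ha'] at e1 e2
        rw [wd_nil, mul_one, hb, Bool.xor_false, he0] at e2
        rw [he0] at e1 ⊢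
        rw [e1, e2, sub_zero]
      · have := S.f3 _ 1 _ (I.i1 a ha ha')
        rwa [map_one, one_mul] at this

end Inv

end LF
namespace LF

section Conv

variable {n : ℕ} {A : Type*} [Ring A] [StarRing A] [Algebra ℂ A]

def sg (x : Fin n → A) (i : Fin n) (b : Bool) : A := if b then x i else star (x i)

theorem bodd_mod (k : ℕ) : Nat.bodd k = false ↔ k % 2 = 0 := by
  rw [← even_bodd, Nat.even_iff]

theorem LWord_eq {m : ℕ} (x : Fin n → A) (i : Fin m → Fin n) :
    LWord x i = wd (sg x) (List.ofFn fun s : Fin m => (i s, xor true (Nat.bodd s))) := by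
  unfold LWord wd
  rw [List.map_ofFn]
  congr 2
  funext s
  by_cases h : (s : ℕ) % 2 = 0
  · simp [sg, h, (bodd_mod _).2 h]
  · have : Nat.bodd (s : ℕ) = true := by
      rw [← Bool.not_eq_false, bodd_mod]; exact h
    simp [sg, h, this]

theorem LWordStar_eq {m : ℕ} (x : Fin n → A) (i : Fin m → Fin n) :
    LWordStar x i = wd (sg x) (List.ofFn fun s : Fin m => (i s, xor false (Nat.bodd s))) := by
  unfold LWordStar wd
  rw [List.map_ofFn]
  congr 2
  funext s
  by_cases h : (s : ℕ) % 2 = 0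
  · simp [sg, h, (bodd_mod _).2 h]
  · have : Nat.bodd (s : ℕ) = true := by
      rw [← Bool.not_eq_false, bodd_mod]; exact h
    simp [sg, h, this]

theorem good_ofFn {m : ℕ} (i : Fin m → Fin n) (b : Bool)
    (hi : ∀ s t : Fin m, (t : ℕ) = (s : ℕ) + 1 → i s ≠ i t) :
    Good (List.ofFn fun s : Fin m => (i s, xor b (Nat.bodd s))) := by
  unfold Good
  rw [List.isChain_iff_getElem]
  intro k hk
  simp only [List.length_ofFn] at hk
  simp only [List.getElem_ofFn]
  exact ⟨hi _ _ rfl, by simp⟩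

theorem good_get (L : List (Fin n × Bool)) (hL : Good L) (h0 : 0 < L.length) :
    ∀ (k : ℕ) (hk : k < L.length), L[k].2 = xor (L[0].2) (Nat.bodd k) := by
  unfold Good at hL
  rw [List.isChain_iff_getElem] at hL
  intro k
  induction k with
  | zero => intro _; simp
  | succ k ih =>
    intro hk
    rw [(hL k hk).2, ih (by omega)]
    simp

theorem lfree_iff (τ : A → ℂ) (x : Fin n → A) : IsLFree τ x ↔
    ∀ L, Good L → L ≠ [] → Even L.length → τ (wd (sg x) L) = 0 := by
  constructor
  · intro h L hL hne hev
    have h0 : 0 < L.length := List.length_pos_iff.2 hne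
    obtain ⟨k, hk⟩ := hev
    have hk2 : L.length = 2 * k := by omega
    let i : Fin (2 * k) → Fin n := fun s => (L[(s : ℕ)]'(by rw [hk2]; exact s.2)).1
    have hi : ∀ s t : Fin (2 * k), (t : ℕ) = (s : ℕ) + 1 → i s ≠ i t := by
      intro s t hst
      have hL' := hL
      unfold Good at hL'
      rw [List.isChain_iff_getElem] at hL'
      have := (hL' s (by rw [← hst, hk2]; exact t.2)).1
      simp only [i, hst]
      exact this
    have hLe : L = List.ofFn fun s : Fin (2 * k) => (i s, xor (L[0].2) (Nat.bodd s)) := by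
      apply List.ext_getElem
      · simp [hk2]
      · intro j hj hj'
        rw [List.getElem_ofFn]
        exact Prod.ext rfl (good_get L hL h0 j hj)
    have := h k (by omega) i hi
    rw [LWord_eq, LWordStar_eq] at this
    rw [hLe]
    cases hb : L[0].2
    · exact this.2
    · exact this.1
  · intro h k hk i hi
    rw [LWord_eq, LWordStar_eq]
    have : ∀ b, τ (wd (sg x) (List.ofFn fun s : Fin (2 * k) => (i s, xor b (Nat.bodd s)))) = 0 := by
      intro b
      refine h _ (good_ofFn i b hi) ?_ (by simp)
      intro h'
      have := congrArg List.length h'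
      simp at this
      omega
    exact ⟨this true, this false⟩

theorem tr_zero {τ : A → ℂ} (hτ : IsTracialState τ) : τ 0 = 0 := by
  have := hτ.1 1 0 0
  simpa using this

theorem tr_add {τ : A → ℂ} (hτ : IsTracialState τ) (a b : A) : τ (a + b) = τ a + τ b := by
  have := hτ.1 1 a b
  simpa using this

theorem tr_sub' {τ : A → ℂ} (hτ : IsTracialState τ) (a b : A) : τ (a - b) = τ a - τ b := by
  have := tr_add hτ (a - b) b
  rw [sub_add_cancel] at this
  rw [this]; ring

theorem tr_sum {τ : A → ℂ} (hτ : IsTracialState τ) {ι : Type*} (s : Finset ι) (f : ι → A) :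
    τ (∑ j ∈ s, f j) = ∑ j ∈ s, τ (f j) := by
  classical
  induction s using Finset.induction_on with
  | empty => simp [tr_zero hτ]
  | insert a s ha ih => rw [Finset.sum_insert ha, Finset.sum_insert ha, tr_add hτ, ih]

theorem mat_sq {σ : A → ℂ} (hσ : IsTracialState σ) (X : Matrix (Fin (n + 1)) (Fin (n + 1)) A) :
    ∑ j, σ ((star X * X) j j) = ∑ j, ∑ l, σ (star (X l j) * X l j) := by
  refine Finset.sum_congr rfl fun j _ => ?_
  rw [Matrix.mul_apply, tr_sum hσ]
  rfl

theorem coef_ne (n : ℕ) : (1 / ((n : ℂ) + 1)) ≠ 0 :=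
  one_div_ne_zero (by exact_mod_cast Nat.succ_ne_zero n)

theorem mat_tracial {σ : A → ℂ} (hσ : IsTracialState σ) :
    IsTracialState (fun V : Matrix (Fin (n + 1)) (Fin (n + 1)) A =>
          (1 / ((n : ℂ) + 1)) * ∑ j, σ (V j j)) := by
  refine ⟨?_, ?_, ?_, ?_⟩
  · intro c X Y
    have : ∀ j, σ ((c • X + Y) j j) = c * σ (X j j) + σ (Y j j) := fun j => hσ.1 c _ _
    simp only [this, Finset.sum_add_distrib, ← Finset.mul_sum]
    ring
  · have h : (n : ℂ) + 1 ≠ 0 := by exact_mod_cast Nat.succ_ne_zero n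
    simp [hσ.2.1]
    field_simp
  · intro X
    dsimp only
    rw [mat_sq hσ]
    refine mul_nonneg ?_ (Finset.sum_nonneg fun j _ => Finset.sum_nonneg fun l _ => hσ.2.2.1 _)
    have : (1 / ((n : ℂ) + 1)) = ((1 / ((n : ℝ) + 1) : ℝ) : ℂ) := by push_cast; ring
    rw [this]
    exact Complex.zero_le_real.2 (by positivity)
  · intro X Y
    dsimp only
    congr 1
    simp only [Matrix.mul_apply, tr_sum hσ]
    rw [Finset.sum_comm]
    simp only [hσ.2.2.2]

theorem mat_faithful {σ : A → ℂ} (hσ : IsTracialState σ) (hf : IsFaithful σ) :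
    IsFaithful (fun V : Matrix (Fin (n + 1)) (Fin (n + 1)) A =>
          (1 / ((n : ℂ) + 1)) * ∑ j, σ (V j j)) := by
  intro X hX
  dsimp only at hX
  rw [mat_sq hσ] at hX
  have h := (mul_eq_zero.1 hX).resolve_left (coef_ne n)
  rw [Finset.sum_eq_zero_iff_of_nonneg
    (fun j _ => Finset.sum_nonneg fun l _ => hσ.2.2.1 _)] at h
  ext l j
  have h2 := h j (Finset.mem_univ _)
  rw [Finset.sum_eq_zero_iff_of_nonneg (fun l _ => hσ.2.2.1 _)] at h2
  exact hf _ (h2 l (Finset.mem_univ _))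

end Conv

end LF

/-- Dilation of an L-free family of contractions to an L-free
family of unitaries in the `(n+1) × (n+1)` matrices over a larger algebra. -/
theorem LFree_dilation_to_unitaries
    {M : Type u} [NormedRing M] [StarRing M] [CStarRing M] [NormedAlgebra ℂ M]
    [StarModule ℂ M] [CompleteSpace M]
    (τ : M → ℂ) (hτ : IsTracialState τ) (hτf : IsFaithful τ)
    (n : ℕ) (hn : 1 ≤ n)
    (x : Fin n → M) (hx : ∀ i, ‖x i‖ ≤ 1) (hL : IsLFree τ x) :
    ∃ D : CStarDilation M,
      IsTracialState D.σ ∧ IsFaithful D.σ ∧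
      Function.Injective D.ι ∧ (∀ y : M, D.σ (D.ι y) = τ y) ∧
      ∃ U : Fin n → Matrix (Fin (n + 1)) (Fin (n + 1)) D.N,
        (∀ i, IsUnitary (U i)) ∧
        IsTracialState (fun V : Matrix (Fin (n + 1)) (Fin (n + 1)) D.N =>
          (1 / ((n : ℂ) + 1)) * ∑ j, D.σ (V j j)) ∧
        IsFaithful (fun V : Matrix (Fin (n + 1)) (Fin (n + 1)) D.N =>
          (1 / ((n : ℂ) + 1)) * ∑ j, D.σ (V j j)) ∧
        IsLFree (fun V : Matrix (Fin (n + 1)) (Fin (n + 1)) D.N =>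
          (1 / ((n : ℂ) + 1)) * ∑ j, D.σ (V j j)) U ∧
        (∀ i, U i 0 0 = D.ι (x i)) := by
  choose s s' hs hs' hss hss' hxq using fun i => LF.exists_sqrt τ hτ hτf (x i) (hx i)
  obtain ⟨D, hσ, hσf, hinj, hσι, v, E, hvs, hvm, f1, f2, f3⟩ :=
    LF.exists_model τ hτ hτf (Fin n × Fin (n + 1))
  let X : Fin n → Bool → M := LF.sg x
  let Q : Fin n → Bool → M := fun i b => if b then s i else s' i
  have hXs : ∀ i b, star (X i b) = X i (!b) := by
    intro i b
    cases b <;> simp [X, LF.sg]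
  have hQs : ∀ i b, star (Q i b) = Q i b := by
    intro i b
    cases b <;> simp [Q, hs, hs']
  have hQ : ∀ i b, Q i b * Q i b = 1 - X i b * X i (!b) := by
    intro i b
    cases b <;> simp [X, Q, LF.sg, hss, hss']
  have hXQ : ∀ i b, X i b * Q i (!b) = Q i b * X i b := by
    intro i b
    cases b
    · have := congrArg star (hxq i)
      rw [star_mul, star_mul, hs, hs'] at this
      simp [X, Q, LF.sg, this]
    · simp [X, Q, LF.sg, hxq]
  let U : Fin n → Bool → Matrix (Fin (n + 1)) (Fin (n + 1)) D.N :=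
    LF.HM (fun i b => D.ι (X i b)) (fun i b => D.ι (Q i b)) v
  have hUs : ∀ i b, star (U i b) = U i (!b) :=
    LF.HM_star _ _ _ (fun i b => by rw [← map_star, hXs]) (fun i b => by rw [← map_star, hQs]) hvs
  have hUm : ∀ i b, U i b * U i (!b) = 1 :=
    LF.HM_mul_inv _ _ _ (fun i b => by rw [← map_mul, hQ, map_sub, map_mul, map_one])
      (fun i b => by rw [← map_mul, hXQ, map_mul]) hvm
  refine ⟨D, hσ, hσf, hinj, hσι, fun i => U i true, ?_, LF.mat_tracial hσ,
    LF.mat_faithful hσ hσf, ?_, ?_⟩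
  · intro i
    constructor
    · rw [hUs]
      exact hUm i false
    · rw [hUs]
      exact hUm i true
  · rw [LF.lfree_iff]
    intro L hLg hne hev
    have hsg : LF.sg (fun i => U i true) = U := by
      funext i b
      cases b
      · simp [LF.sg, hUs]
      · simp [LF.sg]
    rw [hsg]
    have S : LF.Setting τ D.σ D.ι.toAlgHom X Q v E :=
      { τadd := LF.tr_sub' hτ
        τcomm := hτ.2.2.2
        σadd := LF.tr_add hσ
        σsub := LF.tr_sub' hσ
        σι := hσι
        hW := (LF.lfree_iff τ x).1 hL
        hs := hQ
        f1 := f1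
        f2 := f2
        f3 := f3 }
    have h0 : ∀ j, D.σ (LF.wd U L j j) = 0 := fun j => LF.diag_zero S j L hLg hne hev
    simp [h0]
  · intro i
    simp [U, LF.HM, X, LF.sg]
end

section
/- Let M be a unital C*-algebra with a faithful tracial state τ, let n ≥ 2, let (u₁, …, uₙ) be an L-free family of unitaries in M, and let α₁, …, αₙ ∈ ℂ with Σ_{i=1}^n |αᵢ|² ≤ 1. Then ‖Σ_{i=1}^n αᵢ uᵢ‖ ≤ 2√(1 − 1/n). -/
open scoped BigOperators ComplexOrder

namespace LFreeAux

section Algebraic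

variable {M : Type*} [Ring M] [StarRing M] [Algebra ℂ M]

/-- A letter, starred when the flag is `false`. -/
def V {n : ℕ} (u : Fin n → M) (s : Bool) (i : Fin n) : M := if s then u i else star (u i)

/-- Alternating word, first letter of type `s`. -/
def W {n : ℕ} (u : Fin n → M) : Bool → List (Fin n) → M
  | _, [] => 1
  | s, i :: w => V u s i * W u (!s) w

/-- Coefficient. -/
noncomputable def co {n : ℕ} (α : Fin n → ℂ) (s : Bool) (i : Fin n) : ℂ :=
  if s then α i else star (α i)

/-- The linear combination or its adjoint. -/
noncomputable def X {n : ℕ} (α : Fin n → ℂ) (u : Fin n → M) (s : Bool) : M :=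
  ∑ i, co α s i • V u s i

/-- Alternating product of length `m`. -/
noncomputable def L {n : ℕ} (α : Fin n → ℂ) (u : Fin n → M) : ℕ → Bool → M
  | 0, _ => 1
  | m + 1, s => L α u m (!s) * X α u (!s)

/-- Multiplicative weight. -/
noncomputable def f {n : ℕ} (ρ : Fin n → ℝ) (w : List (Fin n)) : ℝ := (w.map ρ).prod

lemma f_pos {n : ℕ} (ρ : Fin n → ℝ) (hρ : ∀ i, 0 < ρ i) (w : List (Fin n)) : 0 < f ρ w := by
  induction w with
  | nil => simp [f]
  | cons i w ih => simpa [f] using mul_pos (hρ i) ih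

lemma W_eq {n : ℕ} (u : Fin n → M) (w : List (Fin n)) : ∀ s : Bool,
    W u s w = (List.ofFn fun t : Fin w.length =>
      V u (if (t : ℕ) % 2 = 0 then s else !s) (w.get t)).prod := by
  induction w with
  | nil => intro s; simp [W]
  | cons i w ih =>
    intro s
    rw [W, ih]
    simp only [List.length_cons, List.ofFn_succ, List.prod_cons]
    congr 2
    congr 1
    funext t
    have : (((t : ℕ) + 1) % 2 = 0) ↔ ¬ ((t : ℕ) % 2 = 0) := by omega
    by_cases h : (t : ℕ) % 2 = 0 <;> simp [this, h]

lemma tau_W {n : ℕ} (τ : M → ℂ) (u : Fin n → M) (hL : IsLFree τ u) (s : Bool)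
    (w : List (Fin n)) (hw : w.IsChain (· ≠ ·)) (hne : w ≠ []) (he : Even w.length) :
    τ (W u s w) = 0 := by
  obtain ⟨k, hk⟩ := he
  have hk2 : 2 * k = w.length := by omega
  have hk1 : 1 ≤ k := by
    have := List.length_pos_iff.mpr hne
    omega
  have key := hL k hk1 (fun t => w.get (Fin.cast hk2 t)) (by
    intro a b hab
    have h := List.isChain_iff_getElem.mp hw a (by have := b.2; omega)
    simpa [hab] using h)
  have cst : ∀ F : Fin w.length → M, List.ofFn (fun t : Fin (2*k) => F (Fin.cast hk2 t))
      = List.ofFn F := by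
    intro F
    rw [List.ofFn_congr hk2.symm F]
  rw [W_eq, ← cst]
  cases s
  · rw [← key.2, LWordStar]
    congr 3
    funext t
    by_cases h : (t : ℕ) % 2 = 0 <;> simp [V, h]
  · rw [← key.1, LWord]
    congr 3
    funext t
    by_cases h : (t : ℕ) % 2 = 0 <;> simp [V, h]

lemma tau_zero (τ : M → ℂ) (hτ : IsTracialState τ) : τ 0 = 0 := by
  have := hτ.1 1 0 0
  simpa using this

/-- bundled functional -/
noncomputable def lin (τ : M → ℂ) (hτ : IsTracialState τ) : M →ₗ[ℂ] ℂ where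
  toFun := τ
  map_add' x y := by simpa using hτ.1 1 x y
  map_smul' c x := by simpa [tau_zero τ hτ] using hτ.1 c x 0

lemma bound {n : ℕ} (τ : M → ℂ) (hτ : IsTracialState τ) (u : Fin n → M)
    (hu : ∀ i, IsUnitary (u i)) (hL : IsLFree τ u) (α : Fin n → ℂ)
    (ρ : Fin n → ℝ) (hρ : ∀ i, 0 < ρ i) (c : ℝ) (hc0 : 0 ≤ c)
    (h0 : ∑ i, ‖α i‖ * ρ i ≤ c)
    (h1 : ∀ j, ∑ i, ‖α i‖ * ρ i + ‖α j‖ / ρ j - ‖α j‖ * ρ j ≤ c) :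
    ∀ (m : ℕ) (s : Bool) (w : List (Fin n)), w.IsChain (· ≠ ·) → Even (m + w.length) →
      ‖τ (L α u m s * W u s w)‖ ≤ c ^ m * f ρ w := by
  intro m
  induction m with
  | zero =>
    intro s w hw he
    by_cases hne : w = []
    · subst hne
      simp [L, W, f, hτ.2.1]
    · rw [L, one_mul, tau_W τ u hL s w hw hne (by simpa using he)]
      simpa using (f_pos ρ hρ w).le
  | succ m ih =>
    intro s w hw he
    have hco : ∀ s i, ‖co α s i‖ = ‖α i‖ := by
      intro s i; cases s <;> simp [co]
    have e1 : τ (L α u (m+1) s * W u s w)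
        = ∑ i, co α (!s) i * τ (L α u m (!s) * (V u (!s) i * W u s w)) := by
      have : L α u (m+1) s * W u s w
        = ∑ i, co α (!s) i • (L α u m (!s) * (V u (!s) i * W u s w)) := by
        rw [L, mul_assoc, X, Finset.sum_mul, Finset.mul_sum]
        refine Finset.sum_congr rfl fun i _ => ?_
        rw [smul_mul_assoc, mul_smul_comm]
      rw [this]
      change lin τ hτ _ = ∑ i, _ * lin τ hτ _
      rw [map_sum]
      simp
    have hcons : ∀ i, (i :: w).IsChain (· ≠ ·) →
        ‖τ (L α u m (!s) * (V u (!s) i * W u s w))‖ ≤ c ^ m * (ρ i * f ρ w) := by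
      intro i hi
      have := ih (!s) (i :: w) hi (by
        simp only [List.length_cons]; convert he using 1; ring)
      simpa [W, f] using this
    rw [e1]
    refine (norm_sum_le _ _).trans ?_
    simp only [norm_mul, hco]
    cases w with
    | nil =>
      calc _ ≤ ∑ i, ‖α i‖ * (c ^ m * (ρ i * f ρ [])) :=
            Finset.sum_le_sum fun i _ => by
              gcongr
              exact hcons i (by simp)
        _ = c ^ m * f ρ [] * ∑ i, ‖α i‖ * ρ i := by
            rw [Finset.mul_sum]; exact Finset.sum_congr rfl fun i _ => by ring
        _ ≤ c ^ m * f ρ [] * c := by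
            have := (f_pos ρ hρ []).le
            gcongr
        _ = _ := by ring
    | cons j w =>
      have hj : ‖τ (L α u m (!s) * (V u (!s) j * W u s (j :: w)))‖ ≤ c ^ m * f ρ w := by
        have e2 : V u (!s) j * W u s (j :: w) = W u (!s) w := by
          rw [W, ← mul_assoc]
          have : V u (!s) j * V u s j = 1 := by
            cases s
            · simpa [V] using (hu j).2
            · simpa [V] using (hu j).1
          rw [this, one_mul]
        rw [e2]
        refine ih _ _ hw.tail ?_
        simp only [List.length_cons] at he
        rw [show m + 1 + (w.length + 1) = (m + w.length) + 2 by ring] at he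
        simpa [Nat.even_add] using he
      have hfw : f ρ (j :: w) = ρ j * f ρ w := by simp [f]
      have hfp := f_pos ρ hρ w
      have hoth : ∀ i, ‖α i‖ * ‖τ (L α u m (!s) * (V u (!s) i * W u s (j :: w)))‖ ≤
          c ^ m * (ρ j * f ρ w) * (‖α i‖ * ρ i
            + if i = j then ‖α j‖ / ρ j - ‖α j‖ * ρ j else 0) := by
        intro i
        by_cases hij : i = j
        · subst hij
          have hρi := (hρ i).ne'
          calc _ ≤ ‖α i‖ * (c ^ m * f ρ w) := by gcongr
            _ = _ := by simp; field_simp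
        · have := hcons i (by simp [hij]; simpa using hw)
          calc _ ≤ ‖α i‖ * (c ^ m * (ρ i * f ρ (j :: w))) := by gcongr
            _ = _ := by simp [hij, hfw]; ring
      calc _ ≤ _ := Finset.sum_le_sum fun i _ => hoth i
        _ = c ^ m * (ρ j * f ρ w) * (∑ i, ‖α i‖ * ρ i + ‖α j‖ / ρ j - ‖α j‖ * ρ j) := by
            rw [← Finset.mul_sum, Finset.sum_add_distrib]
            simp; left; ring
        _ ≤ c ^ m * (ρ j * f ρ w) * c := by
            have := hρ j
            gcongr
            exact h1 j
        _ = _ := by rw [hfw]; ring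

lemma L_even {n : ℕ} (α : Fin n → ℂ) (u : Fin n → M) (s : Bool) (k : ℕ) :
    L α u (2 * k) s = (X α u s * X α u (!s)) ^ k := by
  induction k with
  | zero => simp [L]
  | succ k ih =>
    rw [show 2 * (k + 1) = 2 * k + 1 + 1 by ring, L, L, pow_succ, Bool.not_not, ih, mul_assoc]

end Algebraic

lemma norm_le {M : Type*} [CStarAlgebra M] (τ : M → ℂ) (hτ : IsTracialState τ)
    (hτf : IsFaithful τ) (h : M) (hh : IsSelfAdjoint h) (d : ℝ) (hd : 0 ≤ d)
    (hb : ∀ k : ℕ, ‖τ (h ^ (2 * k))‖ ≤ d ^ (2 * k)) : ‖h‖ ≤ d := by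
  by_contra! hlt
  obtain ⟨e, hde, heh⟩ := exists_between hlt
  have he : 0 < e := hd.trans_lt hde
  set g : ℝ → ℝ := fun t => max 0 (|t| - e) with hg
  have hgc : Continuous g := by fun_prop
  have sq : ∀ r : ℝ → ℝ, Continuous r → 0 ≤ τ (cfc (fun t => r t ^ 2) h) := by
    intro r hr
    have e1 : cfc (fun t => r t ^ 2) h = star (cfc r h) * cfc r h := by
      rw [(cfc_predicate r h : IsSelfAdjoint _).star_eq, ← cfc_mul r r h]
      simp only [pow_two]
    rw [e1]
    exact hτ.2.2.1 _
  have hG : cfc g h ≠ 0 := by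
    intro h0
    have : cfc g h = cfc (fun _ => (0:ℝ)) h := by rw [h0]; simp
    have hE := eqOn_of_cfc_eq_cfc (R := ℝ) this
    have : ‖cfc (id : ℝ → ℝ) h‖ ≤ e := by
      refine norm_cfc_le he.le fun t ht => ?_
      have := hE ht
      simp only [hg] at this
      have h2 := le_max_right 0 (|t| - e)
      rw [this] at h2
      simpa using h2
    rw [cfc_id ℝ h] at this
    linarith
  have hpos : 0 < (τ (cfc (fun t => g t ^ 2) h)).re := by
    have h1 := sq g hgc
    have h2 : τ (cfc (fun t => g t ^ 2) h) ≠ 0 := by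
      intro h0
      apply hG
      apply hτf
      rw [← h0, (cfc_predicate g h : IsSelfAdjoint _).star_eq, ← cfc_mul g g h]
      simp only [pow_two]
    exact (Complex.lt_def.mp (lt_of_le_of_ne h1 h2.symm)).1
  have key : ∀ k : ℕ, (τ (cfc (fun t => g t ^ 2) h)).re ≤ d ^ 2 * ((d / e) ^ 2) ^ k := by
    intro k
    have hnn : ∀ t, 0 ≤ t ^ (2 * (k + 1)) - e ^ (2 * k) * g t ^ 2 := by
      intro t
      simp only [hg]
      rw [sub_nonneg]
      have habs : t ^ (2 * (k+1)) = |t| ^ (2 * k) * |t| ^ 2 := by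
        rw [← pow_add, pow_mul, ← sq_abs, ← pow_mul]; ring_nf
      rw [habs]
      rcases le_total |t| e with hte | hte
      · rw [max_eq_left (by linarith)]
        simp; positivity
      · rw [max_eq_right (by linarith)]
        gcongr
        linarith
    have h1 := sq (fun t => Real.sqrt (t ^ (2 * (k + 1)) - e ^ (2 * k) * g t ^ 2)) (by fun_prop)
    have h1' : (fun t : ℝ => Real.sqrt (t ^ (2 * (k + 1)) - e ^ (2 * k) * g t ^ 2) ^ 2)
        = fun t => t ^ (2 * (k + 1)) - e ^ (2 * k) * g t ^ 2 :=
      funext fun t => Real.sq_sqrt (hnn t)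
    rw [h1'] at h1
    rw [cfc_sub (fun t : ℝ => t ^ (2 * (k + 1))) (fun t => e ^ (2 * k) * g t ^ 2) h,
      cfc_pow_id (R := ℝ) h, cfc_const_mul (e ^ (2 * k)) (fun t => g t ^ 2) h] at h1
    have h2 : τ (h ^ (2 * (k + 1)) - e ^ (2 * k) • cfc (fun t => g t ^ 2) h)
        = τ (h ^ (2 * (k + 1))) - ((e ^ (2 * k) : ℝ) : ℂ) * τ (cfc (fun t => g t ^ 2) h) := by
      change lin τ hτ _ = lin τ hτ _ - _ * lin τ hτ _
      rw [map_sub, ← Complex.coe_smul, map_smul, smul_eq_mul]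
    rw [h2] at h1
    have h3 := (Complex.le_def.mp h1).1
    rw [Complex.sub_re, Complex.re_ofReal_mul, Complex.zero_re] at h3
    have h4 := (Complex.re_le_norm _).trans (hb (k + 1))
    have h5 : e ^ (2 * k) * (τ (cfc (fun t => g t ^ 2) h)).re ≤ d ^ (2 * (k + 1)) := by linarith
    have h6 : d ^ 2 * ((d / e) ^ 2) ^ k = d ^ (2 * (k + 1)) / e ^ (2 * k) := by
      rw [← pow_mul, div_pow]; ring
    rw [h6, le_div_iff₀ (by positivity)]
    linarith
  have hlim : Filter.Tendsto (fun k : ℕ => d ^ 2 * ((d / e) ^ 2) ^ k) Filter.atTop (nhds 0) := by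
    have hde1 : d / e < 1 := (div_lt_one he).mpr hde
    have hde0 : 0 ≤ d / e := by positivity
    have := (tendsto_pow_atTop_nhds_zero_of_lt_one (r := (d / e) ^ 2) (by positivity)
      (by nlinarith)).const_mul (d ^ 2)
    simpa using this
  have := ge_of_tendsto' hlim key
  linarith

/-- Existence of the weights. -/
lemma weights {n : ℕ} (hn : 2 ≤ n) (a : Fin n → ℝ) (ha : ∀ i, 0 ≤ a i)
    (hs : ∑ i, a i ^ 2 ≤ 1) :
    ∃ ρ : Fin n → ℝ, (∀ i, 0 < ρ i) ∧
      ∑ i, a i * ρ i ≤ 2 * Real.sqrt (1 - 1 / (n : ℝ)) ∧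
      ∀ j, ∑ i, a i * ρ i + a j / ρ j - a j * ρ j ≤ 2 * Real.sqrt (1 - 1 / (n : ℝ)) := by
  set q := Real.sqrt (1 - 1 / (n : ℝ)) with hq
  have hn' : (2 : ℝ) ≤ n := by exact_mod_cast hn
  have hpos : (0 : ℝ) < 1 - 1 / (n : ℝ) := by
    rw [sub_pos, div_lt_one (by linarith)]; linarith
  have hq0 : 0 < q := Real.sqrt_pos.mpr hpos
  have hq2 : q ^ 2 = 1 - 1 / (n : ℝ) := Real.sq_sqrt hpos.le
  have hnq : n * q ^ 2 = n - 1 := by rw [hq2]; field_simp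
  set S : ℝ := 1 / (2 * q) with hS
  set s : ℝ := (n - 2) / n * S with hsdef
  have hS0 : 0 < S := by positivity
  have hs0 : 0 ≤ s := by
    have : (0:ℝ) ≤ (n - 2) / n := div_nonneg (by linarith) (by linarith)
    positivity
  have hsS : s < S := by
    have : ((n:ℝ) - 2) / n < 1 := by rw [div_lt_one (by linarith)]; linarith
    nlinarith
  have hns : n * s = (n - 2) * S := by rw [hsdef]; field_simp
  have hSq : S * q = 1 / 2 := by rw [hS]; field_simp
  have hS2 : (n - 1) * (4 * S ^ 2) = n := by
    rw [← hnq]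
    have : n * q ^ 2 * (4 * S ^ 2) = n * (4 * (S * q) ^ 2) := by ring
    rw [this, hSq]; ring
  have hrel : n * (S ^ 2 - s ^ 2) = 1 := by
    have hn0 : (n : ℝ) ≠ 0 := by linarith
    apply mul_left_cancel₀ hn0
    have : (n:ℝ) * (n * (S ^ 2 - s ^ 2)) = n ^ 2 * S ^ 2 - (n * s) ^ 2 := by ring
    rw [this, hns]
    linear_combination hS2
  set T : Fin n → ℝ := fun i => (s ^ 2 + a i ^ 2 + S ^ 2) / (2 * S) with hT
  have hTS : ∀ i, T i * (2 * S) = s ^ 2 + a i ^ 2 + S ^ 2 := fun i => by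
    simp only [hT]; field_simp
  have hTs : ∀ i, s < T i := fun i => by
    rw [hT, lt_div_iff₀ (by positivity)]
    nlinarith [sq_nonneg (a i), mul_pos (sub_pos.mpr hsS) (sub_pos.mpr hsS)]
  have hT2 : ∀ i, a i ^ 2 ≤ (T i + s) * (T i - s) := fun i => by
    nlinarith [hTS i, sq_nonneg (T i - S)]
  have hsumT : ∑ i, T i ≤ n * S := by
    have : (∑ i, T i) * (2 * S) = n * s ^ 2 + ∑ i, a i ^ 2 + n * S ^ 2 := by
      rw [Finset.sum_mul]
      simp only [hTS, Finset.sum_add_distrib]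
      simp
    nlinarith
  have hval : n * S - n * s + 2 * s ≤ 2 * q := by
    have h1 : n * S - n * s = 2 * S := by rw [hns]; ring
    rw [h1]
    have hn0 : (0 : ℝ) < n := by linarith
    have h2 : n * (2 * S + 2 * s) = 4 * (n - 1) * S := by linear_combination 2 * hns
    have h3 : n * (2 * q) = 4 * (n - 1) * S := by
      rw [← hnq]
      linear_combination (-4 * n * q) * hSq
    nlinarith
  refine ⟨fun i => if a i = 0 then 1 else (T i - s) / a i, ?_, ?_⟩
  · intro i
    by_cases h : a i = 0
    · simp [h]
    · have := (ha i).lt_of_ne' h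
      have := hTs i
      simp only [h, if_false]
      apply div_pos <;> linarith
  have hle : ∀ i, a i * (if a i = 0 then 1 else (T i - s) / a i) ≤ T i - s := by
    intro i
    by_cases h : a i = 0
    · have := hTs i
      simp [h]; linarith
    · simp only [h, if_false]
      rw [mul_div_cancel₀ _ h]
  have hsum : ∑ i, a i * (if a i = 0 then 1 else (T i - s) / a i) ≤ n * S - n * s := by
    refine (Finset.sum_le_sum fun i _ => hle i).trans ?_
    rw [Finset.sum_sub_distrib]
    simp
    linarith
  refine ⟨by linarith, fun j => ?_⟩
  suffices h : a j / (if a j = 0 then 1 else (T j - s) / a j)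
      - a j * (if a j = 0 then 1 else (T j - s) / a j) ≤ 2 * s by linarith
  by_cases h : a j = 0
  · simp [h]; linarith
  · simp only [h, if_false]
    rw [mul_div_cancel₀ _ h]
    have h1 : a j / ((T j - s) / a j) ≤ T j + s := by
      have := hTs j
      rw [div_div_eq_mul_div, div_le_iff₀ (by linarith)]
      have := hT2 j
      nlinarith
    linarith

end LFreeAux

open LFreeAux in
/-- An L-free family of `n ≥ 2` unitaries satisfies
`‖Σ αᵢ uᵢ‖ ≤ 2√(1 - 1/n)` whenever `Σ |αᵢ|² ≤ 1`. -/
theorem norm_comb_LFree_unitaries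
    {M : Type*} [NormedRing M] [StarRing M] [CStarRing M] [NormedAlgebra ℂ M]
    [StarModule ℂ M] [CompleteSpace M]
    (τ : M → ℂ) (hτ : IsTracialState τ) (hτf : IsFaithful τ)
    (n : ℕ) (hn : 2 ≤ n)
    (u : Fin n → M) (hu : ∀ i, IsUnitary (u i)) (hL : IsLFree τ u)
    (α : Fin n → ℂ) (hα : ∑ i, ‖α i‖ ^ 2 ≤ 1) :
    ‖∑ i, α i • u i‖ ≤ 2 * Real.sqrt (1 - 1 / (n : ℝ)) := by
  obtain ⟨ρ, hρ, h0, h1⟩ := weights hn (fun i => ‖α i‖) (fun i => norm_nonneg _) hα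
  set c := 2 * Real.sqrt (1 - 1 / (n : ℝ)) with hc
  have hc0 : 0 ≤ c := by positivity
  have hB := bound τ hτ u hu hL α ρ hρ c hc0 h0 h1
  set x := ∑ i, α i • u i with hx
  have hXt : X α u true = x := by simp [X, co, V, hx]
  have hXf : X α u false = star x := by simp [X, co, V, hx, star_sum, star_smul]
  have hle : ‖x * star x‖ ≤ c ^ 2 := by
    letI : CStarAlgebra M := { }
    refine norm_le τ hτ hτf (x * star x) (IsSelfAdjoint.mul_star_self x) (c ^ 2)
      (by positivity) fun k => ?_
    have := hB (2 * (2 * k)) true [] (by simp) (by simp)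
    rw [L_even, Bool.not_true, hXt, hXf] at this
    simpa [W, f, ← pow_mul] using this
  rw [CStarRing.norm_self_mul_star] at hle
  nlinarith [norm_nonneg x]
end

section
/- Let M be a unital C*-algebra with a faithful tracial state τ, let n ≥ 2, and let v₁, …, v_{n−1} ∈ M be freely independent Haar unitaries with respect to τ. Then ‖1 + v₁ + v₂ + ⋯ + v_{n−1}‖ = 2√(n−1). -/
open scoped BigOperators ComplexOrder

section HaarHelpers

set_option linter.unusedSectionVars false

open Finset

variable {A : Type*} [Ring A] [StarRing A] [Algebra ℂ A]

theorem IsTracialState.map_add {τ : A → ℂ} (h : IsTracialState τ) (x y : A) :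
    τ (x + y) = τ x + τ y := by
  have := h.1 1 x y
  simpa using this

theorem IsTracialState.map_zero {τ : A → ℂ} (h : IsTracialState τ) : τ 0 = 0 := by
  have := h.map_add 0 0
  simpa using this

theorem IsTracialState.map_smul {τ : A → ℂ} (h : IsTracialState τ) (c : ℂ) (x : A) :
    τ (c • x) = c * τ x := by
  have := h.1 c x 0
  simpa [h.map_zero] using this

theorem IsTracialState.map_natCast_mul {τ : A → ℂ} (h : IsTracialState τ) (c : ℕ) (x : A) :
    τ ((c : A) * x) = c * τ x := by
  have := h.map_smul (c : ℂ) x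
  rwa [Algebra.smul_def, map_natCast] at this

theorem IsTracialState.map_sum {τ : A → ℂ} (h : IsTracialState τ) {ι : Type*} (s : Finset ι)
    (f : ι → A) : τ (∑ i ∈ s, f i) = ∑ i ∈ s, τ (f i) := by
  classical
  induction s using Finset.induction_on with
  | empty => simp [h.map_zero]
  | insert a s ha ih => rw [Finset.sum_insert ha, Finset.sum_insert ha, h.map_add, ih]

/-- the letters: `v i` or its adjoint -/
def hLet {m : ℕ} (v : Fin m → A) (p : Bool) (i : Fin m) : A :=
  if p then v i else star (v i)

/-- letters including the unit -/
def hLetO {m : ℕ} (v : Fin m → A) (p : Bool) : Option (Fin m) → A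
  | none => 1
  | some i => hLet v p i

/-- sums of reduced alternating words of length `k + 1` with given first letter -/
def hV {m : ℕ} (v : Fin m → A) : ℕ → Bool → Option (Fin m) → A
  | 0, p, i => hLetO v p i
  | k + 1, p, i => hLetO v p i * ∑ j ∈ univ.erase i, hV v k (!p) j

def hW {m : ℕ} (v : Fin m → A) (p : Bool) : ℕ → A
  | 0 => 1
  | k + 1 => ∑ i, hV v k p i

def hA {m : ℕ} (v : Fin m → A) (p : Bool) : A := ∑ i, hLetO v p i

def hY {m : ℕ} (v : Fin m → A) : ℕ → Bool → A
  | 0, _ => 1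
  | N + 1, p => hY v N (!p) * hA v (!p)

/-- products of syllables with leading letter `(i, p)` -/
def hSyl {m : ℕ} (v : Fin m → A) (i : Fin m) (p : Bool) (x : A) : Prop :=
  ∃ (e : ℕ) (L : List (Fin m × ℤ)),
    (∀ z ∈ L, z.2 ≠ 0) ∧
    List.IsChain (fun a b : Fin m × ℤ => a.1 ≠ b.1)
      ((i, if p then ((e : ℤ) + 1) else -((e : ℤ) + 1)) :: L) ∧
    x = hLet v p i ^ (e + 1) * (L.map fun z => zpowU (v z.1) z.2).prod

theorem hSyl_zpow {m : ℕ} (v : Fin m → A) (i : Fin m) (p : Bool) (e : ℕ) :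
    zpowU (v i) (if p then ((e : ℤ) + 1) else -((e : ℤ) + 1)) = hLet v p i ^ (e + 1) := by
  cases p
  · have h : ¬ (0 ≤ -((e : ℤ) + 1)) := by omega
    have h2 : (((e : ℤ) + 1)).toNat = e + 1 := by omega
    simp only [Bool.false_eq_true, if_false, zpowU, hLet, h, neg_neg, h2]
  · have h : (0 ≤ ((e : ℤ) + 1)) := by omega
    have h2 : (((e : ℤ) + 1)).toNat = e + 1 := by omega
    simp only [if_true, zpowU, hLet, h, h2]

theorem hSyl_single {m : ℕ} (v : Fin m → A) (i : Fin m) (p : Bool) :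
    hSyl v i p (hLet v p i) :=
  ⟨0, [], by simp, by simp, by simp⟩

theorem hSyl_mul {m : ℕ} (v : Fin m → A) (i j : Fin m) (p q : Bool) (x : A)
    (h : hSyl v j q x) (hij : i ≠ j ∨ p = q) : hSyl v i p (hLet v p i * x) := by
  obtain ⟨e, L, h0, hc, rfl⟩ := h
  by_cases hh : i = j
  · subst hh
    have hpq : p = q := by simpa using hij
    subst hpq
    refine ⟨e + 1, L, h0, ?_, ?_⟩
    · cases L with
      | nil => simp
      | cons z L =>
        rw [List.isChain_cons_cons] at hc ⊢
        exact hc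
    · rw [pow_succ' _ (e + 1), mul_assoc]
  · refine ⟨0, (j, if q then ((e : ℤ) + 1) else -((e : ℤ) + 1)) :: L, ?_, ?_, ?_⟩
    · intro z hz
      rcases List.mem_cons.1 hz with rfl | hz
      · cases q <;> simp <;> omega
      · exact h0 z hz
    · rw [List.isChain_cons_cons]
      exact ⟨hh, hc⟩
    · rw [List.map_cons, List.prod_cons, hSyl_zpow]
      simp

theorem hSyl_trace {m : ℕ} (τ : A → ℂ) (v : Fin m → A) (hfree : AreHaarFree τ v)
    (i : Fin m) (p : Bool) (x : A) (h : hSyl v i p x) : τ x = 0 := by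
  obtain ⟨e, L, h0, hc, rfl⟩ := h
  set L' := (i, if p then ((e : ℤ) + 1) else -((e : ℤ) + 1)) :: L with hL'
  have key := hfree L'.length (by simp [hL']) (fun s => (L'.get s).1) (fun s => (L'.get s).2)
    (by
      intro s
      have hm : L'.get s ∈ L' := List.get_mem _ _
      rcases List.mem_cons.1 hm with h1 | h1
      · rw [h1]; cases p <;> simp <;> omega
      · exact h0 _ h1)
    (by
      intro s t hst
      have := List.isChain_iff_getElem.1 hc s.1 (by have := t.2; omega)
      simp only [List.get_eq_getElem]
      simp only [hst]
      exact this)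
  have e1 : (List.ofFn fun s : Fin L'.length => zpowU (v (L'.get s).1) (L'.get s).2)
      = L'.map fun z => zpowU (v z.1) z.2 := by
    clear_value L'
    apply List.ext_getElem <;> simp
  rw [e1, hL', List.map_cons, List.prod_cons, hSyl_zpow] at key
  exact key

def hS {m : ℕ} (v : Fin m → A) (i : Fin m) (p : Bool) : AddSubmonoid A :=
  AddSubmonoid.closure {x | hSyl v i p x}

theorem hS_mul {m : ℕ} (v : Fin m → A) (i j : Fin m) (p q : Bool) (x : A)
    (h : x ∈ hS v j q) (hij : i ≠ j ∨ p = q) : hLet v p i * x ∈ hS v i p := by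
  unfold hS at h
  induction h using AddSubmonoid.closure_induction with
  | mem x hx => exact AddSubmonoid.subset_closure (hSyl_mul v i j p q x hx hij)
  | zero => rw [mul_zero]; exact zero_mem _
  | add x y _ _ hx hy => rw [mul_add]; exact add_mem hx hy

theorem hS_trace {m : ℕ} (τ : A → ℂ) (hτ : IsTracialState τ) (v : Fin m → A)
    (hfree : AreHaarFree τ v)
    (i : Fin m) (p : Bool) (x : A) (h : x ∈ hS v i p) : τ x = 0 := by
  unfold hS at h
  induction h using AddSubmonoid.closure_induction with
  | mem x hx => exact hSyl_trace τ v hfree i p x hx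
  | zero => exact hτ.map_zero
  | add x y _ _ hx hy => rw [hτ.map_add, hx, hy, add_zero]

theorem sum_erase_none {m : ℕ} (f : Option (Fin m) → A) :
    ∑ j ∈ univ.erase none, f j = ∑ j, f (some j) := by
  have h1 := Finset.add_sum_erase univ f (Finset.mem_univ none)
  rw [Fintype.sum_option] at h1
  exact add_left_cancel h1

theorem hV_none {m : ℕ} (v : Fin m → A) (k : ℕ) (p : Bool) :
    hV v (k + 1) p none = ∑ j, hV v k (!p) (some j) := by
  rw [hV, sum_erase_none]
  simp [hLetO]

theorem hV_some_mem {m : ℕ} (v : Fin m → A) (k : ℕ) :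
    ∀ (p : Bool) (i : Fin m), hV v k p (some i) ∈ hS v i p := by
  induction k using Nat.strong_induction_on with
  | _ k ih =>
    intro p i
    cases k with
    | zero => exact AddSubmonoid.subset_closure (hSyl_single v i p)
    | succ k =>
      rw [hV, Finset.mul_sum]
      refine sum_mem ?_
      intro j hj
      have hj' : j ≠ some i := (Finset.mem_erase.1 hj).1
      cases j with
      | some j =>
        exact hS_mul v i j p (!p) _ (ih k (by omega) _ _) (Or.inl (fun h => hj' (by rw [h])))
      | none =>
        cases k with
        | zero =>
          have : hLetO v p (some i) * hV v 0 (!p) none = hLet v p i := by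
            simp [hV, hLetO]
          rw [this]
          exact AddSubmonoid.subset_closure (hSyl_single v i p)
        | succ k =>
          rw [hV_none, Finset.mul_sum]
          refine sum_mem ?_
          intro j _
          exact hS_mul v i j p (!!p) _ (ih k (by omega) _ _) (Or.inr (by simp))

theorem hV_trace {m : ℕ} (τ : A → ℂ) (hτ : IsTracialState τ) (v : Fin m → A)
    (hfree : AreHaarFree τ v) (k : ℕ) (p : Bool) (i : Option (Fin m)) :
    τ (hV v (k + 1) p i) = 0 := by
  cases i with
  | some i => exact hS_trace τ hτ v hfree i p _ (hV_some_mem v _ p i)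
  | none =>
    rw [hV_none, hτ.map_sum]
    exact Finset.sum_eq_zero fun j _ => hS_trace τ hτ v hfree j _ _ (hV_some_mem v _ _ j)

theorem hW_trace {m : ℕ} (τ : A → ℂ) (hτ : IsTracialState τ) (v : Fin m → A)
    (hfree : AreHaarFree τ v) (k : ℕ) (p : Bool) : τ (hW v p (k + 2)) = 0 := by
  rw [hW, hτ.map_sum]
  exact Finset.sum_eq_zero fun j _ => hV_trace τ hτ v hfree k p j

theorem hLetO_cancel {m : ℕ} (v : Fin m → A) (hv : ∀ i, IsUnitary (v i)) (p : Bool)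
    (i : Option (Fin m)) : hLetO v p i * hLetO v (!p) i = 1 := by
  cases i with
  | none => simp [hLetO]
  | some i => cases p <;> simp [hLetO, hLet, (hv i).1, (hv i).2]

theorem hA_mul_W0 {m : ℕ} (v : Fin m → A) (p : Bool) : hA v p * hW v (!p) 0 = hW v p 1 := by
  simp [hA, hW, hV]

theorem hA_mul_succ {m : ℕ} (v : Fin m → A) (p : Bool) (k : ℕ) :
    hA v p * hW v (!p) (k + 1)
      = hW v p (k + 2) + ∑ i, hLetO v p i * hV v k (!p) i := by
  rw [hA, Finset.sum_mul, hW, hW, ← Finset.sum_add_distrib]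
  refine Finset.sum_congr rfl fun i _ => ?_
  rw [hV, ← mul_add, Finset.sum_erase_add _ _ (Finset.mem_univ i)]

theorem hA_mul_W1 {m : ℕ} (v : Fin m → A) (hv : ∀ i, IsUnitary (v i)) (p : Bool) :
    hA v p * hW v (!p) 1 = hW v p 2 + ((m + 1 : ℕ) : A) * hW v p 0 := by
  rw [hA_mul_succ]
  congr 1
  simp [hV, hLetO_cancel v hv, hW]

theorem hA_mul_W2 {m : ℕ} (v : Fin m → A) (hv : ∀ i, IsUnitary (v i)) (p : Bool) (k : ℕ) :
    hA v p * hW v (!p) (k + 2) = hW v p (k + 3) + (m : A) * hW v p (k + 1) := by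
  rw [hA_mul_succ]
  congr 1
  have h1 : ∀ i, hLetO v p i * hV v (k + 1) (!p) i = hW v p (k + 1) - hV v k p i := by
    intro i
    rw [hV, ← mul_assoc, hLetO_cancel v hv, one_mul, Bool.not_not, hW, eq_sub_iff_add_eq,
      Finset.sum_erase_add _ _ (Finset.mem_univ i)]
  rw [Finset.sum_congr rfl fun i _ => h1 i, Finset.sum_sub_distrib]
  rw [Finset.sum_const, Finset.card_univ, Fintype.card_option, Fintype.card_fin, nsmul_eq_mul]
  change _ - hW v p (k + 1) = _
  push_cast
  noncomm_ring

/-- the numerical sequence -/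
def hd (m : ℕ) : ℕ → ℕ → ℕ
  | 0, 0 => 1
  | 0, _ + 1 => 0
  | N + 1, 0 => hd m N 1
  | N + 1, 1 => hd m N 2 + (m + 1) * hd m N 0
  | N + 1, j + 2 => hd m N (j + 3) + m * hd m N (j + 1)

theorem trace_hY_hW {m : ℕ} (τ : A → ℂ) (hτ : IsTracialState τ) (v : Fin m → A)
    (hv : ∀ i, IsUnitary (v i)) (hfree : AreHaarFree τ v) (N : ℕ) :
    ∀ (p : Bool) (j : ℕ), (N + j) % 2 = 0 → τ (hY v N p * hW v p j) = hd m N j := by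
  induction N with
  | zero =>
    intro p j hj
    match j with
    | 0 => simp [hY, hW, hd, hτ.2.1]
    | 1 => simp at hj
    | j + 2 => simp [hY, hd, hW_trace τ hτ v hfree]
  | succ N ih =>
    intro p j hj
    have comm : ∀ (c : ℕ) (x y : A), x * ((c : A) * y) = (c : A) * (x * y) := by
      intro c x y
      rw [← mul_assoc, ← mul_assoc, Nat.cast_comm]
    match j with
    | 0 =>
      have h := hA_mul_W0 v (!p)
      rw [Bool.not_not] at h
      rw [hY, mul_assoc, h, ih _ _ (by omega), hd]
    | 1 =>
      have h := hA_mul_W1 v hv (!p)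
      rw [Bool.not_not] at h
      rw [hY, mul_assoc, h, mul_add, hτ.map_add, comm, hτ.map_natCast_mul, ih _ _ (by omega),
        ih _ _ (by omega), hd]
      push_cast; ring
    | j + 2 =>
      have h := hA_mul_W2 v hv (!p) j
      rw [Bool.not_not] at h
      rw [hY, mul_assoc, h, mul_add, hτ.map_add, comm, hτ.map_natCast_mul, ih _ _ (by omega),
        ih _ _ (by omega), hd]
      push_cast; ring

theorem hY_even {m : ℕ} (v : Fin m → A) (k : ℕ) :
    hY v (2 * k) false = (hA v false * hA v true) ^ k := by
  induction k with
  | zero => simp [hY]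
  | succ k ih =>
    rw [show 2 * (k + 1) = 2 * k + 1 + 1 by ring, hY, hY, pow_succ, ← ih]
    simp [mul_assoc]

theorem trace_pow {m : ℕ} (τ : A → ℂ) (hτ : IsTracialState τ) (v : Fin m → A)
    (hv : ∀ i, IsUnitary (v i)) (hfree : AreHaarFree τ v) (k : ℕ) :
    τ ((star (1 + ∑ i, v i) * (1 + ∑ i, v i)) ^ k) = hd m (2 * k) 0 := by
  have h := trace_hY_hW τ hτ v hv hfree (2 * k) false 0 (by omega)
  rw [hY_even] at h
  have h1 : hA v true = 1 + ∑ i, v i := by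
    simp [hA, Fintype.sum_option, hLetO, hLet]
  have h2 : hA v false = star (1 + ∑ i, v i) := by
    simp [hA, Fintype.sum_option, hLetO, hLet]
  rw [h1, h2] at h
  simpa [hW] using h

theorem hd_upper_aux (m : ℕ) (hm : 1 ≤ m) (N : ℕ) :
    (hd m N 0 : ℝ) ≤ (2 * √m) ^ N ∧
    ∀ j, (hd m N (j + 1) : ℝ) ≤ 2 * (2 * √m) ^ N * √m ^ (j + 1) := by
  have hq : √(m : ℝ) ^ 2 = m := Real.sq_sqrt (by positivity)
  have hq0 : 0 ≤ √(m : ℝ) := Real.sqrt_nonneg _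
  have hm' : (1 : ℝ) ≤ m := by exact_mod_cast hm
  induction N with
  | zero =>
    refine ⟨by simp [hd], fun j => ?_⟩
    simp [hd]
  | succ N ih =>
    obtain ⟨h0, h1⟩ := ih
    set q := √(m : ℝ)
    have hP : 0 ≤ (2 * q) ^ N := by positivity
    refine ⟨?_, fun j => ?_⟩
    · have := h1 0
      rw [hd, pow_succ]
      simp only [zero_add, pow_one] at this
      linarith
    · match j with
      | 0 =>
        have h2 := h1 1
        rw [hd]
        push_cast
        have : ((m : ℝ) + 1) * hd m N 0 ≤ (m + 1) * (2 * q) ^ N := by gcongr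
        have e : 2 * (2 * q) ^ (N + 1) * q ^ (0 + 1) = 4 * m * (2 * q) ^ N := by
          rw [← hq]; ring
        have e2 : 2 * (2 * q) ^ N * q ^ (1 + 1) = 2 * m * (2 * q) ^ N := by
          rw [← hq]; ring
        rw [e]
        rw [e2] at h2
        norm_num at h2 ⊢
        nlinarith
      | j + 1 =>
        have h2 := h1 (j + 2)
        have h3 := h1 j
        rw [hd]
        push_cast
        have : (m : ℝ) * hd m N (j + 1) ≤ m * (2 * (2 * q) ^ N * q ^ (j + 1)) := by gcongr
        calc (hd m N (j + 3) : ℝ) + m * hd m N (j + 1)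
            ≤ 2 * (2 * q) ^ N * q ^ (j + 2 + 1) + m * (2 * (2 * q) ^ N * q ^ (j + 1)) :=
              add_le_add h2 this
          _ = _ := by rw [← hq]; ring

theorem hd_upper (m : ℕ) (hm : 1 ≤ m) (k : ℕ) : (hd m (2 * k) 0 : ℝ) ≤ (4 * m) ^ k := by
  have h := (hd_upper_aux m hm (2 * k)).1
  rwa [pow_mul, mul_pow, Real.sq_sqrt (by positivity), show (2 : ℝ) ^ 2 = 4 by norm_num] at h

/-- ballot numbers -/
def hb (j : ℕ) : ℕ → ℤ
  | 0 => 1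
  | i + 1 => (Nat.choose (j + 2 * i + 2) (i + 1) : ℤ) - Nat.choose (j + 2 * i + 2) i

theorem hb_succ (j i : ℕ) : hb (j + 1) (i + 1) = hb j (i + 1) + hb (j + 2) i := by
  cases i with
  | zero => simp [hb]; ring
  | succ i =>
    simp only [hb]
    rw [show j + 1 + 2 * (i + 1) + 2 = (j + 2 * i + 4) + 1 by ring,
      show j + 2 * (i + 1) + 2 = j + 2 * i + 4 by ring,
      show j + 2 + 2 * i + 2 = j + 2 * i + 4 by ring,
      Nat.choose_succ_succ' (j + 2 * i + 4) (i + 1), Nat.choose_succ_succ' (j + 2 * i + 4) i]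
    push_cast; ring

theorem hb_zero (i : ℕ) : hb 0 (i + 1) = hb 1 i := by
  cases i with
  | zero => simp [hb]
  | succ i =>
    simp only [hb]
    rw [show 0 + 2 * (i + 1) + 2 = (2 * i + 3) + 1 by ring,
      show 1 + 2 * i + 2 = 2 * i + 3 by ring,
      Nat.choose_succ_succ' (2 * i + 3) (i + 1), Nat.choose_succ_succ' (2 * i + 3) i]
    have : Nat.choose (2 * i + 3) (i + 1 + 1) = Nat.choose (2 * i + 3) (i + 1) :=
      Nat.choose_symm_of_eq_add (by ring)
    rw [this]
    push_cast; ring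

theorem hd_succ_ge (m N j : ℕ) : hd m N (j + 2) + m * hd m N j ≤ hd m (N + 1) (j + 1) := by
  cases j with
  | zero => rw [hd]; gcongr; omega
  | succ j => rw [hd]

theorem hd_lower_aux (m N : ℕ) : ∀ j i, j + 2 * i = N →
    (m : ℤ) ^ (i + j) * hb j i ≤ hd m N j := by
  induction N with
  | zero =>
    intro j i h
    obtain rfl : j = 0 := by omega
    obtain rfl : i = 0 := by omega
    simp [hb, hd]
  | succ N ih =>
    intro j i h
    match j, i with
    | 0, 0 => omega
    | 0, i + 1 =>
      have := ih 1 i (by omega)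
      rw [hb_zero, hd]
      exact this
    | j + 1, 0 =>
      have h1 := ih j 0 (by omega)
      have h2 := hd_succ_ge m N j
      have h3 : (hd m N (j + 2) : ℤ) + m * hd m N j ≤ hd m (N + 1) (j + 1) := by exact_mod_cast h2
      have h4 : (0 : ℤ) ≤ hd m N (j + 2) := by positivity
      have h5 := mul_le_mul_of_nonneg_left h1 (show (0 : ℤ) ≤ m by positivity)
      simp only [hb, mul_one, zero_add] at h5 ⊢
      rw [pow_succ']
      linarith
    | j + 1, i + 1 =>
      have h1 := ih j (i + 1) (by omega)
      have h1' := ih (j + 2) i (by omega)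
      have h2 := hd_succ_ge m N j
      have h3 : (hd m N (j + 2) : ℤ) + m * hd m N j ≤ hd m (N + 1) (j + 1) := by exact_mod_cast h2
      have h5 := mul_le_mul_of_nonneg_left h1 (show (0 : ℤ) ≤ m by positivity)
      rw [hb_succ]
      calc (m : ℤ) ^ (i + 1 + (j + 1)) * (hb j (i + 1) + hb (j + 2) i)
          = m ^ (i + (j + 2)) * hb (j + 2) i + m * (m ^ (i + 1 + j) * hb j (i + 1)) := by ring
        _ ≤ _ := by linarith

theorem hb_catalan (k : ℕ) : ((k : ℤ) + 2) * hb 0 (k + 1) = Nat.centralBinom (k + 1) := by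
  simp only [hb]
  rw [Nat.centralBinom, show 0 + 2 * k + 2 = 2 * (k + 1) by ring]
  have h := Nat.choose_succ_right_eq (2 * (k + 1)) k
  rw [show 2 * (k + 1) - k = k + 2 by omega] at h
  have h' : (Nat.choose (2 * (k + 1)) (k + 1) : ℤ) * (k + 1)
    = Nat.choose (2 * (k + 1)) k * (k + 2) := by exact_mod_cast h
  linarith

theorem hd_lower (m k : ℕ) :
    (4 * (m : ℝ)) ^ (k + 1) ≤ 2 * (k + 1) * (k + 2) * hd m (2 * (k + 1)) 0 := by
  have h1 := hd_lower_aux m (2 * (k + 1)) 0 (k + 1) (by ring)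
  have h2 := hb_catalan k
  have h3 := Nat.four_pow_le_two_mul_self_mul_centralBinom (k + 1) (by omega)
  have h3' : (4 : ℤ) ^ (k + 1) ≤ 2 * (k + 1) * Nat.centralBinom (k + 1) := by exact_mod_cast h3
  have h4 : (4 * (m : ℤ)) ^ (k + 1) ≤ 2 * (k + 1) * (k + 2) * hd m (2 * (k + 1)) 0 := by
    calc (4 * (m : ℤ)) ^ (k + 1) = m ^ (k + 1) * 4 ^ (k + 1) := by rw [mul_pow, mul_comm]
      _ ≤ m ^ (k + 1) * (2 * (k + 1) * Nat.centralBinom (k + 1)) := by gcongr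
      _ = 2 * (k + 1) * (k + 2) * (m ^ (k + 1 + 0) * hb 0 (k + 1)) := by
        rw [← h2]; ring
      _ ≤ _ := by gcongr
  exact_mod_cast h4

end HaarHelpers

section HaarAnalysis

variable {M : Type*} [CStarAlgebra M]

theorem trace_cfc_nonneg (τ : M → ℂ) (hτ : IsTracialState τ) (b : M)
    (f : ℝ → ℝ) (hf : Continuous f) (hf0 : ∀ t ∈ spectrum ℝ b, 0 ≤ f t) :
    0 ≤ τ (cfc f b) := by
  have hs : Continuous fun t => √(f t) := Real.continuous_sqrt.comp hf
  have h1 : cfc f b = star (cfc (fun t => √(f t)) b) * cfc (fun t => √(f t)) b := by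
    rw [(cfc_predicate (R := ℝ) (fun t => √(f t)) b : IsSelfAdjoint _).star_eq,
      ← cfc_mul _ _ b hs.continuousOn hs.continuousOn]
    refine cfc_congr fun t ht => ?_
    exact (Real.mul_self_sqrt (hf0 t ht)).symm
  rw [h1]
  exact hτ.2.2.1 _

theorem trace_cfc_eq_zero (τ : M → ℂ) (hτ : IsTracialState τ) (hτf : IsFaithful τ) (b : M)
    (hb : IsSelfAdjoint b)
    (f : ℝ → ℝ) (hf : Continuous f) (hf0 : ∀ t ∈ spectrum ℝ b, 0 ≤ f t)
    (h : τ (cfc f b) = 0) : ∀ t ∈ spectrum ℝ b, f t = 0 := by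
  have hs : Continuous fun t => √(f t) := Real.continuous_sqrt.comp hf
  have h1 : cfc f b = star (cfc (fun t => √(f t)) b) * cfc (fun t => √(f t)) b := by
    rw [(cfc_predicate (R := ℝ) (fun t => √(f t)) b : IsSelfAdjoint _).star_eq,
      ← cfc_mul _ _ b hs.continuousOn hs.continuousOn]
    refine cfc_congr fun t ht => ?_
    exact (Real.mul_self_sqrt (hf0 t ht)).symm
  rw [h1] at h
  have h2 := hτf _ h
  rw [h2, mul_zero, ← cfc_zero ℝ b, cfc_eq_cfc_iff_eqOn (ha := hb) (hf := hf.continuousOn)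
    (hg := continuous_zero.continuousOn)] at h1
  intro t ht
  simpa using h1 ht

theorem IsTracialState.map_sub {A : Type*} [Ring A] [StarRing A] [Algebra ℂ A]
    {τ : A → ℂ} (h : IsTracialState τ) (x y : A) :
    τ (x - y) = τ x - τ y := by
  have := h.map_add (x - y) y
  rw [sub_add_cancel] at this
  rw [this]; ring

/-- `τ (b ^ k)` through the functional calculus, scaled -/
theorem trace_cfc_pow (τ : M → ℂ) (hτ : IsTracialState τ) (b : M) (hb : IsSelfAdjoint b)
    (c : ℝ) (k : ℕ) : τ (cfc (fun t : ℝ => c * t ^ k) b) = c * τ (b ^ k) := by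
  rw [cfc_const_mul c (fun t : ℝ => t ^ k) b (by fun_prop), cfc_pow_id b k hb, ← hτ.map_smul]
  rfl

theorem trace_pow_le (τ : M → ℂ) (hτ : IsTracialState τ) (b : M) (hb : IsSelfAdjoint b)
    (hpos : ∀ t ∈ spectrum ℝ b, 0 ≤ t) (k : ℕ) (d : ℝ) (hd : τ (b ^ k) = d) :
    d ≤ ‖b‖ ^ k := by
  have h := trace_cfc_nonneg τ hτ b (fun t => ‖b‖ ^ k - 1 * t ^ k) (by fun_prop) (by
    intro t ht
    have h1 : ‖t‖ ≤ ‖b‖ := by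
      have := (norm_cfc_le_iff (𝕜 := ℝ) id b (norm_nonneg b) continuousOn_id hb).1
        (by rw [cfc_id ℝ b hb]) t ht
      simpa using this
    have h2 : t ≤ ‖b‖ := (le_abs_self t).trans h1
    have := pow_le_pow_left₀ (hpos t ht) h2 k
    simp only [one_mul]
    linarith)
  rw [cfc_sub (fun _ : ℝ => ‖b‖ ^ k) (fun t => 1 * t ^ k) b (by fun_prop) (by fun_prop),
    hτ.map_sub, trace_cfc_pow τ hτ b hb, cfc_const _ b hb, Algebra.algebraMap_eq_smul_one,
    hd] at h
  have h3 : τ ((‖b‖ ^ k) • (1 : M)) = ((‖b‖ ^ k : ℝ) : ℂ) := by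
    have := hτ.map_smul ((‖b‖ ^ k : ℝ) : ℂ) 1
    rw [hτ.2.1, mul_one] at this
    exact this
  rw [h3] at h
  have h4 : (0 : ℂ) ≤ ((‖b‖ ^ k - d : ℝ) : ℂ) := by
    push_cast at h ⊢
    simpa using h
  have := Complex.zero_le_real.1 h4
  linarith

theorem norm_le_of_trace_pow (τ : M → ℂ) (hτ : IsTracialState τ) (hτf : IsFaithful τ) (b : M)
    (hb : IsSelfAdjoint b) (hpos : ∀ t ∈ spectrum ℝ b, 0 ≤ t) (R : ℝ) (hR : 0 < R)
    (d : ℕ → ℝ) (hd : ∀ k, τ (b ^ k) = d k) (hdR : ∀ k, d k ≤ R ^ k) : ‖b‖ ≤ R := by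
  have key : ∀ t ∈ spectrum ℝ b, t ≤ R := by
    intro t0 ht0
    by_contra hlt
    push Not at hlt
    obtain ⟨S, hRS, hSt⟩ := exists_between hlt
    have hS : 0 < S := hR.trans hRS
    set g : ℝ → ℝ := fun t => min 1 (max 0 (t - S)) with hg
    have hgc : Continuous g := by fun_prop
    have hg0 : ∀ t, 0 ≤ g t := fun t => le_min zero_le_one (le_max_left _ _)
    have h0 := trace_cfc_nonneg τ hτ b g hgc (fun t _ => hg0 t)
    have hre : τ (cfc g b) = ((τ (cfc g b)).re : ℂ) := by
      apply Complex.ext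
      · simp
      · simpa using (Complex.le_def.1 h0).2.symm
    set r := (τ (cfc g b)).re with hr
    have hr0 : 0 ≤ r := by
      rw [hre] at h0
      exact Complex.zero_le_real.1 h0
    have hle : ∀ k : ℕ, r ≤ (R / S) ^ k := by
      intro k
      have h := trace_cfc_nonneg τ hτ b (fun t => (S ^ k)⁻¹ * t ^ k - g t) (by fun_prop) (by
        intro t ht
        have ht0 := hpos t ht
        by_cases hts : t ≤ S
        · have : g t = 0 := by
            simp only [hg]
            rw [max_eq_left (by linarith), min_eq_right zero_le_one]
          rw [this, sub_zero]
          positivity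
        · push Not at hts
          have h1 : g t ≤ 1 := min_le_left _ _
          have h2 : 1 ≤ (S ^ k)⁻¹ * t ^ k := by
            rw [inv_mul_eq_div, one_le_div (by positivity)]
            exact pow_le_pow_left₀ hS.le hts.le k
          linarith)
      rw [cfc_sub (fun t : ℝ => (S ^ k)⁻¹ * t ^ k) g b (by fun_prop) (hgc.continuousOn),
        hτ.map_sub, trace_cfc_pow τ hτ b hb, hd, hre] at h
      have h4 : (0 : ℂ) ≤ (((S ^ k)⁻¹ * d k - r : ℝ) : ℂ) := by
        push_cast at h ⊢
        exact h
      have h5 := Complex.zero_le_real.1 h4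
      have h6 : (S ^ k)⁻¹ * d k ≤ (S ^ k)⁻¹ * R ^ k :=
        mul_le_mul_of_nonneg_left (hdR k) (by positivity)
      rw [div_pow, div_eq_inv_mul]
      linarith
    have hlim := tendsto_pow_atTop_nhds_zero_of_lt_one (r := R / S) (by positivity)
      ((div_lt_one hS).2 hRS)
    have hr1 : r ≤ 0 := ge_of_tendsto' hlim hle
    have hz : τ (cfc g b) = 0 := by
      rw [hre, le_antisymm hr1 hr0]; simp
    have := trace_cfc_eq_zero τ hτ hτf b hb g hgc (fun t _ => hg0 t) hz t0 ht0
    have hpos' : 0 < g t0 := lt_min one_pos (lt_max_of_lt_right (by linarith))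
    linarith
  have := (norm_cfc_le_iff (𝕜 := ℝ) id b hR.le continuousOn_id hb).2 (by
    intro t ht
    simp only [id, Real.norm_eq_abs]
    rw [abs_of_nonneg (hpos t ht)]
    exact key t ht)
  rwa [cfc_id ℝ b hb] at this

theorem le_of_poly_growth (B R : ℝ) (hB : 0 ≤ B) (hR : 0 < R)
    (h : ∀ k : ℕ, R ^ (k + 1) ≤ 2 * (k + 1) * (k + 2) * B ^ (k + 1)) : R ≤ B := by
  by_contra hlt
  push Not at hlt
  have hlim : Filter.Tendsto (fun n : ℕ => 4 * ((n : ℝ) ^ 2 * (B / R) ^ n)) Filter.atTop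
      (nhds (4 * 0)) :=
    (tendsto_pow_const_mul_const_pow_of_abs_lt_one 2 (r := B / R) (by
      rw [abs_of_nonneg (by positivity)]
      exact (div_lt_one hR).2 hlt)).const_mul 4
  rw [mul_zero] at hlim
  have hle : ∀ᶠ n : ℕ in Filter.atTop, (1 : ℝ) ≤ 4 * ((n : ℝ) ^ 2 * (B / R) ^ n) := by
    filter_upwards [Filter.eventually_ge_atTop 1] with n hn
    obtain ⟨k, rfl⟩ : ∃ k, n = k + 1 := ⟨n - 1, by omega⟩
    have h1 := h k
    have h2 : (2 * ((k : ℝ) + 1) * (k + 2)) * B ^ (k + 1)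
        ≤ (4 * ((k : ℝ) + 1) ^ 2) * B ^ (k + 1) := by
      refine mul_le_mul_of_nonneg_right ?_ (by positivity)
      have : (0 : ℝ) ≤ k := by positivity
      nlinarith
    rw [div_pow, ← mul_div_assoc, ← mul_div_assoc, one_le_div (by positivity)]
    push_cast
    linarith
  have := le_of_tendsto_of_tendsto tendsto_const_nhds hlim hle
  linarith

theorem norm_haar_aux (τ : M → ℂ) (hτ : IsTracialState τ) (hτf : IsFaithful τ)
    (m : ℕ) (hm : 1 ≤ m) (v : Fin m → M) (hv : ∀ i, IsUnitary (v i)) (hfree : AreHaarFree τ v) :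
    ‖(1 : M) + ∑ i, v i‖ = 2 * √(m : ℝ) := by
  set a := (1 : M) + ∑ i, v i with ha
  have hb : IsSelfAdjoint (star a * a) := IsSelfAdjoint.star_mul_self a
  have hpos : ∀ t ∈ spectrum ℝ (star a * a), 0 ≤ t := spectrum_star_mul_self_nonneg
  have htr : ∀ k, τ ((star a * a) ^ k) = ((hd m (2 * k) 0 : ℝ) : ℂ) := by
    intro k
    rw [ha, trace_pow τ hτ v hv hfree k]
    simp
  have hm0 : (0 : ℝ) < m := by exact_mod_cast hm
  have h1 : ‖star a * a‖ ≤ 4 * m :=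
    norm_le_of_trace_pow τ hτ hτf _ hb hpos (4 * m) (by positivity) _ htr (hd_upper m hm)
  have h2 : 4 * (m : ℝ) ≤ ‖star a * a‖ := by
    refine le_of_poly_growth _ _ (norm_nonneg _) (by positivity) fun k => ?_
    refine (hd_lower m k).trans ?_
    have := trace_pow_le τ hτ _ hb hpos (k + 1) _ (htr (k + 1))
    gcongr
  have h3 := le_antisymm h1 h2
  rw [CStarRing.norm_star_mul_self] at h3
  have h4 : ‖a‖ = √(‖a‖ * ‖a‖) := (Real.sqrt_mul_self (norm_nonneg a)).symm
  rw [h4, h3, Real.sqrt_mul (by norm_num), show (4 : ℝ) = 2 ^ 2 by norm_num,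
    Real.sqrt_sq (by norm_num)]

end HaarAnalysis

/-- (Akemann–Ostrand) For freely independent Haar unitaries
`v₁, …, v_{n-1}` one has `‖1 + v₁ + ⋯ + v_{n-1}‖ = 2√(n-1)`. -/
theorem norm_one_add_sum_haar_unitaries
    {M : Type*} [NormedRing M] [StarRing M] [CStarRing M] [NormedAlgebra ℂ M]
    [StarModule ℂ M] [CompleteSpace M]
    (τ : M → ℂ) (hτ : IsTracialState τ) (hτf : IsFaithful τ)
    (n : ℕ) (hn : 2 ≤ n)
    (v : Fin (n - 1) → M) (hv : ∀ i, IsUnitary (v i)) (hfree : AreHaarFree τ v) :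
    ‖(1 : M) + ∑ i, v i‖ = 2 * Real.sqrt ((n : ℝ) - 1) := by
  letI : CStarAlgebra M := {}
  have h := norm_haar_aux τ hτ hτf (n - 1) (by omega) v hv hfree
  rw [Nat.cast_sub (by omega), Nat.cast_one] at h
  exact h
end
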